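/- Let L = F_q with q = 2^n and let f ∈ L[x] be a polynomial of degree 4e with e ≡ 3 (mod 4). Suppose that no polynomial of the form (x+y)(y+z)(z+x) + P(x,y,z), where P(x,y,z) = c_1(x^2+y^2+z^2) + c_4(xy+xz+yz) + b_1(x+y+z) + d with c_1, c_4, b_1, d ∈ F_{q^3}, divides φ(x,y,z). Then there exists N such that for all m ≥ N, the function induced by f on F_{q^m} is not APN. -/

import Mathlib

open MvPolynomial

/-- A function `f : L → L` on a finite field is APN (almost perfect nonlinear) if
for all `a ≠ 0` and all `b`, the equation `f (x + a) + f x = b` has at most 2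
solutions `x` (in characteristic 2, `+` and `-` coincide). -/
def IsAPN {L : Type} [Field L] [Fintype L] (f : L → L) : Prop :=
  ∀ a b : L, a ≠ 0 → Set.ncard {x : L | f (x + a) + f x = b} ≤ 2

/-- The polynomial `(x+y)(x+z)(y+z)` in `L[x,y,z]` (variables `X 0, X 1, X 2`). -/
noncomputable def delta3 (L : Type) [CommRing L] : MvPolynomial (Fin 3) L :=
  (X 0 + X 1) * (X 0 + X 2) * (X 1 + X 2)

/-- The numerator `f(x) + f(y) + f(z) + f(x+y+z)` of `φ`, as an element of `L[x,y,z]`. -/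
noncomputable def phiNum {L : Type} [CommRing L] (f : Polynomial L) :
    MvPolynomial (Fin 3) L :=
  Polynomial.aeval (X 0 : MvPolynomial (Fin 3) L) f +
    Polynomial.aeval (X 1 : MvPolynomial (Fin 3) L) f +
    Polynomial.aeval (X 2 : MvPolynomial (Fin 3) L) f +
    Polynomial.aeval (X 0 + X 1 + X 2 : MvPolynomial (Fin 3) L) f

/-- `f ∈ L[x]` eventually fails to be APN on every extension `F_{q^m}` of `L = F_q`:
there is `N` such that for all `m ≥ N` and every extension `M` of `L` with
`|M| = q^m`, the function induced by `f` on `M` is not APN. -/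
def NotAPNOnAllLargeExtensions {L : Type} [Field L] [Fintype L] (f : Polynomial L) : Prop :=
  ∃ N : ℕ, ∀ m : ℕ, N ≤ m → ∀ (M : Type) [Field M] [Fintype M], ∀ e : L →+* M,
    Fintype.card M = Fintype.card L ^ m →
      ¬ IsAPN (fun x => Polynomial.eval x (f.map e))

/-- A polynomial of degree less than `M * #s` in each variable that vanishes to order `M` (in each
variable) at every point of the grid `s ^ r` is zero. -/
theorem MvPolynomial.eq_zero_of_forall_mem_span_pow {k : Type*} [Field k] (s : Finset k) (M : ℕ) :
    ∀ (r : ℕ) (G : MvPolynomial (Fin r) k),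
      (∀ x : Fin r → k, (∀ i, x i ∈ s) →
        G ∈ Ideal.span (Set.range fun i => (X i - C (x i) : MvPolynomial (Fin r) k) ^ M)) →
      (∀ i, degreeOf i G < M * s.card) → G = 0 := by
  intro r
  induction r with
  | zero =>
    intro G hG _
    simpa using hG Fin.elim0 (fun i => i.elim0)
  | succ r ih =>
    intro G hG hdeg
    have key : ∀ n, (finSuccEquiv k r G).coeff n = 0 := by
      intro n
      refine ih _ (fun x hx => ?_) (fun i => (degreeOf_coeff_finSuccEquiv G i n).trans_lt
        (hdeg i.succ))
      set I : Ideal (MvPolynomial (Fin r) k) :=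
        Ideal.span (Set.range fun i => (X i - C (x i) : MvPolynomial (Fin r) k) ^ M) with hI
      let π : MvPolynomial (Fin r) k →+* MvPolynomial (Fin r) k ⧸ I := Ideal.Quotient.mk I
      have hdvd : (∏ c ∈ s, (Polynomial.X - Polynomial.C (π (C c)) :
          Polynomial (MvPolynomial (Fin r) k ⧸ I)) ^ M) ∣
          (finSuccEquiv k r G).map π := by
        refine Finset.prod_dvd_of_coprime (R := Polynomial (MvPolynomial (Fin r) k ⧸ I))
          (fun a _ b _ hab => ?_) (fun c hc => ?_)
        · refine IsCoprime.pow (Polynomial.isCoprime_X_sub_C_of_isUnit_sub ?_)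
          rw [← map_sub, ← map_sub]
          exact ((isUnit_iff_ne_zero.2 (sub_ne_zero.2 hab)).map (C : k →+* _)).map π
        · let F : MvPolynomial (Fin (r + 1)) k →+* Polynomial (MvPolynomial (Fin r) k ⧸ I) :=
            (Polynomial.mapRingHom π).comp (finSuccEquiv k r).toRingEquiv.toRingHom
          have h1 := Ideal.mem_map_of_mem F (hG (Fin.cons c x) (fun i => by
            refine Fin.cases ?_ (fun j => ?_) i
            · simpa using hc
            · simpa using hx j))
          rw [Ideal.map_span] at h1
          have h2 : F G ∈ Ideal.span
              {(Polynomial.X - Polynomial.C (π (C c)) :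
                Polynomial (MvPolynomial (Fin r) k ⧸ I)) ^ M} := by
            refine (Ideal.span_le.2 ?_) h1
            rintro _ ⟨_, ⟨i, rfl⟩, rfl⟩
            refine Fin.cases ?_ (fun j => ?_) i
            · refine Ideal.subset_span ?_
              simp [F, finSuccEquiv_apply]
            · have : π ((X j - C (x j)) ^ M) = 0 :=
                Ideal.Quotient.eq_zero_iff_mem.2 (Ideal.subset_span ⟨j, rfl⟩)
              have h3 : F ((X j.succ - C ((Fin.cons c x : Fin (r+1) → k) j.succ)) ^ M) =
                  Polynomial.C (π ((X j - C (x j)) ^ M)) := by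
                simp [F, finSuccEquiv_apply]
              simp only [h3, this, map_zero]
              exact Ideal.zero_mem _
          exact Ideal.mem_span_singleton.1 h2
      have hmon : (∏ c ∈ s, (Polynomial.X - Polynomial.C (π (C c)) :
          Polynomial (MvPolynomial (Fin r) k ⧸ I)) ^ M).Monic :=
        Polynomial.monic_prod_of_monic _ _ fun c _ => (Polynomial.monic_X_sub_C _).pow M
      have hz : (finSuccEquiv k r G).map π = 0 := by
        by_cases hnt : Nontrivial (MvPolynomial (Fin r) k ⧸ I)
        · by_contra hne
          refine Polynomial.Monic.not_dvd_of_natDegree_lt hmon hne ?_ hdvd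
          rw [Polynomial.natDegree_prod_of_monic _ _ fun c _ => (Polynomial.monic_X_sub_C _).pow M]
          simp only [(Polynomial.monic_X_sub_C _).natDegree_pow, Polynomial.natDegree_X_sub_C,
            mul_one, Finset.sum_const, smul_eq_mul]
          refine (Polynomial.natDegree_map_le).trans_lt ?_
          rw [natDegree_finSuccEquiv, mul_comm]
          exact hdeg 0
        · have : Subsingleton (MvPolynomial (Fin r) k ⧸ I) := not_nontrivial_iff_subsingleton.1 hnt
          exact Subsingleton.elim _ _
      have := congrArg (fun q => Polynomial.coeff q n) hz
      simpa [Polynomial.coeff_map, π, Ideal.Quotient.eq_zero_iff_mem] using this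
    have : finSuccEquiv k r G = 0 := Polynomial.ext (by simpa using key)
    simpa using this

/-- A nonzero element of an affine domain over an algebraically closed field does not vanish at
some rational point. -/
theorem IsAlgClosed.exists_algHom_apply_ne_zero (k : Type*) [Field k] [IsAlgClosed k] {S : Type*}
    [CommRing S] [IsDomain S] [Algebra k S] [Algebra.FiniteType k S] {c : S} (hc : c ≠ 0) :
    ∃ ψ : S →ₐ[k] k, ψ c ≠ 0 := by
  have hJ : IsJacobsonRing S := isJacobsonRing_of_finiteType (A := k)
  have hbot : (⊥ : Ideal S).jacobson = ⊥ := hJ.out (Ideal.isRadical_bot)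
  have hcn : c ∉ (⊥ : Ideal S).jacobson := by simpa [hbot] using hc
  rw [Ideal.jacobson, Ideal.mem_sInf] at hcn
  push Not at hcn
  obtain ⟨J, ⟨-, hJm⟩, hcJ⟩ := hcn
  let : Field (S ⧸ J) := Ideal.Quotient.field J
  have : Module.Finite k (S ⧸ J) := finite_of_finite_type_of_isJacobsonRing k (S ⧸ J)
  let e : k ≃ₐ[k] S ⧸ J := AlgEquiv.ofBijective (Algebra.ofId k (S ⧸ J))
    IsAlgClosed.algebraMap_bijective_of_isIntegral
  refine ⟨(e.symm : S ⧸ J →ₐ[k] k).comp (Ideal.Quotient.mkₐ k J), ?_⟩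
  simpa [Ideal.Quotient.eq_zero_iff_mem] using hcJ

/-- The `k`-algebra homomorphism `X i ↦ x i + X i`, the Taylor expansion at the point `x`. -/
noncomputable def MvPolynomial.taylorAt (k : Type*) [Field k] {ι S : Type*} [CommRing S]
    [Algebra k S] (x : ι → S) : MvPolynomial ι k →+* MvPolynomial ι S :=
  (aeval fun i => C (x i) + X i : MvPolynomial ι k →ₐ[k] MvPolynomial ι S).toRingHom

theorem MvPolynomial.map_taylorAt {k : Type*} [Field k] {ι S T : Type*} [CommRing S]
    [Algebra k S] [CommRing T] [Algebra k T] (ψ : S →ₐ[k] T) (x : ι → S) (a : MvPolynomial ι k) :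
    MvPolynomial.map (ψ : S →+* T) (taylorAt k x a) = taylorAt k (fun i => ψ (x i)) a := by
  induction a using MvPolynomial.induction_on with
  | C c => simp [taylorAt, MvPolynomial.algebraMap_apply]
  | add a b ha hb => simp [ha, hb]
  | mul_X a i ha => simp [ha]; simp [taylorAt]

theorem Polynomial.map_taylorAt {k : Type*} [Field k] {ι S T : Type*} [CommRing S]
    [Algebra k S] [CommRing T] [Algebra k T] (ψ : S →ₐ[k] T) (x : ι → S)
    (p : Polynomial (MvPolynomial ι k)) :
    (p.map (taylorAt k x)).map (MvPolynomial.map (ψ : S →+* T)) =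
      p.map (taylorAt k (fun i => ψ (x i))) := by
  rw [Polynomial.map_map]
  congr 1
  refine RingHom.ext fun a => ?_
  exact MvPolynomial.map_taylorAt ψ x a

/-- The Taylor expansion at a rational point as an automorphism. -/
noncomputable def MvPolynomial.taylorEquiv {k : Type*} [Field k] {ι : Type*} (x : ι → k) :
    MvPolynomial ι k ≃ₐ[k] MvPolynomial ι k :=
  AlgEquiv.ofAlgHom (aeval fun i => C (x i) + X i) (aeval fun i => C (-x i) + X i)
    (by ext i; simp) (by ext i; simp)

/-- A monic prime polynomial over `k[X₁, …, Xᵣ]`, with `k` algebraically closed, stays prime after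
extending scalars to an affine domain and translating. -/
theorem Polynomial.Monic.prime_map_taylorAt {k : Type*} [Field k] [IsAlgClosed k] {r : ℕ}
    {p : Polynomial (MvPolynomial (Fin r) k)} (hm : p.Monic) (hp : Prime p) {S : Type*}
    [CommRing S] [IsDomain S] [Algebra k S] [Algebra.FiniteType k S] (x : Fin r → S) :
    Prime (p.map (taylorAt k x)) := by
  have hpm := hm.map (taylorAt k x)
  refine ⟨hpm.ne_zero, fun hu => ?_, fun a b hab => ?_⟩
  · have h1 := hpm.isUnit_iff.1 hu
    have h2 : p.natDegree = 0 := by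
      rw [← hm.natDegree_map (taylorAt k x), h1]
      simp
    exact hp.not_isUnit (by rw [hm.natDegree_eq_zero.1 h2]; exact isUnit_one)
  · by_contra! hcon
    obtain ⟨ha, hb⟩ := hcon
    rw [← Polynomial.modByMonic_eq_zero_iff_dvd hpm] at ha hb
    obtain ⟨i, hi⟩ := Polynomial.support_nonempty.2 ha
    obtain ⟨j, hj⟩ := Polynomial.support_nonempty.2 hb
    rw [Polynomial.mem_support_iff] at hi hj
    obtain ⟨m, hmi⟩ := MvPolynomial.ne_zero_iff.1 hi
    obtain ⟨n, hnj⟩ := MvPolynomial.ne_zero_iff.1 hj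
    obtain ⟨ψ, hψ⟩ := IsAlgClosed.exists_algHom_apply_ne_zero k (mul_ne_zero hmi hnj)
    rw [map_mul, mul_ne_zero_iff] at hψ
    have hprime : Prime (p.map (taylorAt k (fun i => ψ (x i)))) := by
      have e : ∀ e : MvPolynomial (Fin r) k ≃+* MvPolynomial (Fin r) k,
          Prime (p.map (e : MvPolynomial (Fin r) k →+* MvPolynomial (Fin r) k)) := fun e =>
        (MulEquiv.prime_iff (Polynomial.mapEquiv e).toMulEquiv).2 hp
      exact e (MvPolynomial.taylorEquiv fun i => ψ (x i)).toRingEquiv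
    have hdvd := Polynomial.map_dvd (MvPolynomial.map (ψ : S →+* k)) hab
    rw [Polynomial.map_taylorAt, Polynomial.map_mul] at hdvd
    have aux : ∀ c : Polynomial (MvPolynomial (Fin r) S),
        (p.map (taylorAt k (fun i => ψ (x i)))) ∣
          c.map (MvPolynomial.map (ψ : S →+* k)) →
        ∀ i m, ψ (((c %ₘ (p.map (taylorAt k x))).coeff i).coeff m) = 0 := by
      intro c hc i m
      rw [← Polynomial.modByMonic_eq_zero_iff_dvd (hm.map _), ← Polynomial.map_taylorAt,
        ← Polynomial.map_modByMonic _ hpm] at hc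
      have := congrArg (fun q => (Polynomial.coeff q i).coeff m) hc
      simpa [Polynomial.coeff_map, MvPolynomial.coeff_map] using this
    rcases hprime.dvd_or_dvd hdvd with h | h
    · exact hψ.1 (aux _ h _ _)
    · exact hψ.2 (aux _ h _ _)

/-- A polynomial that is not a multiple of `g` (monic, prime) divides, modulo `g`, a nonzero
element of any subring over which everything is integral. -/
theorem Polynomial.exists_ne_zero_dvd_sub {A B : Type*} [CommRing A] [CommRing B] [Algebra A B]
    [Algebra.IsIntegral A B] [Nontrivial A] {g α : Polynomial B} (hm : g.Monic) (hg : Prime g)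
    (hα : ¬ g ∣ α) :
    ∃ n : A, n ≠ 0 ∧ ∃ β γ : Polynomial B, Polynomial.C (algebraMap A B n) = α * β + g * γ := by
  have : IsDomain (AdjoinRoot g) := AdjoinRoot.isDomain_of_prime hg
  have hα' : AdjoinRoot.mk g α ≠ 0 := by rwa [Ne, AdjoinRoot.mk_eq_zero]
  have hfin : Module.Finite B (AdjoinRoot g) := hm.finite_adjoinRoot
  have hint : Algebra.IsIntegral A (AdjoinRoot g) := Algebra.IsIntegral.trans B
  have hne := Ideal.comap_ne_bot_of_integral_mem (R := A) hα'
    (Ideal.mem_span_singleton_self _) (Algebra.IsIntegral.isIntegral _)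
  obtain ⟨n, hn, hn0⟩ := Submodule.exists_mem_ne_zero_of_ne_bot hne
  refine ⟨n, hn0, ?_⟩
  rw [Ideal.mem_comap, Ideal.mem_span_singleton] at hn
  obtain ⟨b, hb⟩ := hn
  obtain ⟨β, rfl⟩ := AdjoinRoot.mk_surjective b
  rw [IsScalarTower.algebraMap_apply A B (AdjoinRoot g), AdjoinRoot.algebraMap_eq,
    ← AdjoinRoot.mk_C, ← map_mul, AdjoinRoot.mk_eq_mk] at hb
  obtain ⟨γ, hγ⟩ := hb
  exact ⟨β, γ, by linear_combination hγ⟩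

/-- If an algebra `N` over an Artinian algebra `T` is generated as a module by `1, δ, …, δ ^ d`, and
`δ ^ (d + 1)` is a combination of `δ, …, δ ^ d` modulo the Jacobson radical, then the eventual image
of multiplication by `δ` has dimension at most `d * dim T`. -/
theorem exists_finrank_range_mulLeft_pow_le {F T N : Type*} [Field F] [CommRing T] [CommRing N]
    [Algebra F T] [Algebra F N] [Algebra T N] [IsScalarTower F T N] [Module.Finite F T]
    (I : Ideal T) (hI : I ≤ Ideal.jacobson ⊥) (δ : N) (d : ℕ)
    (htop : Submodule.span T (Set.range fun j : Fin (d + 1) => δ ^ (j : ℕ)) = ⊤)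
    (hrel : δ ^ (d + 1) ∈ Submodule.span T (Set.range fun j : Fin d => δ ^ (j + 1 : ℕ)) ⊔
      I • (⊤ : Submodule T N)) :
    ∃ s, Module.finrank F (LinearMap.range (LinearMap.mulLeft F (δ ^ s))) ≤
      d * Module.finrank F T := by
  have hfinT : Module.Finite T N :=
    ⟨(htop ▸ Submodule.fg_span (Set.finite_range _) : (⊤ : Submodule T N).FG)⟩
  have hfinF : Module.Finite F N := Module.Finite.trans T N
  have hart : IsArtinian F N := inferInstance
  have hartN : IsArtinian N N := isArtinian_of_tower F hart
  obtain ⟨s, y, hy⟩ := IsArtinian.exists_pow_succ_smul_dvd δ (1 : N)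
  simp only [smul_eq_mul, mul_one] at hy
  refine ⟨s, ?_⟩
  set V : Submodule T N := LinearMap.range (LinearMap.mulLeft T (δ ^ s)) with hV
  set U : Submodule T N := Submodule.span T (Set.range fun j : Fin d => δ ^ (s + 1 + j : ℕ)) with hU
  have hmap : ∀ W : Submodule T N, W.map (LinearMap.mulLeft T (δ ^ s)) ≤ V :=
    fun W => LinearMap.map_le_range
  have hVle : V ≤ U ⊔ I • V := by
    rintro _ ⟨x, rfl⟩
    have h1 : LinearMap.mulLeft T (δ ^ s) x = δ ^ (s + 1) * (y * x) := by
      simp only [LinearMap.mulLeft_apply, ← hy, mul_assoc]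
    rw [h1]
    have h2 : y * x ∈ Submodule.span T (Set.range fun j : Fin (d + 1) => δ ^ (j : ℕ)) :=
      htop ▸ Submodule.mem_top
    have h3 := Submodule.mem_map_of_mem (f := LinearMap.mulLeft T (δ ^ (s + 1))) h2
    refine (?_ : Submodule.map _ _ ≤ _) h3
    rw [Submodule.map_span, Submodule.span_le]
    rintro _ ⟨_, ⟨j, rfl⟩, rfl⟩
    simp only [LinearMap.mulLeft_apply, ← pow_add]
    refine Fin.lastCases ?_ (fun i => ?_) j
    · have h4 := Submodule.mem_map_of_mem (f := LinearMap.mulLeft T (δ ^ s)) hrel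
      rw [Submodule.map_sup, Submodule.map_smul'', Submodule.map_span] at h4
      have h5 : (LinearMap.mulLeft T (δ ^ s)) (δ ^ (d + 1)) =
          δ ^ (s + 1 + (Fin.last d : ℕ)) := by
        simp [← pow_add]; ring
      rw [h5] at h4
      refine sup_le_sup ?_ (Submodule.smul_mono le_rfl (hmap _)) h4
      rw [Submodule.span_le]
      rintro _ ⟨_, ⟨i, rfl⟩, rfl⟩
      refine Submodule.subset_span ⟨i, ?_⟩
      simp only [LinearMap.mulLeft_apply, ← pow_add]
      ring
    · exact Submodule.mem_sup_left (Submodule.subset_span ⟨i, by simp⟩)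
  have hart' : IsNoetherian T N := isNoetherian_of_tower F inferInstance
  have hVU : V ≤ U := Submodule.le_of_le_smul_of_le_jacobson_bot (IsNoetherian.noetherian V) hI hVle
  have hle : LinearMap.range (LinearMap.mulLeft F (δ ^ s)) ≤ LinearMap.range
      ((Fintype.linearCombination T fun j : Fin d => δ ^ (s + 1 + j : ℕ)).restrictScalars F) := by
    rintro _ ⟨x, rfl⟩
    have : δ ^ s * x ∈ U := hVU ⟨x, rfl⟩
    rw [hU, ← Fintype.range_linearCombination] at this
    exact this
  calc _ ≤ _ := Submodule.finrank_mono hle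
    _ ≤ Module.finrank F (Fin d → T) := LinearMap.finrank_range_le _
    _ = _ := by simp [Module.finrank_pi_fintype]

theorem MvPolynomial.mem_span_range_X_pow_iff {R ι : Type*} [CommRing R] {M : ℕ}
    {g : MvPolynomial ι R} :
    g ∈ Ideal.span (Set.range fun i => (X i : MvPolynomial ι R) ^ M) ↔
      ∀ m : ι →₀ ℕ, (∀ i, m i < M) → coeff m g = 0 := by
  have : (Set.range fun i => (X i : MvPolynomial ι R) ^ M) =
      (fun s => monomial s (1 : R)) '' Set.range fun i => Finsupp.single i M := by
    ext; simp [X_pow_eq_monomial]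
  rw [this, mem_ideal_span_monomial_image]
  simp only [Set.exists_range_iff, Finsupp.single_le_iff, mem_support_iff]
  refine forall_congr' fun m => ?_
  rw [← not_imp_not]
  push Not
  rfl

theorem MvPolynomial.finrank_quotient_span_X_pow_le (F : Type*) [Field F] (r M : ℕ) :
    Module.Finite F (MvPolynomial (Fin r) F ⧸
      Ideal.span (Set.range fun i => (X i : MvPolynomial (Fin r) F) ^ M)) ∧
    Module.finrank F (MvPolynomial (Fin r) F ⧸
      Ideal.span (Set.range fun i => (X i : MvPolynomial (Fin r) F) ^ M)) ≤ M ^ r := by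
  set I := Ideal.span (Set.range fun i => (X i : MvPolynomial (Fin r) F) ^ M) with hI
  let Φ := Fintype.linearCombination F fun k : Fin r → Fin M => Ideal.Quotient.mk I
    (monomial (Finsupp.equivFunOnFinite.symm fun i => (k i : ℕ)) (1 : F))
  have hΦ : Function.Surjective Φ := by
    rw [← LinearMap.range_eq_top, Fintype.range_linearCombination, eq_top_iff]
    rintro x -
    obtain ⟨g, rfl⟩ := Ideal.Quotient.mk_surjective x
    rw [g.as_sum, map_sum]
    refine Submodule.sum_mem _ fun m _ => ?_
    by_cases hm : ∀ i, m i < M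
    · have : Ideal.Quotient.mk I (monomial m (coeff m g)) =
          coeff m g • Ideal.Quotient.mk I (monomial (Finsupp.equivFunOnFinite.symm
            fun i => (((fun i => ⟨m i, hm i⟩ : Fin r → Fin M) i : Fin M) : ℕ)) (1 : F)) := by
        rw [← Ideal.Quotient.mkₐ_eq_mk F, ← map_smul, smul_monomial, smul_eq_mul, mul_one]
        congr 3
        ext; rfl
      rw [this]
      exact Submodule.smul_mem _ _ (Submodule.subset_span ⟨_, rfl⟩)
    · have : Ideal.Quotient.mk I (monomial m (coeff m g)) = 0 := by
        rw [Ideal.Quotient.eq_zero_iff_mem, hI, mem_span_range_X_pow_iff]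
        intro n hn
        rw [coeff_monomial, if_neg]
        rintro rfl
        exact hm hn
      rw [this]
      exact Submodule.zero_mem _
  refine ⟨Module.Finite.of_surjective Φ hΦ, ?_⟩
  simpa using LinearMap.finrank_le_finrank_of_surjective (f := Φ) hΦ

/-- The polynomial of degree less than `n` in the last variable and at most `κ` in each of the
other variables with coefficients `a`. -/
noncomputable def Polynomial.ofBox {R : Type*} [CommRing R] {r n κ : ℕ}
    (a : Fin n × (Fin r → Fin (κ + 1)) → R) : Polynomial (MvPolynomial (Fin r) R) :=
  ∑ j : Fin n, Polynomial.monomial (j : ℕ) (∑ k : Fin r → Fin (κ + 1),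
    MvPolynomial.monomial (Finsupp.equivFunOnFinite.symm fun i => (k i : ℕ)) (a (j, k)))

theorem Polynomial.coeff_ofBox {R : Type*} [CommRing R] {r n κ : ℕ}
    (a : Fin n × (Fin r → Fin (κ + 1)) → R) (j : ℕ) :
    (Polynomial.ofBox a).coeff j = if h : j < n then ∑ k : Fin r → Fin (κ + 1),
      MvPolynomial.monomial (Finsupp.equivFunOnFinite.symm fun i => (k i : ℕ)) (a (⟨j, h⟩, k))
      else 0 := by
  simp only [Polynomial.ofBox, Polynomial.finsetSum_coeff, Polynomial.coeff_monomial]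
  split_ifs with h
  · rw [Finset.sum_eq_single ⟨j, h⟩] <;> simp +contextual [Fin.ext_iff]
  · refine Finset.sum_eq_zero fun i _ => if_neg ?_
    omega

theorem Polynomial.map_ofBox {R S : Type*} [CommRing R] [CommRing S] {r n κ : ℕ}
    (a : Fin n × (Fin r → Fin (κ + 1)) → R) (ψ : R →+* S) :
    (Polynomial.ofBox a).map (MvPolynomial.map ψ) = Polynomial.ofBox fun i => ψ (a i) := by
  simp [Polynomial.ofBox, Polynomial.map_sum]

theorem Polynomial.ofBox_ne_zero {R : Type*} [CommRing R] {r n κ : ℕ}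
    {a : Fin n × (Fin r → Fin (κ + 1)) → R} (ha : a ≠ 0) : Polynomial.ofBox a ≠ 0 := by
  contrapose! ha
  funext ⟨j, k⟩
  have := congrArg (fun p => MvPolynomial.coeff (Finsupp.equivFunOnFinite.symm fun i => (k i : ℕ))
    (Polynomial.coeff p j)) ha
  simp only [Polynomial.coeff_ofBox, j.2, dif_pos, MvPolynomial.coeff_sum,
    MvPolynomial.coeff_monomial, Polynomial.coeff_zero, MvPolynomial.coeff_zero] at this
  rw [Finset.sum_eq_single k] at this
  · simpa using this
  · intro k' _ hk'
    refine if_neg fun h => hk' ?_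
    funext i
    have := DFunLike.congr_fun h i
    simpa [Fin.ext_iff] using this
  · simp

theorem Polynomial.degree_ofBox_lt {R : Type*} [CommRing R] {r n κ : ℕ}
    (a : Fin n × (Fin r → Fin (κ + 1)) → R) : (Polynomial.ofBox a).degree < n := by
  rw [Polynomial.degree_lt_iff_coeff_zero]
  intro j hj
  rw [Polynomial.coeff_ofBox, dif_neg (by omega)]

theorem Polynomial.ofBox_smul {R : Type*} [CommRing R] {r n κ : ℕ} (c : R)
    (a : Fin n × (Fin r → Fin (κ + 1)) → R) :
    Polynomial.ofBox (c • a) = Polynomial.C (MvPolynomial.C c) * Polynomial.ofBox a := by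
  simp [Polynomial.ofBox, Finset.mul_sum, Polynomial.C_mul_monomial, MvPolynomial.C_mul_monomial]

/-- Over a field, if `p(t, Z)` is monic in `Z` of degree `d + 1` with `p(0, y) = 0`, then some
nonzero small polynomial `α` satisfies `(Z - y) ^ s * α ≡ 0` modulo `p` and high powers of `t`. -/
theorem Polynomial.Monic.exists_ofBox_of_field {F : Type*} [Field F] {r d : ℕ}
    {p : Polynomial (MvPolynomial (Fin r) F)} (hp : p.Monic) (hd : p.natDegree = d + 1) (y : F)
    (hy : MvPolynomial.constantCoeff (p.eval (MvPolynomial.C y)) = 0) {M κ : ℕ} (hM : 0 < M)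
    (hκ : d * M ^ r < (d + 1) * (κ + 1) ^ r) :
    ∃ s, ∃ a : Fin (d + 1) × (Fin r → Fin (κ + 1)) → F, a ≠ 0 ∧ ∀ j (m : Fin r →₀ ℕ),
      (∀ i, m i < M) → MvPolynomial.coeff m ((((Polynomial.X - Polynomial.C (MvPolynomial.C y)) ^ s *
        Polynomial.ofBox a) %ₘ p).coeff j) = 0 := by
  set J := Ideal.span (Set.range fun i => (MvPolynomial.X i : MvPolynomial (Fin r) F) ^ M) with hJ
  let T := MvPolynomial (Fin r) F ⧸ J
  let π : MvPolynomial (Fin r) F →+* T := Ideal.Quotient.mk J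
  obtain ⟨hfin, hrank⟩ := MvPolynomial.finrank_quotient_span_X_pow_le F r M
  have hJ0 : J ≤ RingHom.ker (MvPolynomial.constantCoeff (R := F) (σ := Fin r)) := by
    rw [hJ, Ideal.span_le]
    rintro _ ⟨i, rfl⟩
    simp [RingHom.mem_ker, hM.ne']
  have hnt : Nontrivial T := (Ideal.Quotient.lift J MvPolynomial.constantCoeff hJ0).domain_nontrivial
  have hpT := hp.map π
  have hdT : (p.map π).natDegree = d + 1 := by rw [hp.natDegree_map, hd]
  set N := AdjoinRoot (p.map π) with hN
  let I : Ideal T := (RingHom.ker (MvPolynomial.constantCoeff (R := F) (σ := Fin r))).map π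
  have hI : I ≤ Ideal.jacobson ⊥ := by
    refine le_trans (Ideal.map_le_iff_le_comap.2 fun g hg => ?_)
      (Ideal.radical_le_jacobson (I := (⊥ : Ideal T)))
    change π g ∈ nilradical T
    have h1 : g ∈ Ideal.span (Set.range fun i => (MvPolynomial.X i : MvPolynomial (Fin r) F) ^ 1) := by
      rw [MvPolynomial.mem_span_range_X_pow_iff]
      intro m hm
      obtain rfl : m = 0 := by ext i; simpa using hm i
      exact hg
    refine (Ideal.span_le (I := (nilradical T).comap π)).2 ?_ h1
    rintro _ ⟨i, rfl⟩
    refine mem_nilradical.2 ⟨M, ?_⟩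
    simp only [pow_one]
    rw [← map_pow]
    exact Ideal.Quotient.eq_zero_iff_mem.2 (Ideal.subset_span ⟨i, rfl⟩)
  set yT : T := π (MvPolynomial.C y)
  set δ : N := AdjoinRoot.mk _ (Polynomial.X - Polynomial.C yT) with hδ
  have htay : ∀ g : Polynomial T, AdjoinRoot.mk (p.map π) g = ∑ i ∈ Finset.range (g.natDegree + 1),
      (Polynomial.taylor yT g).coeff i • δ ^ i := by
    intro g
    conv_lhs => rw [← Polynomial.sum_taylor_eq g yT,
      Polynomial.sum_over_range _ (by simp), Polynomial.natDegree_taylor, map_sum]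
    refine Finset.sum_congr rfl fun i _ => ?_
    rw [map_mul, map_pow, ← hδ]
    exact (Algebra.smul_def ((Polynomial.taylor yT g).coeff i) (δ ^ i)).symm
  have htop : Submodule.span T (Set.range fun j : Fin (d + 1) => δ ^ (j : ℕ)) = ⊤ := by
    rw [eq_top_iff]
    rintro x -
    obtain ⟨g, rfl⟩ := AdjoinRoot.mk_surjective x
    have h1 : AdjoinRoot.mk (p.map π) g = AdjoinRoot.mk (p.map π) (g %ₘ p.map π) := by
      rw [AdjoinRoot.mk_eq_mk]
      exact ⟨g /ₘ p.map π, by linear_combination -Polynomial.modByMonic_add_div g (p.map π)⟩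
    rw [h1, htay]
    refine Submodule.sum_mem _ fun i hi => Submodule.smul_mem _ _ (Submodule.subset_span ?_)
    have h2 := Polynomial.natDegree_modByMonic_lt g hpT (by
      intro h; rw [h] at hdT; simp at hdT)
    rw [Finset.mem_range] at hi
    exact ⟨⟨i, by omega⟩, rfl⟩
  have hrel : δ ^ (d + 1) ∈ Submodule.span T (Set.range fun j : Fin d => δ ^ (j + 1 : ℕ)) ⊔
      I • (⊤ : Submodule T N) := by
    have h1 := htay (p.map π)
    rw [AdjoinRoot.mk_self, hdT, Finset.sum_range_succ, Finset.sum_range_succ'] at h1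
    have h2 : (Polynomial.taylor yT (p.map π)).coeff (d + 1) = 1 := by
      rw [← hdT, Polynomial.coeff_taylor_natDegree, hpT.leadingCoeff]
    have h3 : (Polynomial.taylor yT (p.map π)).coeff 0 ∈ I := by
      rw [Polynomial.taylor_coeff_zero, Polynomial.eval_map_apply]
      exact Ideal.mem_map_of_mem _ hy
    rw [h2, one_smul] at h1
    rw [eq_neg_of_add_eq_zero_right h1.symm]
    refine Submodule.neg_mem _ (Submodule.add_mem_sup (Submodule.sum_mem _ fun i hi => ?_)
      (Submodule.smul_mem_smul h3 Submodule.mem_top))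
    exact Submodule.smul_mem _ _ (Submodule.subset_span ⟨⟨i, Finset.mem_range.1 hi⟩, rfl⟩)
  obtain ⟨s, hs⟩ := exists_finrank_range_mulLeft_pow_le (F := F) I hI δ d htop hrel
  let Ψ : (Fin (d + 1) × (Fin r → Fin (κ + 1)) → F) →ₗ[F] N :=
    { toFun := fun a => AdjoinRoot.mk (p.map π) ((Polynomial.ofBox a).map π)
      map_add' := fun a b => by
        rw [← map_add, ← Polynomial.map_add]
        congr 2
        simp [Polynomial.ofBox, Finset.sum_add_distrib]
      map_smul' := fun c a => by
        rw [Polynomial.ofBox_smul, Polynomial.map_mul, map_mul, Polynomial.map_C, Algebra.smul_def]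
        rfl }
  have hfinN : Module.Finite F N := by
    have : Module.Finite T N := hpT.finite_adjoinRoot
    exact Module.Finite.trans T N
  have hker := LinearMap.ker_ne_bot_of_finrank_lt
    (f := (LinearMap.mulLeft F (δ ^ s)).rangeRestrict ∘ₗ Ψ) (by
      refine hs.trans_lt ((Nat.mul_le_mul_left d hrank).trans_lt ?_)
      simpa using hκ)
  obtain ⟨a, ha, ha0⟩ := Submodule.exists_mem_ne_zero_of_ne_bot hker
  refine ⟨s, a, ha0, fun j m hm => ?_⟩
  have h1 : δ ^ s * Ψ a = 0 := congrArg Subtype.val (LinearMap.mem_ker.1 ha)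
  have h2 : AdjoinRoot.mk (p.map π) (((Polynomial.X - Polynomial.C (MvPolynomial.C y)) ^ s *
      Polynomial.ofBox a).map π) = 0 := by
    rw [← h1]
    simp [Ψ, hδ, yT]
  rw [AdjoinRoot.mk_eq_zero, ← Polynomial.modByMonic_eq_zero_iff_dvd hpT,
    ← Polynomial.map_modByMonic _ hp] at h2
  have h3 := congrArg (fun q => Polynomial.coeff q j) h2
  simp only [Polynomial.coeff_map, Polynomial.coeff_zero] at h3
  exact MvPolynomial.mem_span_range_X_pow_iff.1 (Ideal.Quotient.eq_zero_iff_mem.1 h3) m hm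

theorem MvPolynomial.exists_forall_eval_X_pow_sub_X_ne_zero {k ι : Type*} [Field k]
    {n : MvPolynomial ι (MvPolynomial ι k)} (hn : n ≠ 0) :
    ∃ N, ∀ Q, N ≤ Q → eval (fun i => (X i : MvPolynomial ι k) ^ Q - X i) n ≠ 0 := by
  classical
  set n' : MvPolynomial ι (MvPolynomial ι k) := aeval (fun i => X i - C (X i)) n with hn'
  have hback : aeval (fun i => X i + C (X i) : ι → MvPolynomial ι (MvPolynomial ι k)) n' = n := by
    rw [hn', ← AlgHom.comp_apply]
    conv_rhs => rw [← AlgHom.id_apply (R := MvPolynomial ι k) n]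
    congr 1
    ext i
    simp [← algebraMap_eq]
  have hn'0 : n' ≠ 0 := by
    intro h
    rw [h, map_zero] at hback
    exact hn hback.symm
  obtain ⟨m, hm⟩ := ne_zero_iff.1 hn'0
  obtain ⟨u, hu⟩ := ne_zero_iff.1 hm
  refine ⟨(n'.support.sup fun m => (coeff m n').totalDegree) + 1, fun Q hQ h0 => hu ?_⟩
  have h1 : eval (fun i => (X i : MvPolynomial ι k) ^ Q) n' = 0 := by
    have h2 : (eval fun i => (X i : MvPolynomial ι k) ^ Q).comp
        (aeval fun i => X i - C (X i) : MvPolynomial ι (MvPolynomial ι k) →ₐ[MvPolynomial ι k]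
          MvPolynomial ι (MvPolynomial ι k)).toRingHom = eval fun i => X i ^ Q - X i := by
      refine ringHom_ext (fun a => ?_) (fun i => ?_) <;> simp [← algebraMap_eq]
    rw [← h0, ← h2]
    rfl
  have h2 := congrArg (coeff (Q • m + u)) h1
  have hlt : ∀ m, m ∈ n'.support → ∀ v ∈ (coeff m n').support, ∀ i, v i < Q := by
    intro m hm v hv i
    have h3 : (coeff m n').totalDegree ≤ n'.support.sup fun m => (coeff m n').totalDegree :=
      Finset.le_sup (f := fun m => (coeff m n').totalDegree) hm
    have h4 := degreeOf_le_totalDegree (coeff m n') i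
    have h5 := monomial_le_degreeOf i hv
    omega
  rw [eval_eq, coeff_sum, coeff_zero, Finset.sum_eq_single m] at h2
  · have h3 : ∏ i ∈ m.support, ((X i : MvPolynomial ι k) ^ Q) ^ m i = monomial (Q • m) 1 := by
      rw [monomial_eq, map_one, one_mul, Finsupp.prod_of_support_subset _
        Finsupp.support_smul _ (by simp)]
      simp [pow_mul]
    rw [h3, mul_comm, coeff_monomial_mul, one_mul] at h2
    exact h2
  · intro m' hm' hne
    have h3 : ∏ i ∈ m'.support, ((X i : MvPolynomial ι k) ^ Q) ^ m' i = monomial (Q • m') 1 := by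
      rw [monomial_eq, map_one, one_mul, Finsupp.prod_of_support_subset _
        Finsupp.support_smul _ (by simp)]
      simp [pow_mul]
    rw [h3, mul_comm, coeff_monomial_mul', one_mul]
    split_ifs with hle
    · by_contra hv
      refine hne ?_
      ext i
      have hv' := hlt m' hm' _ (mem_support_iff.2 hv) i
      have hu' := hlt m (mem_support_iff.2 hm) _ (mem_support_iff.2 hu) i
      have hle' := hle i
      simp only [Finsupp.coe_tsub, Finsupp.coe_add, Finsupp.coe_smul, Pi.sub_apply, Pi.add_apply,
        Pi.smul_apply, smul_eq_mul] at hv' hle'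
      have h6 : (Q * m i + u i) / Q = m i := by
        rw [Nat.mul_add_div (by omega), Nat.div_eq_of_lt hu', add_zero]
      have h7 : (Q * m i + u i) / Q = m' i := by
        obtain ⟨w, hw⟩ := Nat.exists_eq_add_of_le hle'
        rw [hw, Nat.mul_add_div (by omega), Nat.div_eq_of_lt (by omega), add_zero]
      omega
    · rfl
  · intro h
    exact absurd (mem_support_iff.2 hm) h

theorem Polynomial.degreeOf_coeff_modByMonic_le {R ι : Type*} [CommRing R] [Nontrivial R]
    {g : Polynomial (MvPolynomial ι R)} (hm : g.Monic) {d c : ℕ} (hd : g.natDegree = d + 1) {i : ι}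
    (hc : ∀ j, MvPolynomial.degreeOf i (g.coeff j) ≤ c) :
    ∀ (N D : ℕ) (G : Polynomial (MvPolynomial ι R)), G.natDegree ≤ d + N →
      (∀ j, MvPolynomial.degreeOf i (G.coeff j) ≤ D) →
      ∀ j, MvPolynomial.degreeOf i ((G %ₘ g).coeff j) ≤ D + c * N := by
  intro N
  induction N with
  | zero =>
    intro D G hG hD j
    rw [(Polynomial.modByMonic_eq_self_iff hm).2]
    · simpa using hD j
    · exact Polynomial.degree_lt_degree (by omega)
  | succ N ih =>
    intro D G hG hD j
    set b := G.coeff (d + 1 + N) with hb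
    have h1 : G %ₘ g = (G - Polynomial.C b * Polynomial.X ^ N * g) %ₘ g := by
      rw [Polynomial.sub_modByMonic, Polynomial.mul_self_modByMonic hm, sub_zero]
    rw [h1]
    refine (ih (D + c) _ ?_ ?_ j).trans (by rw [Nat.mul_succ]; omega)
    · have h2 : (Polynomial.C b * Polynomial.X ^ N * g).natDegree ≤ d + 1 + N := by
        refine (Polynomial.natDegree_mul_le).trans ?_
        have := Polynomial.natDegree_C_mul_X_pow_le b N
        omega
      refine Polynomial.natDegree_le_iff_coeff_eq_zero.2 fun l hl => ?_
      rcases (show l = d + 1 + N ∨ d + 1 + N < l by omega) with rfl | hl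
      · have h3 : (Polynomial.C b * Polynomial.X ^ N * g).coeff (d + 1 + N) = b := by
          rw [mul_assoc, Polynomial.coeff_C_mul, Polynomial.coeff_X_pow_mul, ← hd,
            hm.coeff_natDegree, mul_one]
        rw [Polynomial.coeff_sub, h3, ← hb, sub_self]
      · rw [Polynomial.coeff_sub, Polynomial.coeff_eq_zero_of_natDegree_lt (by omega),
          Polynomial.coeff_eq_zero_of_natDegree_lt (by omega), sub_zero]
    · intro l
      rw [Polynomial.coeff_sub]
      refine (MvPolynomial.degreeOf_sub_le _ _ _).trans (max_le ((hD l).trans (by omega)) ?_)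
      rw [mul_assoc, Polynomial.coeff_C_mul, mul_comm _ g]
      refine (MvPolynomial.degreeOf_mul_le _ _ _).trans (add_le_add (hD _) ?_)
      rw [Polynomial.coeff_mul_X_pow']
      split_ifs
      · exact hc _
      · simp

/-- The version of `Polynomial.Monic.exists_ofBox_of_field` over a domain. -/
theorem Polynomial.Monic.exists_ofBox {S : Type*} [CommRing S] [IsDomain S] {r d : ℕ}
    {p : Polynomial (MvPolynomial (Fin r) S)} (hp : p.Monic) (hd : p.natDegree = d + 1) (y : S)
    (hy : MvPolynomial.constantCoeff (p.eval (MvPolynomial.C y)) = 0) {M κ : ℕ} (hM : 0 < M)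
    (hκ : d * M ^ r < (d + 1) * (κ + 1) ^ r) :
    ∃ s, ∃ a : Fin (d + 1) × (Fin r → Fin (κ + 1)) → S, a ≠ 0 ∧ ∀ j (m : Fin r →₀ ℕ),
      (∀ i, m i < M) → MvPolynomial.coeff m ((((Polynomial.X -
        Polynomial.C (MvPolynomial.C y)) ^ s * Polynomial.ofBox a) %ₘ p).coeff j) = 0 := by
  let F := FractionRing S
  let ψ : S →+* F := algebraMap S F
  have hψ : Function.Injective ψ := IsFractionRing.injective S F
  obtain ⟨s, a, ha, hs⟩ := (hp.map (MvPolynomial.map ψ)).exists_ofBox_of_field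
    (by rw [hp.natDegree_map, hd]) (ψ y) (by
      rw [← MvPolynomial.map_C, Polynomial.eval_map_apply, MvPolynomial.constantCoeff_map, hy,
        map_zero]) hM hκ
  obtain ⟨b, hb⟩ := IsLocalization.exist_integer_multiples_of_finite (nonZeroDivisors S) a
  choose a' ha' using hb
  have hbF : ψ b ≠ 0 := by
    rw [Ne, map_eq_zero_iff ψ hψ]
    exact nonZeroDivisors.ne_zero b.2
  have hsmul : (fun i => ψ (a' i)) = ψ b • a := by
    funext i
    rw [show ψ (a' i) = _ from ha' i]
    exact Algebra.smul_def _ _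
  refine ⟨s, a', ?_, fun j m hm => ?_⟩
  · rintro rfl
    refine ha ?_
    have h0 : ψ b • a = 0 := by rw [← hsmul]; funext i; simp
    exact (smul_eq_zero.1 h0).resolve_left hbF
  · refine hψ ?_
    rw [map_zero, ← MvPolynomial.coeff_map, ← Polynomial.coeff_map, Polynomial.map_modByMonic _ hp,
      Polynomial.map_mul, Polynomial.map_pow, Polynomial.map_sub, Polynomial.map_X,
      Polynomial.map_C, MvPolynomial.map_C, Polynomial.map_ofBox, hsmul, Polynomial.ofBox_smul,
      mul_left_comm, ← Polynomial.smul_eq_C_mul, Polynomial.smul_modByMonic,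
      Polynomial.coeff_smul, smul_eq_mul, MvPolynomial.coeff_C_mul, hs j m hm, mul_zero]

theorem IsAlgClosed.exists_finset_card_eq_pow (k : Type*) [Field k] [IsAlgClosed k] (p t : ℕ)
    [Fact p.Prime] [CharP k p] (ht : 0 < t) :
    ∃ s : Finset k, s.card = p ^ t ∧ ∀ c, c ∈ s ↔ c ^ p ^ t = c := by
  classical
  have hp := (Fact.out : p.Prime).one_lt
  have hsep : (Polynomial.X ^ p ^ t - Polynomial.X : Polynomial k).Separable :=
    galois_poly_separable p _ (dvd_pow_self p ht.ne')
  have h1 : 1 < p ^ t := Nat.one_lt_pow ht.ne' hp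
  have hne := FiniteField.X_pow_card_sub_X_ne_zero k h1
  refine ⟨(Polynomial.X ^ p ^ t - Polynomial.X : Polynomial k).roots.toFinset, ?_, fun c => ?_⟩
  · rw [Multiset.toFinset_card_of_nodup (Polynomial.nodup_roots hsep),
      ← (IsAlgClosed.splits _).natDegree_eq_card_roots,
      FiniteField.X_pow_card_sub_X_natDegree_eq k h1]
  · simp [hne, sub_eq_zero]

/-- Near a rational point at which `g` has no rational root, `η ^ Q - η` is a unit. -/
theorem pow_mul_eq_zero_of_no_rational_root {k T : Type*} [Field k] [IsAlgClosed k] [CommRing T]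
    [Algebra k T] {g : Polynomial (MvPolynomial (Fin 2) k)} {h : MvPolynomial (Fin 2) k}
    {ξ : Fin 2 → T} {η A : T} {c : Fin 2 → k} {M Q s : ℕ}
    (hξ : ∀ i, (ξ i - algebraMap k T (c i)) ^ M = 0)
    (hη : g.eval₂ (aeval ξ : MvPolynomial (Fin 2) k →ₐ[k] T).toRingHom η = 0)
    (hno : eval c h ≠ 0 → ∀ y, y ^ Q = y → (g.map (eval c)).eval y ≠ 0)
    (hA : (η ^ Q - η) ^ s * A = 0) : (aeval ξ h) ^ (2 * M) * A = 0 := by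
  set J : Ideal T := Ideal.span {ξ 0 - algebraMap k T (c 0), ξ 1 - algebraMap k T (c 1)} with hJ
  have hJnil : ∀ z ∈ J, z ^ (2 * M) = 0 := by
    intro z hz
    obtain ⟨a, b, rfl⟩ := Ideal.mem_span_pair.1 hz
    refine (Commute.all _ _).add_pow_eq_zero_of_add_le_succ_of_pow_eq_zero
      (m := M) (n := M) ?_ ?_ (by omega)
    · rw [mul_pow, hξ, mul_zero]
    · rw [mul_pow, hξ, mul_zero]
  have hmk : (Ideal.Quotient.mk J).comp (aeval ξ : MvPolynomial (Fin 2) k →ₐ[k] T).toRingHom =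
      (Ideal.Quotient.mk J).comp ((algebraMap k T).comp (eval c)) := by
    refine MvPolynomial.ringHom_ext (fun a => ?_) (fun i => ?_)
    · simp
    · simp only [RingHom.comp_apply, AlgHom.toRingHom_eq_coe, RingHom.coe_coe, aeval_X, eval_X]
      rw [Ideal.Quotient.mk_eq_mk_iff_sub_mem]
      refine Ideal.subset_span ?_
      fin_cases i <;> simp
  by_cases hc : eval c h = 0
  · rw [hJnil, zero_mul]
    have := RingHom.congr_fun hmk h
    simp only [RingHom.comp_apply, hc, map_zero] at this
    exact Ideal.Quotient.eq_zero_iff_mem.1 this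
  · have hcop : IsCoprime (Polynomial.X ^ Q - Polynomial.X : Polynomial k) (g.map (eval c)) := by
      rw [Polynomial.isCoprime_iff_aeval_ne_zero_of_isAlgClosed k k]
      intro y
      by_cases hy : y ^ Q = y
      · exact Or.inr (by simpa using hno hc y hy)
      · exact Or.inl (by simpa [sub_eq_zero] using hy)
    obtain ⟨u, v, huv⟩ := hcop
    have h1 := congrArg (Polynomial.aeval η) huv
    simp only [map_add, map_mul, map_sub, map_pow, Polynomial.aeval_X, map_one] at h1
    have h2 : Polynomial.aeval η (g.map (eval c)) ∈ J := by
      rw [← Ideal.Quotient.eq_zero_iff_mem, Polynomial.aeval_def, Polynomial.eval₂_map,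
        Polynomial.hom_eval₂, ← hmk, ← Polynomial.hom_eval₂, hη, map_zero]
    have h3 : IsUnit (η ^ Q - η) := by
      refine isUnit_of_mul_isUnit_right (x := Polynomial.aeval η u) ?_
      rw [eq_sub_of_add_eq h1]
      exact IsNilpotent.isUnit_one_sub ⟨_, hJnil _ (J.mul_mem_left _ h2)⟩
    rw [((h3.pow s).mul_right_eq_zero).1 hA, mul_zero]

theorem MvPolynomial.pow_mul_eval₂_mem_span {k S : Type*} [Field k] [CommRing S] [Algebra k S]
    {r : ℕ} {g : Polynomial (MvPolynomial (Fin r) k)} {x : Fin r → S} {y : S}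
    {Q s M : ℕ} (hg : g.eval₂ (aeval fun i => x i ^ Q : MvPolynomial (Fin r) k →ₐ[k] S).toRingHom
      (y ^ Q) = 0) {α : Polynomial (MvPolynomial (Fin r) S)}
    (hα : ∀ j (m : Fin r →₀ ℕ), (∀ i, m i < M) → MvPolynomial.coeff m ((((Polynomial.X -
      Polynomial.C (C y)) ^ s * α) %ₘ (g.map (taylorAt k x))).coeff j) = 0) :
    (g.map (taylorAt k x)).eval₂ (eval fun i => x i ^ Q - x i) (y ^ Q) = 0 ∧
    (y ^ Q - y) ^ s * α.eval₂ (eval fun i => x i ^ Q - x i) (y ^ Q) ∈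
      Ideal.span (Set.range fun i => (x i ^ Q - x i) ^ M) := by
  have h0 : (g.map (taylorAt k x)).eval₂ (eval fun i => x i ^ Q - x i) (y ^ Q) = 0 := by
    rw [Polynomial.eval₂_map, ← hg]
    congr 1
    refine MvPolynomial.ringHom_ext (fun a => ?_) (fun i => ?_) <;>
      simp [taylorAt, MvPolynomial.algebraMap_apply]
  refine ⟨h0, ?_⟩
  have h1 := congrArg (Polynomial.eval₂ (eval fun i => x i ^ Q - x i) (y ^ Q))
    (Polynomial.modByMonic_add_div ((Polynomial.X - Polynomial.C (C y)) ^ s * α)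
      (g.map (taylorAt k x)))
  rw [Polynomial.eval₂_add, Polynomial.eval₂_mul, h0, zero_mul, add_zero, Polynomial.eval₂_mul,
    Polynomial.eval₂_pow, Polynomial.eval₂_sub, Polynomial.eval₂_X, Polynomial.eval₂_C, eval_C] at h1
  rw [← h1, Polynomial.eval₂_eq_sum_range]
  refine Ideal.sum_mem _ fun j _ => Ideal.mul_mem_right _ _ ?_
  have h2 := Ideal.mem_map_of_mem (eval fun i => x i ^ Q - x i)
    (mem_span_range_X_pow_iff.2 (hα j))
  rw [Ideal.map_span] at h2
  refine Ideal.span_mono ?_ h2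
  rintro _ ⟨_, ⟨i, rfl⟩, rfl⟩
  exact ⟨i, by simp⟩

/-- A representative of bounded degree of the value of a box polynomial at Frobenius. -/
theorem AdjoinRoot.exists_mk_eq_eval₂_ofBox {k : Type*} [Field k] {r d κ : ℕ}
    {g : Polynomial (MvPolynomial (Fin r) k)} (hm : g.Monic) (hd : g.natDegree = d + 1)
    (a : Fin (d + 1) × (Fin r → Fin (κ + 1)) → AdjoinRoot g) :
    ∃ B, ∀ Q, 0 < Q → ∃ G : Polynomial (MvPolynomial (Fin r) k), G.natDegree ≤ d + d * Q ∧
      (∀ i j, degreeOf i (G.coeff j) ≤ B + κ * Q) ∧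
      AdjoinRoot.mk g G = (Polynomial.ofBox a).eval₂
        (eval fun i => AdjoinRoot.of g (X i) ^ Q - AdjoinRoot.of g (X i)) (AdjoinRoot.root g ^ Q) := by
  have hrep : ∀ z : AdjoinRoot g, ∃ G : Polynomial (MvPolynomial (Fin r) k), G.natDegree ≤ d ∧
      AdjoinRoot.mk g G = z := by
    intro z
    obtain ⟨G, rfl⟩ := AdjoinRoot.mk_surjective z
    refine ⟨G %ₘ g, ?_, ?_⟩
    · have := Polynomial.natDegree_modByMonic_lt G hm (by rintro rfl; simp at hd)
      omega
    · rw [AdjoinRoot.mk_eq_mk]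
      exact ⟨-(G /ₘ g), by linear_combination Polynomial.modByMonic_add_div G g⟩
  choose b hb1 hb2 using fun i => hrep (a i)
  refine ⟨Finset.univ.sup fun i => Finset.univ.sup fun l => (Finset.range (d + 1)).sup fun j =>
    degreeOf l ((b i).coeff j), fun Q hQ => ?_⟩
  set B := Finset.univ.sup fun i => Finset.univ.sup fun l => (Finset.range (d + 1)).sup fun j =>
    degreeOf l ((b i).coeff j)
  have hB : ∀ i l j, degreeOf l ((b i).coeff j) ≤ B := by
    intro i l j
    by_cases hj : j < d + 1
    · refine le_trans ?_ (Finset.le_sup (Finset.mem_univ i))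
      refine le_trans ?_ (Finset.le_sup (Finset.mem_univ l))
      exact Finset.le_sup (f := fun j => degreeOf l ((b i).coeff j)) (Finset.mem_range.2 hj)
    · rw [Polynomial.coeff_eq_zero_of_natDegree_lt (by have := hb1 i; omega)]
      simp
  let e : (Fin r → Fin (κ + 1)) → MvPolynomial (Fin r) k :=
    fun u => ∏ l : Fin r, (X l ^ Q - X l) ^ (u l : ℕ)
  have he : ∀ u l, degreeOf l (e u) ≤ κ * Q := by
    intro u l
    have h1 : ∀ l', degreeOf l ((X l' ^ Q - X l' : MvPolynomial (Fin r) k) ^ (u l' : ℕ)) ≤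
        if l' = l then κ * Q else 0 := by
      intro l'
      refine (degreeOf_pow_le _ _ _).trans ?_
      have h2 : degreeOf l (X l' ^ Q - X l' : MvPolynomial (Fin r) k) ≤ if l' = l then Q else 0 := by
        refine (degreeOf_sub_le _ _ _).trans (max_le ((degreeOf_pow_le _ _ _).trans ?_) ?_)
        · rw [degreeOf_X]
          split_ifs with h3 h4
          · simp
          · exact absurd h3.symm h4
          · simp
          · simp
        · rw [degreeOf_X]
          split_ifs with h3 h4
          · exact hQ
          · exact absurd h3.symm h4
          · simp
          · simp
      refine (Nat.mul_le_mul_left _ h2).trans ?_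
      have := (u l').is_lt
      split_ifs
      · exact Nat.mul_le_mul_right _ (by omega)
      · simp
    refine (degreeOf_prod_le _ _ _).trans ((Finset.sum_le_sum fun l' _ => h1 l').trans ?_)
    simp
  refine ⟨∑ j : Fin (d + 1), ∑ u : Fin r → Fin (κ + 1),
    b (j, u) * (Polynomial.C (e u) * Polynomial.X ^ (Q * j)), ?_, fun l i => ?_, ?_⟩
  · refine Polynomial.natDegree_sum_le_of_forall_le _ _ fun j _ =>
      Polynomial.natDegree_sum_le_of_forall_le _ _ fun u _ => ?_
    refine Polynomial.natDegree_mul_le.trans (add_le_add (hb1 _) ?_)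
    refine (Polynomial.natDegree_C_mul_X_pow_le _ _).trans ?_
    rw [mul_comm]
    exact Nat.mul_le_mul_right _ (by omega)
  · simp only [Polynomial.finsetSum_coeff]
    refine (degreeOf_sum_le _ _ _).trans (Finset.sup_le fun j _ =>
      (degreeOf_sum_le _ _ _).trans (Finset.sup_le fun u _ => ?_))
    rw [← mul_assoc, Polynomial.coeff_mul_X_pow']
    split_ifs
    · rw [Polynomial.coeff_mul_C]
      exact (degreeOf_mul_le _ _ _).trans (add_le_add (hB _ _ _) (he _ _))
    · simp
  · simp only [Polynomial.ofBox, Polynomial.eval₂_finsetSum, Polynomial.eval₂_monomial, map_sum,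
      map_mul, hb2, map_pow, AdjoinRoot.mk_X, AdjoinRoot.mk_C, ← pow_mul]
    refine Finset.sum_congr rfl fun j _ => Finset.sum_congr rfl fun u _ => ?_
    rw [eval_monomial, ← mul_assoc]
    congr 2
    rw [Finsupp.prod_fintype _ _ (by simp)]
    simp [e]

theorem AdjoinRoot.eval₂_pow_eq_zero {k : Type*} [Field k] {r : ℕ} {p t : ℕ} [Fact p.Prime]
    [CharP k p] {g : Polynomial (MvPolynomial (Fin r) k)} [Nontrivial (AdjoinRoot g)]
    (hfix : g.map (MvPolynomial.map (iterateFrobenius k p t)) = g) :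
    g.eval₂ (aeval fun i => AdjoinRoot.of g (X i) ^ p ^ t :
      MvPolynomial (Fin r) k →ₐ[k] AdjoinRoot g).toRingHom (AdjoinRoot.root g ^ p ^ t) = 0 := by
  have : CharP (AdjoinRoot g) p :=
    charP_of_injective_algebraMap (algebraMap k (AdjoinRoot g)).injective p
  have h1 := congrArg (iterateFrobenius (AdjoinRoot g) p t) (AdjoinRoot.eval₂_root g)
  rw [Polynomial.hom_eval₂, map_zero, iterateFrobenius_def] at h1
  have h2 : (iterateFrobenius (AdjoinRoot g) p t).comp (AdjoinRoot.of g) =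
      (aeval fun i => AdjoinRoot.of g (X i) ^ p ^ t :
        MvPolynomial (Fin r) k →ₐ[k] AdjoinRoot g).toRingHom.comp
        (MvPolynomial.map (iterateFrobenius k p t)) := by
    refine MvPolynomial.ringHom_ext (fun a => ?_) (fun i => ?_)
    · simp only [RingHom.comp_apply, MvPolynomial.map_C, AlgHom.toRingHom_eq_coe, RingHom.coe_coe,
        algHom_C, iterateFrobenius_def, map_pow]
      rfl
    · simp [iterateFrobenius_def]
  rw [h2, ← Polynomial.eval₂_map, hfix] at h1
  exact h1

/-- Existence of rational points of large degree, off a hypersurface of the base, on a hypersurface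
that is monic in the last variable. -/
theorem MvPolynomial.exists_rational_point_of_monic {k : Type*} [Field k] [IsAlgClosed k] {p : ℕ}
    [Fact p.Prime] [CharP k p] {g : Polynomial (MvPolynomial (Fin 2) k)} (hm : g.Monic)
    (hg : Prime g) {h : MvPolynomial (Fin 2) k} (hh : h ≠ 0) :
    ∃ N, ∀ t, 0 < t → N ≤ p ^ t → g.map (MvPolynomial.map (iterateFrobenius k p t)) = g →
      ∃ c : Fin 2 → k, ∃ y, (∀ i, c i ^ p ^ t = c i) ∧ y ^ p ^ t = y ∧ eval c h ≠ 0 ∧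
        (g.map (eval c)).eval y = 0 := by
  obtain ⟨d, hd⟩ : ∃ d, g.natDegree = d + 1 := by
    refine Nat.exists_eq_succ_of_ne_zero fun h0 => hg.not_isUnit ?_
    rw [hm.natDegree_eq_zero.1 h0]
    exact isUnit_one
  have hdom : IsDomain (AdjoinRoot g) := AdjoinRoot.isDomain_of_prime hg
  have hdeg : g.degree ≠ 0 := by
    rw [Polynomial.degree_eq_natDegree hm.ne_zero, hd]
    exact_mod_cast Nat.succ_ne_zero d
  have hinj : Function.Injective (AdjoinRoot.of g) := AdjoinRoot.of.injective_of_degree_ne_zero hdeg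
  have hfinS : Module.Finite (MvPolynomial (Fin 2) k) (AdjoinRoot g) := hm.finite_adjoinRoot
  have hftS : Algebra.FiniteType k (AdjoinRoot g) :=
    Algebra.FiniteType.trans (S := MvPolynomial (Fin 2) k) inferInstance inferInstance
  obtain ⟨c, hc⟩ : ∃ c, ∀ i j, degreeOf i (g.coeff j) ≤ c := by
    refine ⟨(Finset.range (d + 2)).sup fun j => (g.coeff j).totalDegree, fun i j => ?_⟩
    by_cases hj : j < d + 2
    · exact (degreeOf_le_totalDegree _ _).trans
        (Finset.le_sup (f := fun j => (g.coeff j).totalDegree) (Finset.mem_range.2 hj))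
    · rw [Polynomial.coeff_eq_zero_of_natDegree_lt (by omega)]
      simp
  set x : Fin 2 → AdjoinRoot g := fun i => AdjoinRoot.of g (X i) with hx
  set y : AdjoinRoot g := AdjoinRoot.root g with hy
  set κ : ℕ := c * d * (2 * d + 1) with hκ
  set M : ℕ := 2 * (c * d) * (d + 1) + 1 with hM
  have hMκ : M = κ + c * d + 1 := by rw [hM, hκ]; ring
  have hpS := hm.map (taylorAt k x)
  have hdS : (g.map (taylorAt k x)).natDegree = d + 1 := by rw [hm.natDegree_map, hd]
  have hyS : constantCoeff ((g.map (taylorAt k x)).eval (C y)) = 0 := by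
    rw [Polynomial.eval_map, Polynomial.hom_eval₂, constantCoeff_C, ← AdjoinRoot.eval₂_root g]
    congr 1
    refine MvPolynomial.ringHom_ext (fun a => ?_) (fun i => ?_)
    · simp only [taylorAt, RingHom.comp_apply, AlgHom.toRingHom_eq_coe, RingHom.coe_coe, algHom_C,
        MvPolynomial.algebraMap_apply, constantCoeff_C]
      rfl
    · simp [taylorAt, hx]
  obtain ⟨s, a, ha, hsa⟩ := hpS.exists_ofBox hdS y hyS (M := M) (κ := κ) (by omega) (by
    rw [hM, hκ]
    generalize c * d = e
    nlinarith [Nat.zero_le (e * d), Nat.zero_le (e * e * d), Nat.zero_le (e * e)])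
  have hprime := hm.prime_map_taylorAt hg x
  have hndvd : ¬ g.map (taylorAt k x) ∣ Polynomial.ofBox a := by
    intro hdvd
    refine hpS.not_dvd_of_degree_lt (Polynomial.ofBox_ne_zero ha) ?_ hdvd
    refine (Polynomial.degree_ofBox_lt a).trans_eq ?_
    rw [Polynomial.degree_eq_natDegree hpS.ne_zero, hdS]
  obtain ⟨n, hn, β, γ, hnβ⟩ : ∃ n : MvPolynomial (Fin 2) (MvPolynomial (Fin 2) k), n ≠ 0 ∧ ∃ β γ,
      Polynomial.C (MvPolynomial.map (AdjoinRoot.of g) n) =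
        Polynomial.ofBox a * β + g.map (taylorAt k x) * γ := by
    let _ : Algebra (MvPolynomial (Fin 2) (MvPolynomial (Fin 2) k))
      (MvPolynomial (Fin 2) (AdjoinRoot g)) := algebraMvPolynomial
    have : Algebra.IsIntegral (MvPolynomial (Fin 2) k) (AdjoinRoot g) := inferInstance
    exact Polynomial.exists_ne_zero_dvd_sub hpS hprime hndvd
  obtain ⟨N, hN⟩ := exists_forall_eval_X_pow_sub_X_ne_zero hn
  obtain ⟨B, hB⟩ := AdjoinRoot.exists_mk_eq_eval₂_ofBox hm hd a
  refine ⟨N + B + 2 * M * h.totalDegree + 1, fun t ht hQ hfix => ?_⟩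
  set Q := p ^ t with hQdef
  by_contra! hcon
  obtain ⟨G, hGdeg, hGi, hGA⟩ := hB Q (by omega)
  have hfrob := AdjoinRoot.eval₂_pow_eq_zero hfix
  obtain ⟨hev0, hevA⟩ := pow_mul_eval₂_mem_span (x := x) (y := y) hfrob hsa
  rw [← hGA] at hevA
  obtain ⟨F, hFcard, hF⟩ := IsAlgClosed.exists_finset_card_eq_pow k p t ht
  set W : Polynomial (MvPolynomial (Fin 2) k) := Polynomial.C (h ^ (2 * M)) * G with hW
  have hzero : W %ₘ g = 0 := by
    ext1 j
    rw [Polynomial.coeff_zero]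
    refine eq_zero_of_forall_mem_span_pow F M 2 _ (fun z hz => ?_) (fun i => ?_)
    · set I : Ideal (MvPolynomial (Fin 2) k) := Ideal.span (Set.range fun i => (X i - C (z i)) ^ M)
      let π := Ideal.Quotient.mk I
      let T := AdjoinRoot (g.map π)
      let θ : MvPolynomial (Fin 2) k →ₐ[k] T := aeval fun i => AdjoinRoot.of (g.map π) (π (X i))
      have hθ : θ.toRingHom = (AdjoinRoot.of (g.map π)).comp π := by
        refine MvPolynomial.ringHom_ext (fun a => ?_) (fun i => ?_)
        · simp only [AlgHom.toRingHom_eq_coe, RingHom.coe_coe, algHom_C]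
          rfl
        · simp [θ]
      have hroot : g.eval₂ θ.toRingHom (AdjoinRoot.root (g.map π)) = 0 := by
        rw [hθ, ← Polynomial.eval₂_map, AdjoinRoot.eval₂_root]
      let ρ : AdjoinRoot g →+* T := AdjoinRoot.lift θ.toRingHom (AdjoinRoot.root (g.map π)) hroot
      have hξ : ∀ i, (AdjoinRoot.of (g.map π) (π (X i)) - algebraMap k T (z i)) ^ M = 0 := by
        intro i
        have h1 : π ((X i - C (z i)) ^ M) = 0 :=
          Ideal.Quotient.eq_zero_iff_mem.2 (Ideal.subset_span ⟨i, rfl⟩)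
        have h2 := congrArg (AdjoinRoot.of (g.map π)) h1
        rw [map_pow, map_pow, map_sub, map_sub, map_zero] at h2
        exact h2
      have hA : (AdjoinRoot.root (g.map π) ^ Q - AdjoinRoot.root (g.map π)) ^ s *
          ρ (AdjoinRoot.mk g G) = 0 := by
        have h1 := Ideal.mem_map_of_mem ρ hevA
        rw [map_mul, map_pow, map_sub, map_pow, AdjoinRoot.lift_root, Ideal.map_span] at h1
        refine (Ideal.mem_bot).1 ((Ideal.span_le (I := ⊥)).2 ?_ h1)
        rintro _ ⟨_, ⟨i, rfl⟩, rfl⟩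
        rw [SetLike.mem_coe, Ideal.mem_bot]
        have h2 : ρ (x i) = AdjoinRoot.of (g.map π) (π (X i)) := by
          simp [ρ, hx, θ]
        have h3 : algebraMap k T (z i) ^ Q = algebraMap k T (z i) := by
          rw [← map_pow, (hF (z i)).1 (hz i)]
        obtain ⟨w, hw⟩ := sub_dvd_pow_sub_pow (AdjoinRoot.of (g.map π) (π (X i)))
          (algebraMap k T (z i)) Q
        have h4 : ρ (x i ^ Q - x i) = (AdjoinRoot.of (g.map π) (π (X i)) - algebraMap k T (z i)) *
            (w - 1) := by
          rw [map_sub, map_pow, h2]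
          rw [h3] at hw
          linear_combination hw
        rw [map_pow, h4, mul_pow, hξ, zero_mul]
      have key := pow_mul_eq_zero_of_no_rational_root hξ hroot (h := h) (c := z) (by
        intro hne y' hy'
        exact hcon z y' (fun i => (hF _).1 (hz i)) hy' hne) hA
      have hkey : AdjoinRoot.mk (g.map π) (W.map π) = 0 := by
        rw [← key, hW, Polynomial.map_mul, map_mul, Polynomial.map_C, AdjoinRoot.mk_C, map_pow,
          map_pow]
        congr 1
        · exact congrArg (· ^ (2 * M)) (RingHom.congr_fun hθ h).symm
        · rw [AdjoinRoot.lift_mk, hθ, ← Polynomial.eval₂_map]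
          exact (AdjoinRoot.aeval_eq _).symm
      rw [AdjoinRoot.mk_eq_zero, ← Polynomial.modByMonic_eq_zero_iff_dvd (hm.map π),
        ← Polynomial.map_modByMonic _ hm] at hkey
      have h5 := congrArg (fun q => Polynomial.coeff q j) hkey
      simp only [Polynomial.coeff_map, Polynomial.coeff_zero] at h5
      exact Ideal.Quotient.eq_zero_iff_mem.1 h5
    · rw [hFcard, ← hQdef]
      have hWdeg : W.natDegree ≤ d + d * Q := (Polynomial.natDegree_C_mul_le _ _).trans hGdeg
      have hWi : ∀ l, degreeOf i (W.coeff l) ≤ 2 * M * h.totalDegree + (B + κ * Q) := by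
        intro l
        rw [hW, Polynomial.coeff_C_mul]
        refine (degreeOf_mul_le _ _ _).trans (add_le_add ((degreeOf_pow_le _ _ _).trans
          (Nat.mul_le_mul_left _ (degreeOf_le_totalDegree _ _))) (hGi _ _))
      refine (Polynomial.degreeOf_coeff_modByMonic_le hm hd (hc i) _ _ W hWdeg hWi j).trans_lt ?_
      rw [hMκ]
      rw [← hMκ]
      have : M * Q = κ * Q + c * (d * Q) + Q := by rw [hMκ]; ring
      omega
  rw [Polynomial.modByMonic_eq_zero_iff_dvd hm, ← AdjoinRoot.mk_eq_zero, hW, map_mul,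
    AdjoinRoot.mk_C, mul_eq_zero, map_pow] at hzero
  have hGz : AdjoinRoot.mk g G = 0 := by
    refine hzero.resolve_left (pow_ne_zero _ ?_)
    rwa [Ne, map_eq_zero_iff _ hinj]
  have h6 := congrArg (Polynomial.eval₂ (eval fun i => x i ^ Q - x i) (y ^ Q)) hnβ
  rw [Polynomial.eval₂_C, Polynomial.eval₂_add, Polynomial.eval₂_mul, Polynomial.eval₂_mul, hev0,
    ← hGA, hGz, zero_mul, zero_mul, add_zero] at h6
  refine hN Q (by omega) (hinj ?_)
  rw [map_zero, ← h6]
  rw [eval_map, ← eval₂_id, eval₂_comp_left]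
  simp [hx, Function.comp_def]

theorem Polynomial.integralNormalization_comp {R : Type*} [CommRing R] {p : Polynomial R}
    (hd : 1 ≤ p.natDegree) :
    p.integralNormalization.comp (C p.leadingCoeff * X) =
      C (p.leadingCoeff ^ (p.natDegree - 1)) * p := by
  have := integralNormalization_eval₂_leadingCoeff_mul hd C X
  rwa [eval₂_C_X, ← C_pow] at this

theorem Polynomial.integralNormalization_dvd_iff {R : Type*} [CommRing R] [IsDomain R]
    {p : Polynomial R} (hp : Prime p) (hd : 1 ≤ p.natDegree) (F : Polynomial R) :
    p.integralNormalization ∣ F ↔ p ∣ F.comp (C p.leadingCoeff * X) := by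
  have hl : p.leadingCoeff ≠ 0 := leadingCoeff_ne_zero.2 hp.ne_zero
  have hm := monic_integralNormalization hp.ne_zero
  have hc := integralNormalization_comp hd
  constructor
  · rintro ⟨q, rfl⟩
    rw [mul_comp, hc]
    exact (Dvd.intro_left _ rfl).mul_right _
  · intro h
    rw [← modByMonic_eq_zero_iff_dvd hm]
    have h1 := modByMonic_add_div F p.integralNormalization
    have h2 : p ∣ (F %ₘ p.integralNormalization).comp (C p.leadingCoeff * X) := by
      rw [← h1, add_comp, mul_comp, hc] at h
      exact (dvd_add_left ((Dvd.intro_left _ rfl).mul_right _)).1 h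
    by_contra hne
    have h3 : (F %ₘ p.integralNormalization).comp (C p.leadingCoeff * X) ≠ 0 := by
      rwa [Ne, comp_C_mul_X_eq_zero_iff (mem_nonZeroDivisors_of_ne_zero hl)]
    have h4 := natDegree_le_of_dvd h2 h3
    rw [natDegree_comp, natDegree_C_mul_X _ hl, mul_one] at h4
    have h5 := natDegree_modByMonic_lt F hm (by
      intro h; have := congrArg natDegree h
      rw [natDegree_integralNormalization, natDegree_one] at this; omega)
    rw [natDegree_integralNormalization] at h5
    omega

theorem Polynomial.prime_integralNormalization {R : Type*} [CommRing R] [IsDomain R]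
    {p : Polynomial R} (hp : Prime p) (hd : 1 ≤ p.natDegree) :
    Prime p.integralNormalization := by
  have hm := monic_integralNormalization hp.ne_zero
  refine ⟨hm.ne_zero, fun h => ?_, fun a b h => ?_⟩
  · have := congrArg natDegree (hm.isUnit_iff.1 h)
    rw [natDegree_integralNormalization, natDegree_one] at this
    omega
  · rw [integralNormalization_dvd_iff hp hd, mul_comp] at h
    simpa only [integralNormalization_dvd_iff hp hd] using hp.dvd_or_dvd h

theorem MvPolynomial.exists_rational_point_of_natDegree_pos {k : Type*} [Field k] [IsAlgClosed k]
    {p : ℕ} [Fact p.Prime] [CharP k p] {g : Polynomial (MvPolynomial (Fin 2) k)} (hg : Prime g)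
    (hd : 1 ≤ g.natDegree) {G : Polynomial (MvPolynomial (Fin 2) k)} (hG : ¬ g ∣ G) :
    ∃ N, ∀ t, 0 < t → N ≤ p ^ t → g.map (MvPolynomial.map (iterateFrobenius k p t)) = g →
      ∃ c : Fin 2 → k, ∃ y, (∀ i, c i ^ p ^ t = c i) ∧ y ^ p ^ t = y ∧
        (g.map (eval c)).eval y = 0 ∧ (G.map (eval c)).eval y ≠ 0 := by
  have hl : g.leadingCoeff ≠ 0 := Polynomial.leadingCoeff_ne_zero.2 hg.ne_zero
  have hG' : ¬ g.integralNormalization ∣ G.scaleRoots g.leadingCoeff := by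
    rw [Polynomial.integralNormalization_dvd_iff hg hd]
    have h1 := Polynomial.scaleRoots_eval₂_mul (p := G) Polynomial.C Polynomial.X g.leadingCoeff
    rw [Polynomial.eval₂_C_X, ← Polynomial.C_pow] at h1
    rw [Polynomial.comp, h1]
    intro h
    refine (hg.dvd_or_dvd h).elim (fun h => ?_) hG
    have := Polynomial.natDegree_le_of_dvd h (Polynomial.C_ne_zero.2 (pow_ne_zero _ hl))
    rw [Polynomial.natDegree_C] at this
    omega
  have hm := Polynomial.monic_integralNormalization hg.ne_zero
  have hgp := Polynomial.prime_integralNormalization hg hd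
  obtain ⟨h, hh, β, γ, hβ⟩ :=
    Polynomial.exists_ne_zero_dvd_sub (A := MvPolynomial (Fin 2) k) hm hgp hG'
  obtain ⟨N, hN⟩ := exists_rational_point_of_monic (p := p) hm hgp (mul_ne_zero hl hh)
  refine ⟨N, fun t ht htN hfix => ?_⟩
  have hlfix : MvPolynomial.map (iterateFrobenius k p t) g.leadingCoeff = g.leadingCoeff := by
    conv_rhs => rw [← hfix]
    rw [Polynomial.leadingCoeff_map_of_injective
      (map_injective _ (iterateFrobenius_inj k p t))]
  obtain ⟨c, y, hc, hy, hne, hev⟩ := hN t ht htN (by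
    rw [← Polynomial.integralNormalization_map, hfix]
    rwa [hlfix])
  rw [map_mul, mul_ne_zero_iff] at hne
  obtain ⟨hl0, hh0⟩ := hne
  have hlc : eval c g.leadingCoeff ^ p ^ t = eval c g.leadingCoeff := by
    have h1 : eval₂ (iterateFrobenius k p t) (fun i => iterateFrobenius k p t (c i))
        g.leadingCoeff = iterateFrobenius k p t (eval c g.leadingCoeff) := by
      rw [← eval₂_id, eval₂_comp_left]; simp [Function.comp_def]
    rw [← iterateFrobenius_def, ← h1]
    conv_rhs => rw [← hlfix, eval_map]
    congr 1
    funext i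
    rw [iterateFrobenius_def, hc]
  set l := eval c g.leadingCoeff with hldef
  have hyl : l * (y / l) = y := mul_div_cancel₀ y hl0
  refine ⟨c, y / l, hc, by rw [div_pow, hy, hlc], ?_, ?_⟩
  · have h1 := Polynomial.integralNormalization_eval₂_leadingCoeff_mul hd (eval c) (y / l)
    rw [← hldef, hyl, Polynomial.eval₂_eq_eval_map, hev, Polynomial.eval₂_eq_eval_map,
      eq_comm] at h1
    exact (mul_eq_zero.1 h1).resolve_left (pow_ne_zero _ hl0)
  · intro h0
    have h1 := Polynomial.scaleRoots_eval₂_mul (p := G) (eval c) (y / l) g.leadingCoeff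
    rw [← hldef, hyl, Polynomial.eval₂_eq_eval_map (p := G), h0, mul_zero] at h1
    have h2 := congrArg (Polynomial.eval₂ (eval c) y) hβ
    rw [Polynomial.eval₂_add, Polynomial.eval₂_mul, Polynomial.eval₂_mul, h1,
      Polynomial.eval₂_eq_eval_map (p := g.integralNormalization), hev, Polynomial.eval₂_C] at h2
    apply hh0
    simpa using h2

theorem MvPolynomial.finSuccEquiv_map {R S : Type*} [CommRing R] [CommRing S] (f : R →+* S) {n : ℕ}
    (P : MvPolynomial (Fin (n + 1)) R) :
    finSuccEquiv S n (map f P) = (finSuccEquiv R n P).map (map f) := by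
  ext i m
  simp only [finSuccEquiv_coeff_coeff, Polynomial.coeff_map, coeff_map]

/-- A weak Lang-Weil bound for surfaces. -/
theorem MvPolynomial.exists_rational_point_of_irreducible {k : Type*} [Field k] [IsAlgClosed k]
    {p : ℕ} [Fact p.Prime] [CharP k p] {P G : MvPolynomial (Fin 3) k} (hP : Irreducible P)
    (hG : ¬ P ∣ G) :
    ∃ N, ∀ t, 0 < t → N ≤ p ^ t → map (iterateFrobenius k p t) P = P →
      ∃ v : Fin 3 → k, (∀ i, v i ^ p ^ t = v i) ∧ eval v P = 0 ∧ eval v G ≠ 0 := by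
  obtain ⟨i, hi⟩ : ∃ i, degreeOf i P ≠ 0 := by
    by_contra! h
    have h1 : P = C (coeff 0 P) := by
      rw [← totalDegree_eq_zero_iff_eq_C, totalDegree_eq_zero_iff]
      intro m hm i
      have := monomial_le_degreeOf i hm
      rw [h i] at this
      omega
    rw [h1] at hP
    refine hP.not_isUnit (IsUnit.map C (IsUnit.mk0 _ ?_))
    intro h2
    rw [h2, C_0] at hP
    exact hP.ne_zero rfl
  set s : Fin 3 ≃ Fin 3 := Equiv.swap 0 i with hs
  let Θ : MvPolynomial (Fin 3) k ≃ₐ[k] Polynomial (MvPolynomial (Fin 2) k) :=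
    (renameEquiv k s).trans (finSuccEquiv k 2)
  have hΘ : ∀ F, Θ F = finSuccEquiv k 2 (rename s F) := fun F => rfl
  have hprime : Prime (Θ P) := (MulEquiv.prime_iff Θ).2 hP.prime
  have hdvd : ¬ Θ P ∣ Θ G := by rwa [map_dvd_iff]
  have hdeg : 1 ≤ (Θ P).natDegree := by
    have h1 := degreeOf_rename_of_injective (p := P) s.injective i
    have h2 : s i = 0 := Equiv.swap_apply_right 0 i
    rw [h2] at h1
    rw [hΘ, natDegree_finSuccEquiv, h1]
    omega
  obtain ⟨N, hN⟩ := exists_rational_point_of_natDegree_pos (p := p) hprime hdeg hdvd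
  refine ⟨N, fun t ht htN hfix => ?_⟩
  obtain ⟨c, y, hc, hy, h0, hne⟩ := hN t ht htN (by
    rw [hΘ, ← finSuccEquiv_map, map_rename, hfix])
  have hev : ∀ F, eval (fun j => (Fin.cons y c : Fin 3 → k) (s j)) F =
      ((Θ F).map (eval c)).eval y := by
    intro F
    rw [hΘ, ← eval_eq_eval_mv_eval', eval_rename]
    rfl
  refine ⟨_, fun j => ?_, (hev P).trans h0, (hev G).trans_ne hne⟩
  have : ∀ j, (Fin.cons y c : Fin 3 → k) j ^ p ^ t = (Fin.cons y c : Fin 3 → k) j := by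
    intro j
    refine Fin.cases ?_ (fun j => ?_) j
    · simpa using hy
    · simpa using hc j
  exact this _

namespace MvPolynomial

/-- The ring homomorphism `P ↦ P(t x)`, whose coefficients are the homogeneous components. -/
noncomputable def homogenizeHom (ι k : Type*) [CommRing k] :
    MvPolynomial ι k →ₐ[k] Polynomial (MvPolynomial ι k) :=
  aeval fun i => Polynomial.C (X i) * Polynomial.X

/-- The homogeneous part of top degree. -/
noncomputable def leadingForm {ι k : Type*} [CommRing k] (P : MvPolynomial ι k) :
    MvPolynomial ι k :=
  (homogenizeHom ι k P).leadingCoeff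

section

variable {ι k : Type*} [CommRing k]

theorem homogenizeHom_monomial (m : ι →₀ ℕ) (c : k) :
    homogenizeHom ι k (monomial m c) = Polynomial.monomial m.degree (monomial m c) := by
  rw [homogenizeHom, aeval_monomial, ← Polynomial.C_mul_X_pow_eq_monomial, monomial_eq,
    Finsupp.degree_apply, map_mul, mul_assoc]
  congr 1
  simp only [Finsupp.prod, mul_pow, Finset.prod_mul_distrib, Finset.prod_pow_eq_pow_sum, map_prod,
    map_pow]

theorem coeff_homogenizeHom (P : MvPolynomial ι k) (j : ℕ) :
    (homogenizeHom ι k P).coeff j = homogeneousComponent j P := by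
  induction P using MvPolynomial.induction_on' with
  | monomial m c =>
    rw [homogenizeHom_monomial, Polynomial.coeff_monomial]
    ext d
    rw [coeff_homogeneousComponent]
    by_cases h : m = d
    · subst h
      split_ifs <;> simp
    · have h0 : coeff d (monomial m c) = 0 := by classical rw [coeff_monomial, if_neg h]
      rw [h0, ite_self]
      split_ifs
      · exact h0
      · exact coeff_zero d
  | add p q hp hq => rw [map_add, Polynomial.coeff_add, hp, hq, map_add]

theorem eval_one_homogenizeHom (P : MvPolynomial ι k) :
    (homogenizeHom ι k P).eval 1 = P := by
  induction P using MvPolynomial.induction_on' with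
  | monomial m c => simp [homogenizeHom_monomial]
  | add p q hp hq => rw [map_add, Polynomial.eval_add, hp, hq]

theorem homogenizeHom_injective : Function.Injective (homogenizeHom ι k) :=
  Function.LeftInverse.injective (g := Polynomial.eval 1) eval_one_homogenizeHom

theorem IsHomogeneous.homogenizeHom {P : MvPolynomial ι k} {d : ℕ} (hP : P.IsHomogeneous d) :
    homogenizeHom ι k P = Polynomial.monomial d P := by
  ext1 j
  rw [coeff_homogenizeHom, homogeneousComponent_of_mem hP, Polynomial.coeff_monomial]
  simp only [eq_comm]

theorem IsHomogeneous.leadingForm_eq {P : MvPolynomial ι k} {d : ℕ} (hP : P.IsHomogeneous d) :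
    leadingForm P = P := by
  rw [leadingForm, hP.homogenizeHom, Polynomial.leadingCoeff_monomial]

theorem leadingForm_isHomogeneous (P : MvPolynomial ι k) :
    (leadingForm P).IsHomogeneous (homogenizeHom ι k P).natDegree := by
  rw [leadingForm, Polynomial.leadingCoeff, coeff_homogenizeHom]
  exact homogeneousComponent_isHomogeneous _ _

theorem leadingForm_ne_zero {P : MvPolynomial ι k} (hP : P ≠ 0) : leadingForm P ≠ 0 := by
  rw [leadingForm, Polynomial.leadingCoeff_ne_zero]
  rwa [Ne, map_eq_zero_iff _ homogenizeHom_injective]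

theorem leadingForm_mul [IsDomain k] (P Q : MvPolynomial ι k) :
    leadingForm (P * Q) = leadingForm P * leadingForm Q := by
  simp only [leadingForm, map_mul, Polynomial.leadingCoeff_mul]

theorem leadingForm_C (c : k) : leadingForm (C c : MvPolynomial ι k) = C c :=
  (isHomogeneous_C ι c).leadingForm_eq

theorem homogenizeHom_map {K : Type*} [CommRing K] (f : k →+* K) (P : MvPolynomial ι k) :
    homogenizeHom ι K (map f P) = (homogenizeHom ι k P).map (map f) := by
  induction P using MvPolynomial.induction_on' with
  | monomial m c => simp [homogenizeHom_monomial]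
  | add p q hp hq => simp only [map_add, Polynomial.map_add, hp, hq]

theorem leadingForm_map {K : Type*} [CommRing K] {f : k →+* K} (hf : Function.Injective f)
    (P : MvPolynomial ι k) : leadingForm (map f P) = map f (leadingForm P) := by
  rw [leadingForm, homogenizeHom_map, Polynomial.leadingCoeff_map_of_injective (map_injective f hf),
    leadingForm]

theorem homogenizeHom_rename {κ : Type*} (f : ι → κ) (P : MvPolynomial ι k) :
    homogenizeHom κ k (rename f P) = (homogenizeHom ι k P).map (rename f : _ →ₐ[k] _) := by
  induction P using MvPolynomial.induction_on with
  | C c => simp [homogenizeHom, algebraMap_eq]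
  | add p q hp hq => simp only [map_add, Polynomial.map_add, hp, hq]
  | mul_X p i hp => simp only [map_mul, Polynomial.map_mul, hp]; simp [homogenizeHom]

theorem leadingForm_rename {κ : Type*} {f : ι → κ} (hf : Function.Injective f)
    (P : MvPolynomial ι k) : leadingForm (rename f P) = rename f (leadingForm P) := by
  rw [leadingForm, homogenizeHom_rename]
  exact Polynomial.leadingCoeff_map_of_injective (rename_injective f hf) (homogenizeHom ι k P)

theorem leadingForm_add_of_degree_lt {T R : MvPolynomial ι k} {d : ℕ} (hT : T.IsHomogeneous d)
    (hT0 : T ≠ 0) (hR : (homogenizeHom ι k R).degree < d) : leadingForm (T + R) = T := by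
  rw [leadingForm, map_add, hT.homogenizeHom, Polynomial.leadingCoeff_add_of_degree_lt',
    Polynomial.leadingCoeff_monomial]
  rwa [Polynomial.degree_monomial _ hT0]

end

end MvPolynomial

theorem exists_irreducible_dvd_of_additive {U : Type*} [CommRing U] [IsDomain U]
    [UniqueFactorizationMonoid U] {v : U → ℕ}
    (hv : ∀ a b, a ≠ 0 → b ≠ 0 → v (a * b) = v a + v b) (Ψ : U) (h0 : Ψ ≠ 0) (hΨ : v Ψ ≠ 0) :
    ∃ P, Irreducible P ∧ P ∣ Ψ ∧ v P ≠ 0 := by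
  induction Ψ using UniqueFactorizationMonoid.induction_on_prime with
  | h₁ => exact absurd rfl h0
  | h₂ x hx =>
    exfalso
    obtain ⟨u, rfl⟩ := hx
    have h1 : v 1 = 0 := by
      have := hv 1 1 one_ne_zero one_ne_zero
      rw [mul_one] at this
      omega
    have := hv u (↑u⁻¹ : U) u.ne_zero u⁻¹.ne_zero
    rw [Units.mul_inv, h1] at this
    omega
  | h₃ a p ha hp ih =>
    rw [hv p a hp.ne_zero ha] at hΨ
    by_cases h : v p = 0
    · obtain ⟨P, h1, h2, h3⟩ := ih ha (by omega)
      exact ⟨P, h1, h2.mul_left p, h3⟩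
    · exact ⟨p, hp.irreducible, dvd_mul_right p a, h⟩

theorem Irreducible.mul_dvd_of_not_associated {U : Type*} [CommRing U]
    [UniqueFactorizationMonoid U] {P Q Ψ : U} (hP : Irreducible P)
    (hQ : Irreducible Q) (h : ¬ Associated P Q) (h1 : P ∣ Ψ) (h2 : Q ∣ Ψ) : P * Q ∣ Ψ := by
  obtain ⟨R, rfl⟩ := h1
  refine mul_dvd_mul_left P ((hQ.prime.dvd_or_dvd h2).resolve_left fun h3 => h ?_)
  exact ((hQ.dvd_irreducible_iff_associated hP).1 h3).symm

theorem Irreducible.mul_mul_dvd_of_not_associated {U : Type*} [CommRing U]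
    [UniqueFactorizationMonoid U] {P Q R Ψ : U} (hP : Irreducible P)
    (hQ : Irreducible Q) (hR : Irreducible R) (hPQ : ¬ Associated P Q) (hPR : ¬ Associated P R)
    (hQR : ¬ Associated Q R) (h1 : P ∣ Ψ) (h2 : Q ∣ Ψ) (h3 : R ∣ Ψ) : P * Q * R ∣ Ψ := by
  obtain ⟨S, rfl⟩ := h1
  rw [mul_assoc]
  have hQS := (hQ.prime.dvd_or_dvd h2).resolve_left fun h =>
    hPQ ((hQ.dvd_irreducible_iff_associated hP).1 h).symm
  have hRS := (hR.prime.dvd_or_dvd h3).resolve_left fun h =>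
    hPR ((hR.dvd_irreducible_iff_associated hP).1 h).symm
  exact mul_dvd_mul_left P (hQ.mul_dvd_of_not_associated hR hQR hQS hRS)

theorem exists_fixed_irreducible_of_eq_one {U : Type*} [CommRing U] [IsDomain U]
    [UniqueFactorizationMonoid U] (σ : U ≃+* U)
    {Ψ : U} (hΨ0 : Ψ ≠ 0) (hσ : Associated (σ Ψ) Ψ) {v : U → ℕ}
    (hv : ∀ a b, a ≠ 0 → b ≠ 0 → v (a * b) = v a + v b) (hvσ : ∀ a, v (σ a) = v a)
    (h1 : v Ψ = 1) : ∃ P, Irreducible P ∧ P ∣ Ψ ∧ Associated (σ P) P := by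
  obtain ⟨P, hP, hPΨ, hvP⟩ := exists_irreducible_dvd_of_additive hv Ψ hΨ0 (by omega)
  refine ⟨P, hP, hPΨ, ?_⟩
  by_contra hne
  have hσP : Irreducible (σ P) := (MulEquiv.irreducible_iff σ).2 hP
  obtain ⟨R, hR⟩ := hσP.mul_dvd_of_not_associated hP hne
    (((map_dvd_iff σ).2 hPΨ).trans hσ.dvd) hPΨ
  have hR0 : R ≠ 0 := by rintro rfl; exact hΨ0 (by rw [hR, mul_zero])
  rw [hR, hv _ _ (mul_ne_zero hσP.ne_zero hP.ne_zero) hR0, hv _ _ hσP.ne_zero hP.ne_zero,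
    hvσ] at h1
  omega

theorem exists_orbit_of_eq_three {U : Type*} [CommRing U] [IsDomain U]
    [UniqueFactorizationMonoid U] (σ : U ≃+* U)
    {Ψ : U} (hΨ0 : Ψ ≠ 0) (hσ : Associated (σ Ψ) Ψ) {v : U → ℕ}
    (hv : ∀ a b, a ≠ 0 → b ≠ 0 → v (a * b) = v a + v b) (hvσ : ∀ a, v (σ a) = v a)
    (h3 : v Ψ = 3) (hno : ∀ P, Irreducible P → P ∣ Ψ → ¬ Associated (σ P) P) :
    ∃ P, Irreducible P ∧ v P = 1 ∧ ¬ Associated P (σ P) ∧ ¬ Associated P (σ (σ P)) ∧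
      Associated (σ (σ (σ P))) P ∧ ∃ R, R ≠ 0 ∧ Ψ = P * σ P * σ (σ P) * R ∧ Associated (σ R) R := by
  have hσi : ∀ {a}, Irreducible a → Irreducible (σ a) := fun h => (MulEquiv.irreducible_iff σ).2 h
  have hσd : ∀ {a}, a ∣ Ψ → σ a ∣ Ψ := fun h => ((map_dvd_iff σ).2 h).trans hσ.dvd
  have hσa : ∀ {a b}, Associated (σ a) (σ b) ↔ Associated a b := fun {a b} =>
    ⟨fun h => by simpa using h.map (σ.symm : U →* U), fun h => h.map (σ : U →* U)⟩
  obtain ⟨P, hP, hPΨ, hvP⟩ := exists_irreducible_dvd_of_additive hv Ψ hΨ0 (by omega)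
  have h01 : ¬ Associated P (σ P) := fun h => hno P hP hPΨ h.symm
  have h12 : ¬ Associated (σ P) (σ (σ P)) := fun h => h01 (hσa.1 h)
  have hP1 := hσi hP
  have hP2 := hσi hP1
  have hP3 := hσi hP2
  have hd1 := hσd hPΨ
  have hd2 := hσd hd1
  have hd3 := hσd hd2
  have hcancel : ∀ {D R : U}, D ≠ 0 → Ψ = D * R → Associated (σ D) D → Associated (σ R) R := by
    intro D R hD hR hDσ
    rw [hR, map_mul] at hσ
    exact Associated.of_mul_left hσ hDσ ((map_ne_zero_iff σ σ.injective).2 hD)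
  by_cases h02 : Associated P (σ (σ P))
  · exfalso
    obtain ⟨R, hR⟩ := hP.mul_dvd_of_not_associated hP1 h01 hPΨ hd1
    have hR0 : R ≠ 0 := by rintro rfl; exact hΨ0 (by rw [hR, mul_zero])
    have h4 := h3
    rw [hR, hv _ _ (mul_ne_zero hP.ne_zero hP1.ne_zero) hR0, hv _ _ hP.ne_zero hP1.ne_zero,
      hvσ] at h4
    obtain ⟨P', hP', hPR, hfix⟩ := exists_fixed_irreducible_of_eq_one σ hR0
      (hcancel (mul_ne_zero hP.ne_zero hP1.ne_zero) hR (by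
        rw [map_mul, mul_comm P]
        exact (Associated.refl _).mul_mul h02.symm)) hv hvσ (by omega)
    exact hno P' hP' (hPR.trans (hR ▸ dvd_mul_left R _)) hfix
  · obtain ⟨R, hR⟩ := hP.mul_mul_dvd_of_not_associated hP1 hP2 h01 h02 h12 hPΨ hd1 hd2
    have hR0 : R ≠ 0 := by rintro rfl; exact hΨ0 (by rw [hR, mul_zero])
    have hD := mul_ne_zero (mul_ne_zero hP.ne_zero hP1.ne_zero) hP2.ne_zero
    have h4 := h3
    rw [hR, hv _ _ hD hR0, hv _ _ (mul_ne_zero hP.ne_zero hP1.ne_zero) hP2.ne_zero,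
      hv _ _ hP.ne_zero hP1.ne_zero, hvσ, hvσ] at h4
    have hvP1 : v P = 1 := by omega
    have h30 : Associated (σ (σ (σ P))) P := by
      rw [hR] at hd3
      rcases hP3.prime.dvd_or_dvd hd3 with h | h
      · rcases hP3.prime.dvd_or_dvd h with h | h
        · rcases hP3.prime.dvd_or_dvd h with h | h
          · exact (hP3.dvd_irreducible_iff_associated hP).1 h
          · exact absurd (hσa.1 ((hP3.dvd_irreducible_iff_associated hP1).1 h)).symm h02
        · exact absurd ((hP3.dvd_irreducible_iff_associated hP2).1 h).symm
            (by rw [hσa, hσa]; exact h01)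
      · exfalso
        obtain ⟨S, rfl⟩ := h
        rw [hv _ _ hP3.ne_zero (right_ne_zero_of_mul hR0)] at h4
        simp only [hvσ] at h4
        omega
    refine ⟨P, hP, hvP1, h01, h02, h30, R, hR0, hR, hcancel hD hR ?_⟩
    rw [map_mul, map_mul, mul_comm (P * σ P), ← mul_assoc, mul_comm (σ (σ P) * P), ← mul_assoc]
    exact ((Associated.refl _).mul_mul h30)

theorem MvPolynomial.three_le_height_vanishingIdeal_zero (k : Type*) [Field k] :
    3 ≤ (vanishingIdeal k {(0 : Fin 3 → k)}).height := by
  set m := vanishingIdeal k {(0 : Fin 3 → k)} with hm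
  have hmp : m.IsPrime := by
    have : m = RingHom.ker (aeval (0 : Fin 3 → k)) := by
      ext p; rw [hm, mem_vanishingIdeal_singleton_iff, RingHom.mem_ker]
    rw [this]
    exact RingHom.ker_isPrime _
  let ρ₁ : MvPolynomial (Fin 3) k →ₐ[k] MvPolynomial (Fin 3) k := aeval ![0, X 1, X 2]
  let ρ₂ : MvPolynomial (Fin 3) k →ₐ[k] MvPolynomial (Fin 3) k := aeval ![0, 0, X 2]
  have hp1 : (RingHom.ker ρ₁).IsPrime := RingHom.ker_isPrime _
  have hp2 : (RingHom.ker ρ₂).IsPrime := RingHom.ker_isPrime _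
  have h01 : (⊥ : Ideal (MvPolynomial (Fin 3) k)) < RingHom.ker ρ₁ := by
    rw [bot_lt_iff_ne_bot]
    intro h
    have : (X 0 : MvPolynomial (Fin 3) k) ∈ RingHom.ker ρ₁ := by simp [RingHom.mem_ker, ρ₁]
    rw [h, Ideal.mem_bot] at this
    exact X_ne_zero 0 this
  have h12 : RingHom.ker ρ₁ < RingHom.ker ρ₂ := by
    refine lt_of_le_of_ne (fun p hp => ?_) fun h => ?_
    · have : ρ₂ = ρ₂.comp ρ₁ := by
        ext i : 1
        fin_cases i <;> simp [ρ₁, ρ₂]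
      rw [RingHom.mem_ker] at hp ⊢
      rw [this, AlgHom.comp_apply, hp, map_zero]
    · have : (X 1 : MvPolynomial (Fin 3) k) ∈ RingHom.ker ρ₂ := by simp [RingHom.mem_ker, ρ₂]
      rw [← h, RingHom.mem_ker] at this
      simp [ρ₁] at this
  have h23 : RingHom.ker ρ₂ < m := by
    refine lt_of_le_of_ne (fun p hp => ?_) fun h => ?_
    · have : aeval (0 : Fin 3 → k) = (aeval (0 : Fin 3 → k)).comp ρ₂ := by
        ext i : 1
        fin_cases i <;> simp [ρ₂]
      rw [RingHom.mem_ker] at hp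
      rw [hm, mem_vanishingIdeal_singleton_iff, this, AlgHom.comp_apply, hp, map_zero]
    · have : (X 2 : MvPolynomial (Fin 3) k) ∈ m := by
        rw [hm, mem_vanishingIdeal_singleton_iff]; simp
      rw [← h, RingHom.mem_ker] at this
      simp [ρ₂] at this
  have e1 := Ideal.height_add_one_le_of_lt_of_isPrime h01
  have e2 := Ideal.height_add_one_le_of_lt_of_isPrime h12
  have e3 := Ideal.height_add_one_le_of_lt_of_isPrime h23
  rw [Ideal.height_bot, zero_add] at e1
  calc (3 : ℕ∞) = 1 + 1 + 1 := by norm_num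
    _ ≤ (RingHom.ker ρ₁).height + 1 + 1 := by gcongr
    _ ≤ (RingHom.ker ρ₂).height + 1 := by gcongr
    _ ≤ _ := e3

theorem MvPolynomial.exists_ne_zero_eval_eq_zero {k : Type*} [Field k] [IsAlgClosed k]
    {g h : MvPolynomial (Fin 3) k} (hg : eval 0 g = 0) (hh : eval 0 h = 0) :
    ∃ x : Fin 3 → k, x ≠ 0 ∧ eval x g = 0 ∧ eval x h = 0 := by
  by_contra! hcon
  set m := vanishingIdeal k {(0 : Fin 3 → k)} with hm
  have hmp : m.IsPrime := by
    have : m = RingHom.ker (aeval (0 : Fin 3 → k)) := by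
      ext p; rw [hm, mem_vanishingIdeal_singleton_iff, RingHom.mem_ker]
    rw [this]
    exact RingHom.ker_isPrime _
  have hz : zeroLocus k (Ideal.span {g, h}) ⊆ {(0 : Fin 3 → k)} := by
    intro x hx
    rw [zeroLocus_span] at hx
    by_contra hne
    exact hcon x hne (hx g (by simp)) (hx h (by simp))
  have hle : m ≤ (Ideal.span {g, h}).radical := by
    rw [← vanishingIdeal_zeroLocus_eq_radical (K := k)]
    exact vanishingIdeal_anti_mono hz
  have hmin : m ∈ (Ideal.span {g, h}).minimalPrimes := by
    refine ⟨⟨hmp, ?_⟩, fun J hJ _ => hle.trans (hJ.1.radical_le_iff.2 hJ.2)⟩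
    rw [Ideal.span_le]
    rintro _ (rfl | rfl) <;> rw [SetLike.mem_coe, hm, mem_vanishingIdeal_singleton_iff]
    · simpa [aeval_eq_eval] using hg
    · simpa [aeval_eq_eval] using hh
  have h1 := Ideal.height_le_card_of_mem_minimalPrimes_span (Set.toFinite _) hmin
  have h2 := (three_le_height_vanishingIdeal_zero k).trans h1
  have h3 : ({g, h} : Set (MvPolynomial (Fin 3) k)).ncard ≤ 2 := by
    refine (Set.ncard_insert_le _ _).trans ?_
    rw [Set.ncard_singleton]
  have h4 : 3 ≤ ({g, h} : Set (MvPolynomial (Fin 3) k)).ncard := by exact_mod_cast h2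
  omega

/-- Restriction of a polynomial to the parametrised line `t ↦ x + t d`. -/
noncomputable def MvPolynomial.lineHom {k ι : Type*} [CommRing k] (x d : ι → k) :
    MvPolynomial ι k →ₐ[k] Polynomial k :=
  aeval fun i => Polynomial.C (x i) + Polynomial.C (d i) * Polynomial.X

theorem MvPolynomial.coeff_zero_lineHom {k ι : Type*} [CommRing k] (x d : ι → k)
    (g : MvPolynomial ι k) : (lineHom x d g).coeff 0 = eval x g := by
  induction g using MvPolynomial.induction_on with
  | C c => simp [lineHom]
  | add p q hp hq => simp only [map_add, Polynomial.coeff_add, hp, hq]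
  | mul_X p i hp => simp only [map_mul, Polynomial.mul_coeff_zero, hp]; simp [lineHom]

theorem MvPolynomial.coeff_one_lineHom {k ι : Type*} [CommRing k] [Fintype ι] (x d : ι → k)
    (g : MvPolynomial ι k) :
    (lineHom x d g).coeff 1 = ∑ i, d i * eval x (pderiv i g) := by
  induction g using MvPolynomial.induction_on with
  | C c => simp [lineHom]
  | add p q hp hq =>
    simp only [map_add, Polynomial.coeff_add, hp, hq, mul_add, Finset.sum_add_distrib]
  | mul_X p i hp =>
    classical
    have h1 : (lineHom x d (X i)).coeff 1 = d i := by
      simp [lineHom]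
    have h2 : ∀ j, eval x (pderiv j (X i : MvPolynomial ι k)) = if j = i then 1 else 0 := by
      intro j
      split_ifs with h
      · rw [h, pderiv_X_self, map_one]
      · rw [pderiv_X_of_ne (Ne.symm h), map_zero]
    simp only [map_mul, Polynomial.mul_coeff_one, hp, h1, coeff_zero_lineHom, pderiv_mul, map_add,
      h2, mul_add, Finset.sum_add_distrib, eval_X, mul_ite, mul_one, mul_zero,
      Finset.sum_ite_eq', Finset.mem_univ, if_true, Finset.sum_mul, mul_assoc]
    ring

theorem Polynomial.coeff_C_add_C_mul_X_pow {k : Type*} [CommRing k] (a b : k) (e j : ℕ) :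
    ((C a + C b * X) ^ e).coeff j = e.choose j * (a ^ (e - j) * b ^ j) := by
  have h : (C a + C b * X) ^ e = ((X + C a) ^ e).comp (C b * X) := by
    simp [add_comm]
  rw [h, comp_C_mul_X_coeff, coeff_X_add_C_pow]
  ring

section

variable {k : Type} [Field k]

theorem MvPolynomial.coeff_lineHom_fermat (x d : Fin 3 → k) (e j : ℕ) :
    (lineHom x d (X 0 ^ e + X 1 ^ e + X 2 ^ e + (X 0 + X 1 + X 2) ^ e)).coeff j =
      e.choose j * (x 0 ^ (e - j) * d 0 ^ j + x 1 ^ (e - j) * d 1 ^ j + x 2 ^ (e - j) * d 2 ^ j +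
        (x 0 + x 1 + x 2) ^ (e - j) * (d 0 + d 1 + d 2) ^ j) := by
  have h : lineHom x d (X 0 ^ e + X 1 ^ e + X 2 ^ e + (X 0 + X 1 + X 2) ^ e) =
      (Polynomial.C (x 0) + Polynomial.C (d 0) * Polynomial.X) ^ e +
      (Polynomial.C (x 1) + Polynomial.C (d 1) * Polynomial.X) ^ e +
      (Polynomial.C (x 2) + Polynomial.C (d 2) * Polynomial.X) ^ e +
      (Polynomial.C (x 0 + x 1 + x 2) + Polynomial.C (d 0 + d 1 + d 2) * Polynomial.X) ^ e := by
    simp only [lineHom, map_add, map_pow, aeval_X]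
    congr 2
    ring
  simp only [h, Polynomial.coeff_add, Polynomial.coeff_C_add_C_mul_X_pow]
  ring

variable [CharP k 2]

theorem cast_choose_eq_one {e : ℕ} (he : e % 4 = 3) {j : ℕ} (hj : j ≤ 3) :
    (e.choose j : k) = 1 := by
  have h2 : (2 : k) = 0 := CharTwo.two_eq_zero
  have key : e.choose j % 2 = 1 := by
    have := Choose.choose_modEq_choose_mod_mul_choose_div_nat (n := e) (k := j) (p := 2)
    rw [Nat.ModEq] at this
    rw [this]
    have h1 : e % 2 = 1 := by omega
    rw [h1]
    interval_cases j <;> simp <;> omega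
  rw [← Nat.div_add_mod (e.choose j) 2, key]
  push_cast
  rw [h2]
  ring

theorem false_of_singular_point [IsAlgClosed k] {e : ℕ} (he : e % 4 = 3)
    {g h : MvPolynomial (Fin 3) k}
    (hF : delta3 k * (g * h) = X 0 ^ e + X 1 ^ e + X 2 ^ e + (X 0 + X 1 + X 2) ^ e)
    {x : Fin 3 → k} (hx : x ≠ 0) (hg : eval x g = 0) (hh : eval x h = 0) : False := by
  have two : (2 : k) = 0 := CharTwo.two_eq_zero
  have hcoef := fun d j (hj : j ≤ 3) => coeff_lineHom_fermat x d e j |>.trans (by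
    rw [cast_choose_eq_one he hj, one_mul])
  simp only [← hF] at hcoef
  set w := x 0 + x 1 + x 2 with hw
  have hXg : ∀ d, Polynomial.X ∣ lineHom x d g := fun d => by
    rw [Polynomial.X_dvd_iff, coeff_zero_lineHom, hg]
  have hXh : ∀ d, Polynomial.X ∣ lineHom x d h := fun d => by
    rw [Polynomial.X_dvd_iff, coeff_zero_lineHom, hh]
  have hX2 : ∀ d, Polynomial.X ^ 2 ∣ lineHom x d (g * h) := fun d => by
    rw [map_mul, pow_two]
    exact mul_dvd_mul (hXg d) (hXh d)
  have hlin : ∀ d : Fin 3 → k, x 0 ^ (e - 1) * d 0 ^ 1 + x 1 ^ (e - 1) * d 1 ^ 1 +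
      x 2 ^ (e - 1) * d 2 ^ 1 + w ^ (e - 1) * (d 0 + d 1 + d 2) ^ 1 = 0 := fun d => by
    rw [← hcoef d 1 (by norm_num), map_mul]
    exact (Polynomial.X_pow_dvd_iff.1 ((hX2 d).mul_left _)) 1 (by norm_num)
  set c := w ^ (e - 1) with hc
  have e0 : x 0 ^ (e - 1) = c := by
    have := hlin ![1, 0, 0]; simp at this; exact CharTwo.add_eq_zero.1 this
  have e1 : x 1 ^ (e - 1) = c := by
    have := hlin ![0, 1, 0]; simp at this; exact CharTwo.add_eq_zero.1 this
  have e2 : x 2 ^ (e - 1) = c := by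
    have := hlin ![0, 0, 1]; simp at this; exact CharTwo.add_eq_zero.1 this
  clear_value w c
  have hc0 : c ≠ 0 := by
    intro h0
    apply hx
    funext i
    have he1 : e - 1 ≠ 0 := by omega
    fin_cases i
    · exact (pow_eq_zero_iff he1).1 (e0.trans h0)
    · exact (pow_eq_zero_iff he1).1 (e1.trans h0)
    · exact (pow_eq_zero_iff he1).1 (e2.trans h0)
  have hne : ∀ {y : k}, y ^ (e - 1) = c → y ≠ 0 := by
    rintro y hy rfl
    rw [zero_pow (by omega)] at hy
    exact hc0 hy.symm
  have x0 := hne e0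
  have x1 := hne e1
  have x2 := hne e2
  have w0 : w ≠ 0 := hne hc.symm
  have hp2 : ∀ {y : k}, y ^ (e - 1) = c → y ^ (e - 2) = c * y⁻¹ := by
    intro y hy
    rw [eq_mul_inv_iff_mul_eq₀ (hne hy), ← pow_succ, ← hy]
    congr 1; omega
  have hp3 : ∀ {y : k}, y ^ (e - 1) = c → y ^ (e - 3) = c * (y⁻¹) ^ 2 := by
    intro y hy
    rw [inv_pow, eq_mul_inv_iff_mul_eq₀ (pow_ne_zero 2 (hne hy)), ← pow_add, ← hy]
    congr 1; omega
  have hq := fun d => hcoef d 2 (by norm_num)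
  have ht := fun d => hcoef d 3 (by norm_num)
  simp only [hp2 e0, hp2 e1, hp2 e2, hp2 hc.symm] at hq
  simp only [hp3 e0, hp3 e1, hp3 e2, hp3 hc.symm] at ht
  have hAcoef : ∀ d, (lineHom x d (delta3 k)).coeff 0 =
      (x 0 + x 1) * (x 0 + x 2) * (x 1 + x 2) := fun d => by
    rw [coeff_zero_lineHom]; simp [delta3]
  by_cases hA : (x 0 + x 1) * (x 0 + x 2) * (x 1 + x 2) = 0
  · have hX3 : ∀ d, Polynomial.X ^ 3 ∣ lineHom x d (delta3 k * (g * h)) := fun d => by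
      rw [map_mul, pow_succ']
      exact mul_dvd_mul (Polynomial.X_dvd_iff.2 ((hAcoef d).trans hA)) (hX2 d)
    have hquad := fun d => (hq d).symm.trans (Polynomial.X_pow_dvd_iff.1 (hX3 d) 2 (by norm_num))
    have hinv : ∀ {y : k}, y ≠ 0 → c * y⁻¹ + c * w⁻¹ = 0 → y = w := by
      intro y hy h1
      exact inv_injective (mul_left_cancel₀ hc0 (CharTwo.add_eq_zero.1 h1))
    have f0 : x 0 = w := by
      have := hquad ![1, 0, 0]; simp at this; exact hinv x0 this
    have f1 : x 1 = w := by
      have := hquad ![0, 1, 0]; simp at this; exact hinv x1 this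
    have f2 : x 2 = w := by
      have := hquad ![0, 0, 1]; simp at this; exact hinv x2 this
    obtain ⟨l, hl⟩ : ∃ l : k, l ^ 2 + l + 1 = 0 := by
      have := IsAlgClosed.exists_root (Polynomial.X ^ 2 + Polynomial.X + 1 : Polynomial k) (by
        have : (Polynomial.X ^ 2 + Polynomial.X + 1 : Polynomial k).degree = 2 := by compute_degree!
        rw [this]; norm_num)
      obtain ⟨l, hl⟩ := this
      exact ⟨l, by simpa using hl⟩
    have hX4 : Polynomial.X ^ 4 ∣ lineHom x ![1, l, 0] (delta3 k * (g * h)) := by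
      have : lineHom x ![1, l, 0] (delta3 k) =
          Polynomial.X ^ 3 * Polynomial.C ((1 + l) * l) := by
        have ww : Polynomial.C w + Polynomial.C w = (0 : Polynomial k) := by
          rw [← Polynomial.C_add, ← two_mul, two, zero_mul, Polynomial.C_0]
        simp only [lineHom, delta3, map_mul, map_add, aeval_X, f0, f1, f2, Matrix.cons_val]
        simp only [Polynomial.C_1, Polynomial.C_0]
        generalize Polynomial.C l = m
        generalize Polynomial.C w = v at ww
        have h2 : (2 : Polynomial k) = 0 := CharTwo.two_eq_zero
        linear_combination (4 * v * v + v * m * Polynomial.X + v * Polynomial.X +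
          v * 3 * Polynomial.X * (1 + m) +
          Polynomial.X ^ 2 * (1 + 3 * m + m ^ 2)) * ww
      rw [map_mul, this]
      refine Dvd.dvd.trans ?_ (mul_dvd_mul (Dvd.intro _ rfl) (hX2 _))
      rw [← pow_add]
      exact pow_dvd_pow _ (by norm_num)
    have h3 := (ht _).symm.trans (Polynomial.X_pow_dvd_iff.1 hX4 3 (by norm_num))
    simp only [f0, f1, f2, Matrix.cons_val] at h3
    have : c * w⁻¹ ^ 2 = 0 := by
      linear_combination -h3 + 3 * (c * w⁻¹ ^ 2) * hl + c * w⁻¹ ^ 2 * l ^ 3 * two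
    exact mul_ne_zero hc0 (pow_ne_zero 2 (inv_ne_zero w0)) this
  · set A0 := (x 0 + x 1) * (x 0 + x 2) * (x 1 + x 2) with hA0
    have hbil : ∀ d, (lineHom x d (delta3 k * (g * h))).coeff 2 =
        A0 * ((lineHom x d g).coeff 1 * (lineHom x d h).coeff 1) := by
      intro d
      obtain ⟨G, hG⟩ := hXg d
      obtain ⟨H, hH⟩ := hXh d
      rw [map_mul, map_mul, hG, hH, Polynomial.coeff_X_mul, Polynomial.coeff_X_mul,
        show lineHom x d (delta3 k) * (Polynomial.X * G * (Polynomial.X * H)) =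
          Polynomial.X ^ 2 * (lineHom x d (delta3 k) * (G * H)) by ring,
        show 2 = 0 + 2 from rfl, Polynomial.coeff_X_pow_mul, Polynomial.mul_coeff_zero,
        Polynomial.mul_coeff_zero, hAcoef]
    obtain ⟨α, hα⟩ := IsAlgClosed.exists_pow_nat_eq ((x 0)⁻¹ + w⁻¹) (n := 2) (by norm_num)
    obtain ⟨β, hβ⟩ := IsAlgClosed.exists_pow_nat_eq ((x 1)⁻¹ + w⁻¹) (n := 2) (by norm_num)
    have hg1 : ∀ u v, (lineHom x ![u, v, 0] g).coeff 1 =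
        u * eval x (pderiv 0 g) + v * eval x (pderiv 1 g) := by
      intro u v; rw [coeff_one_lineHom, Fin.sum_univ_three]; simp
    have hh1 : ∀ u v, (lineHom x ![u, v, 0] h).coeff 1 =
        u * eval x (pderiv 0 h) + v * eval x (pderiv 1 h) := by
      intro u v; rw [coeff_one_lineHom, Fin.sum_univ_three]; simp
    set g0 := eval x (pderiv 0 g)
    set g1 := eval x (pderiv 1 g)
    set h0 := eval x (pderiv 0 h)
    set h1 := eval x (pderiv 1 h)
    have hprod : ∀ u v, A0 * ((u * g0 + v * g1) * (u * h0 + v * h1)) =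
        c * (α * u + β * v) ^ 2 := by
      intro u v
      have := hq ![u, v, 0]
      rw [hbil, hg1, hh1] at this
      simp only [Matrix.cons_val] at this
      rw [this]
      linear_combination (-c * u ^ 2) * hα - c * v ^ 2 * hβ + c * w⁻¹ * u * v * two -
        c * α * β * u * v * two
    clear_value A0 g0 g1 h0 h1
    have p00 : A0 * (g0 * h0) = c * α ^ 2 := by linear_combination hprod 1 0
    have p11 : A0 * (g1 * h1) = c * β ^ 2 := by linear_combination hprod 0 1
    have p01 : g0 * h1 + g1 * h0 = 0 := by
      refine (mul_eq_zero.1 ?_).resolve_left hA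
      linear_combination hprod 1 1 - p00 - p11 + c * α * β * two
    have hgz : β * g0 + α * g1 = 0 := by
      refine pow_eq_zero_iff (two_ne_zero) |>.1 ((mul_eq_zero.1 ?_).resolve_left hc0)
      linear_combination -g0 ^ 2 * p11 - g1 ^ 2 * p00 + A0 * g0 * g1 * p01 +
        c * α * β * g0 * g1 * two
    have hhz : β * h0 + α * h1 = 0 := by
      refine pow_eq_zero_iff (two_ne_zero) |>.1 ((mul_eq_zero.1 ?_).resolve_left hc0)
      linear_combination -h0 ^ 2 * p11 - h1 ^ 2 * p00 + A0 * h0 * h1 * p01 +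
        c * α * β * h0 * h1 * two
    have hX4 : Polynomial.X ^ 4 ∣ lineHom x ![β, α, 0] (delta3 k * (g * h)) := by
      rw [map_mul, map_mul]
      refine Dvd.dvd.mul_left ?_ _
      rw [show 4 = 2 + 2 from rfl, pow_add]
      refine mul_dvd_mul ?_ ?_ <;> rw [Polynomial.X_pow_dvd_iff] <;> intro j hj <;>
        interval_cases j
      · rw [coeff_zero_lineHom, hg]
      · rw [hg1, hgz]
      · rw [coeff_zero_lineHom, hh]
      · rw [hh1, hhz]
    have h3 := (ht _).symm.trans (Polynomial.X_pow_dvd_iff.1 hX4 3 (by norm_num))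
    simp only [Matrix.cons_val] at h3
    have key : c * (α * β * (α + β) * (α ^ 2 * β ^ 2 + w⁻¹ ^ 2)) = 0 := by
      have ea : (x 0)⁻¹ = α ^ 2 + w⁻¹ := by linear_combination -hα - w⁻¹ * two
      have eb : (x 1)⁻¹ = β ^ 2 + w⁻¹ := by linear_combination -hβ - w⁻¹ * two
      rw [ea, eb] at h3
      linear_combination h3 - c * (α * β ^ 2 * w⁻¹ ^ 2 + α ^ 2 * β * w⁻¹ ^ 2 +
        α ^ 2 * β ^ 3 * w⁻¹ + α ^ 3 * β ^ 2 * w⁻¹ + α ^ 3 * w⁻¹ ^ 2 + β ^ 3 * w⁻¹ ^ 2) * two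
    have n0 : x 0 + x 1 ≠ 0 := by rintro h; apply hA; rw [hA0, h]; ring
    have n1 : x 0 + x 2 ≠ 0 := by rintro h; apply hA; rw [hA0, h]; ring
    have n2 : x 1 + x 2 ≠ 0 := by rintro h; apply hA; rw [hA0, h]; ring
    have hinv : ∀ {y : k}, y⁻¹ + w⁻¹ = 0 → y = w := fun h =>
      inv_injective (CharTwo.add_eq_zero.1 h)
    have a0 : α ≠ 0 := by
      rintro rfl
      apply n2
      have := hinv (hα.symm.trans (zero_pow two_ne_zero))
      linear_combination -this - hw
    have b0 : β ≠ 0 := by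
      rintro rfl
      apply n1
      have := hinv (hβ.symm.trans (zero_pow two_ne_zero))
      linear_combination -this - hw
    have ab0 : α + β ≠ 0 := by
      intro h
      apply n0
      have h4 : (x 0)⁻¹ = (x 1)⁻¹ := by
        have h5 := CharTwo.add_eq_zero.1 h
        rw [h5] at hα
        exact add_right_cancel (hα.symm.trans hβ)
      exact CharTwo.add_eq_zero.2 (inv_injective h4)
    have l0 : α ^ 2 * β ^ 2 + w⁻¹ ^ 2 ≠ 0 := by
      rw [hα, hβ]
      intro h
      have h4 : x 0 + x 1 + w = 0 := by
        have h5 : x 0 * x 1 * w * (((x 0)⁻¹ + w⁻¹) * ((x 1)⁻¹ + w⁻¹) + w⁻¹ ^ 2) =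
            x 0 + x 1 + w + x 0 * x 1 * w⁻¹ * 2 := by
          field_simp
          ring
        rw [h, two, mul_zero, mul_zero, add_zero] at h5
        exact h5.symm
      apply x2
      linear_combination h4 - hw - (x 0 + x 1) * two
    exact mul_ne_zero hc0 (mul_ne_zero (mul_ne_zero (mul_ne_zero a0 b0) ab0) l0) key

end

theorem MvPolynomial.eq_C_of_natDegree_homogenizeHom_eq_zero {ι k : Type*} [CommRing k]
    {P : MvPolynomial ι k} (h : (homogenizeHom ι k P).natDegree = 0) : P = C (P.coeff 0) := by
  have h1 := eval_one_homogenizeHom P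
  rw [Polynomial.eq_C_of_natDegree_eq_zero h, Polynomial.eval_C, coeff_homogenizeHom,
    homogeneousComponent_zero] at h1
  exact h1.symm

theorem MvPolynomial.isUnit_of_natDegree_homogenizeHom_eq_zero {ι k : Type*} [Field k]
    {P : MvPolynomial ι k} (hP : P ≠ 0) (h : (homogenizeHom ι k P).natDegree = 0) : IsUnit P := by
  have h1 := eq_C_of_natDegree_homogenizeHom_eq_zero h
  rw [h1]
  refine (isUnit_iff_ne_zero.2 fun h0 => hP ?_).map C
  rw [h1, h0, C_0]

theorem MvPolynomial.irreducible_X_add_X_add_C {ι k : Type*} [Field k] {i j : ι} (h : i ≠ j)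
    (c : k) : Irreducible (X i + X j + C c : MvPolynomial ι k) := by
  classical
  have hc : coeff (Finsupp.single i 1) (X i + X j + C c : MvPolynomial ι k) = 1 := by
    have h1 : Finsupp.single j 1 ≠ Finsupp.single i 1 := fun hh =>
      h ((Finsupp.single_left_injective one_ne_zero) hh).symm
    have h2 : (0 : ι →₀ ℕ) ≠ Finsupp.single i 1 := fun hh =>
      one_ne_zero (Finsupp.single_eq_zero.1 hh.symm)
    simp [coeff_X, coeff_C, h1, h2]
  refine irreducible_of_totalDegree_eq_one (le_antisymm ?_ ?_) fun x hx => ?_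
  · refine (totalDegree_add _ _).trans (max_le ((totalDegree_add _ _).trans ?_) ?_) <;>
      simp [totalDegree_X]
  · have := le_totalDegree (p := (X i + X j + C c : MvPolynomial ι k)) (s := Finsupp.single i 1)
      (by rw [mem_support_iff, hc]; exact one_ne_zero)
    simpa using this
  · exact isUnit_of_dvd_one (hc ▸ hx (Finsupp.single i 1))

theorem MvPolynomial.irreducible_X_add_X {ι k : Type*} [Field k] {i j : ι} (h : i ≠ j) :
    Irreducible (X i + X j : MvPolynomial ι k) := by
  simpa using irreducible_X_add_X_add_C (k := k) h 0

theorem MvPolynomial.not_dvd_of_eval {ι k : Type*} [Field k] {P Q : MvPolynomial ι k} (x : ι → k)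
    (hP : eval x P = 0) (hQ : eval x Q ≠ 0) : ¬ P ∣ Q := by
  rintro ⟨R, rfl⟩
  exact hQ (by rw [map_mul, hP, zero_mul])

section

variable {k : Type} [Field k]

theorem delta3_isHomogeneous : (delta3 k).IsHomogeneous 3 :=
  (((isHomogeneous_X k 0).add (isHomogeneous_X k 1)).mul
    ((isHomogeneous_X k 0).add (isHomogeneous_X k 2))).mul
    ((isHomogeneous_X k 1).add (isHomogeneous_X k 2))

theorem delta3_ne_zero : delta3 k ≠ 0 :=
  mul_ne_zero (mul_ne_zero (irreducible_X_add_X (by decide)).ne_zero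
    (irreducible_X_add_X (by decide)).ne_zero) (irreducible_X_add_X (by decide)).ne_zero

/-- The form `x ^ e + y ^ e + z ^ e + (x + y + z) ^ e`. -/
noncomputable def powerForm (k : Type) [Field k] (e : ℕ) : MvPolynomial (Fin 3) k :=
  X 0 ^ e + X 1 ^ e + X 2 ^ e + (X 0 + X 1 + X 2) ^ e

theorem powerForm_isHomogeneous (e : ℕ) : (powerForm k e).IsHomogeneous e := by
  have hX : ∀ i : Fin 3, (X i ^ e : MvPolynomial (Fin 3) k).IsHomogeneous e := fun i => by
    simpa using (isHomogeneous_X k i).pow e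
  refine (((hX 0).add (hX 1)).add (hX 2)).add ?_
  simpa using (((isHomogeneous_X k 0).add (isHomogeneous_X k 1)).add (isHomogeneous_X k 2)).pow e

variable [CharP k 2]

theorem delta3_mul_dvd {P : MvPolynomial (Fin 3) k} (c : k) (h1 : X 0 + X 1 + C c ∣ P)
    (h2 : X 0 + X 2 + C c ∣ P) (h3 : X 1 + X 2 + C c ∣ P) :
    (X 0 + X 1 + C c) * (X 0 + X 2 + C c) * (X 1 + X 2 + C c) ∣ P := by
  refine Irreducible.mul_mul_dvd_of_not_associated (irreducible_X_add_X_add_C (by decide) c)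
    (irreducible_X_add_X_add_C (by decide) c) (irreducible_X_add_X_add_C (by decide) c)
    (fun h => ?_) (fun h => ?_) (fun h => ?_) h1 h2 h3
  · exact not_dvd_of_eval ![c, 0, 1] (by simp [CharTwo.add_self_eq_zero])
      (by simp [add_right_comm, CharTwo.add_self_eq_zero]) h.dvd
  · exact not_dvd_of_eval ![0, c, 1] (by simp [CharTwo.add_self_eq_zero])
      (by simp [add_right_comm, CharTwo.add_self_eq_zero]) h.dvd
  · exact not_dvd_of_eval ![0, 1, c] (by simp [CharTwo.add_self_eq_zero])
      (by simp [add_assoc, CharTwo.add_self_eq_zero]) h.dvd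

theorem delta3_dvd {P : MvPolynomial (Fin 3) k} (h1 : X 0 + X 1 ∣ P)
    (h2 : X 0 + X 2 ∣ P) (h3 : X 1 + X 2 ∣ P) : delta3 k ∣ P := by
  simpa [delta3] using delta3_mul_dvd (P := P) 0 (by simpa using h1) (by simpa using h2)
    (by simpa using h3)

theorem powerForm_ne_zero {e : ℕ} (he : e % 4 = 3) : powerForm k e ≠ 0 := by
  intro h0
  have h := coeff_lineHom_fermat (k := k) ![0, 1, 0] ![1, 0, 0] e 1
  rw [cast_choose_eq_one he (by norm_num), ← powerForm, h0] at h
  have h1 : e - 1 ≠ 0 := by omega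
  simp [h1] at h

theorem delta3_dvd_powerForm (e : ℕ) : delta3 k ∣ powerForm k e := by
  have two : (2 : MvPolynomial (Fin 3) k) = 0 := CharTwo.two_eq_zero
  have key : ∀ a b c : MvPolynomial (Fin 3) k,
      a + b ∣ a ^ e + b ^ e + (c ^ e + (a + b + c) ^ e) := by
    intro a b c
    refine dvd_add ?_ ?_
    · have := sub_dvd_pow_sub_pow a b e
      rwa [CharTwo.sub_eq_add, CharTwo.sub_eq_add] at this
    · have := sub_dvd_pow_sub_pow (a + b + c) c e
      rwa [add_sub_cancel_right, CharTwo.sub_eq_add, add_comm (_ ^ e)] at this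
  refine delta3_dvd ?_ ?_ ?_
  · convert key (X 0) (X 1) (X 2) using 1
    rw [powerForm]; ring
  · convert key (X 0) (X 2) (X 1) using 1
    rw [powerForm]; ring
  · convert key (X 1) (X 2) (X 0) using 1
    rw [powerForm]; ring

theorem MvPolynomial.IsHomogeneous.leadingForm_of_mul_eq {ι K : Type*} [Field K]
    {P Q g : MvPolynomial ι K} {m n : ℕ} (hP : P.IsHomogeneous m) (hQ : Q.IsHomogeneous n)
    (hP0 : P ≠ 0) (h : P * g = Q) : leadingForm g = g := by
  have h1 : leadingForm (P * g) = leadingForm Q := by rw [h]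
  rw [leadingForm_mul, hP.leadingForm_eq, hQ.leadingForm_eq, ← h] at h1
  exact mul_left_cancel₀ hP0 h1

theorem isUnit_or_irreducible_of_delta3_mul_eq [IsAlgClosed k] {e : ℕ} (he : e % 4 = 3)
    {g : MvPolynomial (Fin 3) k} (hg : delta3 k * g = powerForm k e) :
    IsUnit g ∨ Irreducible g := by
  by_contra! hcon
  obtain ⟨h1, h2⟩ := hcon
  have hg0 : g ≠ 0 := by
    rintro rfl
    exact powerForm_ne_zero he (by rw [← hg, mul_zero])
  obtain ⟨a, b, ha, hb, rfl⟩ : ∃ a b, ¬ IsUnit a ∧ ¬ IsUnit b ∧ g = a * b := by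
    rw [irreducible_iff] at h2
    push Not at h2
    obtain ⟨a, b, h3, h4, h5⟩ := h2 h1
    exact ⟨a, b, h4, h5, h3⟩
  have hlead := delta3_isHomogeneous.leadingForm_of_mul_eq (powerForm_isHomogeneous e)
    delta3_ne_zero hg
  rw [leadingForm_mul] at hlead
  have hzero : ∀ {P : MvPolynomial (Fin 3) k}, P ≠ 0 → ¬ IsUnit P →
      eval 0 (leadingForm P) = 0 := by
    intro P hP0 hP
    rw [eval_zero, constantCoeff_eq]
    refine (leadingForm_isHomogeneous P).coeff_eq_zero ?_
    rw [map_zero]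
    exact fun h => hP (isUnit_of_natDegree_homogenizeHom_eq_zero hP0 h.symm)
  obtain ⟨x, hx, h3, h4⟩ := exists_ne_zero_eval_eq_zero
    (hzero (left_ne_zero_of_mul hg0) ha) (hzero (right_ne_zero_of_mul hg0) hb)
  refine false_of_singular_point he (g := leadingForm a) (h := leadingForm b) ?_ hx h3 h4
  rw [hlead, hg, powerForm]

end

theorem phiNum_add {k : Type} [CommRing k] (p q : Polynomial k) :
    phiNum (p + q) = phiNum p + phiNum q := by
  simp only [phiNum, map_add]
  ring

theorem phiNum_map {k K : Type} [CommRing k] [CommRing K] (i : k →+* K) (p : Polynomial k) :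
    phiNum (p.map i) = map i (phiNum p) := by
  simp only [phiNum, map_add, Polynomial.aeval_def, Polynomial.eval₂_map, Polynomial.hom_eval₂,
    map_X, algebraMap_eq]
  have : (C : K →+* MvPolynomial (Fin 3) K).comp i = (map i).comp C := by
    ext1 x
    simp
  rw [this]

theorem delta3_map {k K : Type} [CommRing k] [CommRing K] (i : k →+* K) :
    map i (delta3 k) = delta3 K := by
  simp [delta3]

section

variable {k : Type} [Field k]

theorem phiNum_monomial (n : ℕ) (c : k) :
    phiNum (Polynomial.monomial n c) = C c * powerForm k n := by
  simp only [phiNum, powerForm, Polynomial.aeval_monomial, algebraMap_eq]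
  ring

theorem degree_homogenizeHom_phiNum_lt {p : Polynomial k} {d : ℕ} (hp : p.degree < d) :
    (homogenizeHom (Fin 3) k (phiNum p)).degree < d := by
  classical
  rw [← Polynomial.mem_degreeLT] at hp ⊢
  have h : ∀ q : Polynomial k, q ∈ Polynomial.degreeLT k d →
      homogenizeHom (Fin 3) k (phiNum q) ∈ Polynomial.degreeLT (MvPolynomial (Fin 3) k) d := by
    intro q hq
    rw [Polynomial.degreeLT_eq_span_X_pow] at hq
    induction hq using Submodule.span_induction with
    | mem q hq =>
      obtain ⟨n, hn, rfl⟩ := Finset.mem_image.1 (Finset.mem_coe.1 hq)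
      rw [Polynomial.X_pow_eq_monomial, phiNum_monomial, C_1, one_mul,
        (powerForm_isHomogeneous n).homogenizeHom, Polynomial.mem_degreeLT]
      exact (Polynomial.degree_monomial_le _ _).trans_lt
        (by exact_mod_cast Finset.mem_range.1 hn)
    | zero => simp [phiNum]
    | add q r _ _ hq hr =>
      rw [phiNum_add, map_add]
      exact Submodule.add_mem _ hq hr
    | smul c q _ hq =>
      have : phiNum (c • q) = C c * phiNum q := by
        simp only [phiNum, map_smul, smul_eq_C_mul]
        ring
      rw [this, map_mul, (isHomogeneous_C _ c).homogenizeHom, Polynomial.monomial_zero_left,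
        ← Polynomial.smul_eq_C_mul]
      exact Submodule.smul_mem _ _ hq
  exact h p hp

theorem leadingForm_of_delta3_mul_eq_phiNum [CharP k 2] {e : ℕ} (he : e % 4 = 3)
    {f : Polynomial k} (hf : f.natDegree = 4 * e) {φ g : MvPolynomial (Fin 3) k}
    (hφ : delta3 k * φ = phiNum f) (hg : delta3 k * g = powerForm k e) :
    leadingForm φ = C f.leadingCoeff * (delta3 k ^ 3 * g ^ 4) := by
  have hf0 : f ≠ 0 := by
    rintro rfl
    rw [Polynomial.natDegree_zero] at hf
    omega
  have hpow : powerForm k (4 * e) = powerForm k e ^ 4 := by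
    have h4 : ∀ a b : MvPolynomial (Fin 3) k, (a + b) ^ 4 = a ^ 4 + b ^ 4 := fun a b =>
      add_pow_char_pow (p := 2) (n := 2) a b
    rw [powerForm, powerForm, h4, h4, h4]
    ring
  have h0 : C f.leadingCoeff * powerForm k (4 * e) ≠ 0 :=
    mul_ne_zero ((map_ne_zero_iff _ (C_injective _ _)).2 (Polynomial.leadingCoeff_ne_zero.2 hf0))
      (hpow ▸ pow_ne_zero 4 (powerForm_ne_zero he))
  have h1 : leadingForm (phiNum f) = C f.leadingCoeff * powerForm k (4 * e) := by
    conv_lhs => rw [← f.eraseLead_add_monomial_natDegree_leadingCoeff]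
    rw [add_comm, phiNum_add, phiNum_monomial, hf]
    refine leadingForm_add_of_degree_lt (d := 4 * e) ?_ h0 (degree_homogenizeHom_phiNum_lt ?_)
    · simpa using (isHomogeneous_C (Fin 3) f.leadingCoeff).mul (powerForm_isHomogeneous (4 * e))
    · refine (Polynomial.degree_eraseLead_lt hf0).trans_le ?_
      rw [← hf]
      exact Polynomial.degree_le_natDegree
  rw [← hφ, leadingForm_mul, delta3_isHomogeneous.leadingForm_eq, hpow, ← hg] at h1
  refine mul_left_cancel₀ (delta3_ne_zero (k := k)) ?_
  rw [h1]
  ring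

end

/-- The order of vanishing of the leading form of `P` along `l`. -/
noncomputable def formOrd {ι k : Type*} [Field k] (l P : MvPolynomial ι k) : ℕ :=
  multiplicity l (leadingForm P)

section

variable {ι k : Type*} [Field k]

theorem formOrd_mul {l : MvPolynomial ι k} (hl : Irreducible l) (a b : MvPolynomial ι k)
    (ha : a ≠ 0) (hb : b ≠ 0) : formOrd l (a * b) = formOrd l a + formOrd l b := by
  rw [formOrd, leadingForm_mul, multiplicity_mul hl.prime]
  · rfl
  · exact .of_prime_left hl.prime (mul_ne_zero (leadingForm_ne_zero ha) (leadingForm_ne_zero hb))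

theorem formOrd_map_ringEquiv (ψ : MvPolynomial ι k ≃+* MvPolynomial ι k)
    (hψ : ∀ P, leadingForm (ψ P) = ψ (leadingForm P)) (l P : MvPolynomial ι k) :
    formOrd (ψ l) (ψ P) = formOrd l P := by
  rw [formOrd, hψ, multiplicity_map_eq, formOrd]

theorem formOrd_le_of_dvd {l : MvPolynomial ι k} (hl : Irreducible l) {P Q : MvPolynomial ι k}
    (h : P ∣ Q) (hQ : Q ≠ 0) : formOrd l P ≤ formOrd l Q := by
  obtain ⟨R, rfl⟩ := h
  rw [formOrd_mul hl _ _ (left_ne_zero_of_mul hQ) (right_ne_zero_of_mul hQ)]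
  exact Nat.le_add_right _ _

theorem formOrd_eq_of_associated {l : MvPolynomial ι k} (hl : Irreducible l)
    {P Q : MvPolynomial ι k} (h : Associated P Q) : formOrd l P = formOrd l Q := by
  rcases eq_or_ne Q 0 with rfl | hQ
  · rw [(associated_zero_iff_eq_zero _).1 h]
  · exact le_antisymm (formOrd_le_of_dvd hl h.dvd hQ)
      (formOrd_le_of_dvd hl h.symm.dvd (h.ne_zero_iff.2 hQ))

theorem multiplicity_pow_of_prime {R : Type*} [CommRing R] [IsDomain R]
    [WfDvdMonoid R] {p a : R} (hp : Prime p) (ha : a ≠ 0) (n : ℕ) :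
    multiplicity p (a ^ n) = n * multiplicity p a := by
  induction n with
  | zero =>
    rw [pow_zero, Nat.zero_mul, multiplicity_eq_zero]
    exact fun h => hp.not_isUnit (isUnit_of_dvd_one h)
  | succ n ih =>
    rw [pow_succ, multiplicity_mul hp (.of_prime_left hp (mul_ne_zero (pow_ne_zero n ha) ha)), ih]
    ring

theorem leadingForm_mapEquiv (s : k ≃+* k) (P : MvPolynomial ι k) :
    leadingForm (mapEquiv ι s P) = mapEquiv ι s (leadingForm P) :=
  leadingForm_map (f := (s : k →+* k)) s.injective P

theorem leadingForm_renameEquiv (π : Equiv.Perm ι) (P : MvPolynomial ι k) :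
    leadingForm (renameEquiv k π P) = renameEquiv k π (leadingForm P) :=
  leadingForm_rename π.injective P

end

section

variable {k : Type} [Field k]

theorem not_dvd_X_add_X {i j i' j' : Fin 3} (hj : j ≠ i') (hj' : j ≠ j') (h : i = i' ∨ i = j')
    (hij : i' ≠ j') : ¬ (X i' + X j' : MvPolynomial (Fin 3) k) ∣ X i + X j := by
  refine not_dvd_of_eval (fun t => if t = j then 1 else 0) ?_ ?_
  · simp [hj.symm, hj'.symm]
  · rcases h with rfl | rfl
    · simp [hj.symm]
    · simp [hj'.symm]

theorem formOrd_eq_of_leadingForm_eq {g Φ : MvPolynomial (Fin 3) k} {a : k} (ha : a ≠ 0)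
    (hg0 : g ≠ 0) (hΦ : leadingForm Φ = C a * (delta3 k ^ 3 * g ^ 4))
    {l : MvPolynomial (Fin 3) k} (hl : Irreducible l) :
    formOrd l Φ = 3 * multiplicity l (delta3 k) + 4 * multiplicity l g := by
  have hd := pow_ne_zero 3 (delta3_ne_zero (k := k))
  have hg4 := pow_ne_zero 4 hg0
  have hC : (C a : MvPolynomial (Fin 3) k) ≠ 0 := (map_ne_zero_iff _ (C_injective _ _)).2 ha
  rw [formOrd, hΦ, multiplicity_mul hl.prime (.of_prime_left hl.prime (mul_ne_zero hC
    (mul_ne_zero hd hg4))), multiplicity_mul hl.prime (.of_prime_left hl.prime (mul_ne_zero hd hg4)),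
    multiplicity_pow_of_prime hl.prime hg0, multiplicity_pow_of_prime hl.prime delta3_ne_zero,
    multiplicity_of_isUnit_right hl.not_isUnit ((isUnit_iff_ne_zero.2 ha).map C), zero_add]

theorem multiplicity_delta3_eq {l : MvPolynomial (Fin 3) k} (hl : Irreducible l) :
    multiplicity l (delta3 k) = multiplicity l (X 0 + X 1 : MvPolynomial (Fin 3) k) +
      multiplicity l (X 0 + X 2 : MvPolynomial (Fin 3) k) +
      multiplicity l (X 1 + X 2 : MvPolynomial (Fin 3) k) := by
  have h := delta3_ne_zero (k := k)
  rw [delta3] at h ⊢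
  rw [multiplicity_mul hl.prime (.of_prime_left hl.prime h),
    multiplicity_mul hl.prime (.of_prime_left hl.prime (left_ne_zero_of_mul h))]

theorem multiplicity_X_add_X_delta3 {i j : Fin 3} (hij : i < j) :
    multiplicity (X i + X j : MvPolynomial (Fin 3) k) (delta3 k) = 1 := by
  rw [multiplicity_delta3_eq (irreducible_X_add_X hij.ne)]
  have hz : ∀ {i j i' j' : Fin 3}, j ≠ i' → j ≠ j' → (i = i' ∨ i = j') → i' ≠ j' →
    multiplicity (X i' + X j' : MvPolynomial (Fin 3) k) (X i + X j) = 0 := fun h1 h2 h3 h4 =>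
    multiplicity_eq_zero.2 (not_dvd_X_add_X h1 h2 h3 h4)
  have hc : ∀ i j : Fin 3, (X i + X j : MvPolynomial (Fin 3) k) = X j + X i :=
    fun i j => add_comm _ _
  fin_cases i <;> fin_cases j <;> simp at hij <;> simp only [Fin.zero_eta, Fin.mk_one,
    Fin.reduceFinMk, multiplicity_self]
  · rw [hz (by decide) (by decide) (by decide) (by decide),
      hz (by decide) (by decide) (by decide) (by decide)]
  · rw [hz (by decide) (by decide) (by decide) (by decide), hc 1 2,
      hc 0 2, hz (i := 2) (by decide) (by decide) (by decide) (by decide)]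
  · rw [hc 0 1, hc 0 2, hz (by decide) (by decide) (by decide) (by decide),
      hz (by decide) (by decide) (by decide) (by decide)]

end

section

variable {k : Type} [Field k]

theorem exists_orbit_of_no_fixed_irreducible {a : k} (ha : a ≠ 0)
    {g Φ : MvPolynomial (Fin 3) k} (hg0 : g ≠ 0)
    (hgl : ∀ i j : Fin 3, i < j → ¬ X i + X j ∣ g)
    (hΦ : leadingForm Φ = C a * (delta3 k ^ 3 * g ^ 4)) {s : k ≃+* k}
    (hσΦ : mapEquiv (Fin 3) s Φ = Φ) (hσg : mapEquiv (Fin 3) s g = g)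
    (hτ : ∀ π : Equiv.Perm (Fin 3), rename π Φ = Φ)
    (hno : ∀ P, Irreducible P → P ∣ Φ → ¬ Associated (mapEquiv (Fin 3) s P) P) :
    ∃ P, Irreducible P ∧ P ∣ Φ ∧ formOrd (X 0 + X 1) P = 1 ∧
      (∀ i j : Fin 3, i < j → formOrd (X i + X j) P ≤ 1) ∧
      formOrd (X 0 + X 2) P = formOrd (X 1 + X 2) P ∧
      (Irreducible g → ¬ g ∣ leadingForm P) ∧
      ¬ Associated P (mapEquiv (Fin 3) s P) ∧
      ¬ Associated P (mapEquiv (Fin 3) s (mapEquiv (Fin 3) s P)) ∧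
      Associated (mapEquiv (Fin 3) s (mapEquiv (Fin 3) s (mapEquiv (Fin 3) s P))) P ∧
      ∀ π : Equiv.Perm (Fin 3), formOrd (X 0 + X 1) (rename π P) ≠ 0 →
        Associated (rename π P) P ∨ Associated (rename π P) (mapEquiv (Fin 3) s P) ∨
          Associated (rename π P) (mapEquiv (Fin 3) s (mapEquiv (Fin 3) s P)) := by
  have hΦ0 : Φ ≠ 0 := by
    rintro rfl
    have h0 : C a * (delta3 k ^ 3 * g ^ 4) ≠ 0 :=
      mul_ne_zero ((map_ne_zero_iff _ (C_injective _ _)).2 ha)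
        (mul_ne_zero (pow_ne_zero 3 delta3_ne_zero) (pow_ne_zero 4 hg0))
    exact h0 (by rw [← hΦ, leadingForm, map_zero, Polynomial.leadingCoeff_zero])
  have hirr : ∀ {i j : Fin 3}, i < j → Irreducible (X i + X j : MvPolynomial (Fin 3) k) :=
    fun h => irreducible_X_add_X h.ne
  set σ := mapEquiv (Fin 3) s with hσ
  have hσl : ∀ i j : Fin 3, σ (X i + X j) = X i + X j := by
    intro i j
    rw [hσ, map_add, mapEquiv_apply, mapEquiv_apply, map_X, map_X]
  have hinv : ∀ l, σ l = l → ∀ P, formOrd l (σ P) = formOrd l P := fun l hl P => by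
    conv_lhs => rw [← hl]
    exact formOrd_map_ringEquiv σ (leadingForm_mapEquiv s) l P
  have h3 : ∀ {i j : Fin 3}, i < j → formOrd (X i + X j) Φ = 3 := by
    intro i j hij
    rw [formOrd_eq_of_leadingForm_eq ha hg0 hΦ (hirr hij), multiplicity_X_add_X_delta3 hij,
      multiplicity_eq_zero.2 (hgl i j hij)]
  have h01 : (0 : Fin 3) < 1 := by decide
  have h02 : (0 : Fin 3) < 2 := by decide
  have h12 : (1 : Fin 3) < 2 := by decide
  obtain ⟨P, hP, hP1, hPσ, hPσσ, hσσσ, R, hR0, hΦR, hσR⟩ :=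
    exists_orbit_of_eq_three σ hΦ0 (by rw [hσΦ]) (formOrd_mul (hirr h01))
      (hinv _ (hσl 0 1)) (h3 h01) hno
  have hσ0 : ∀ {Q}, Q ≠ 0 → σ Q ≠ 0 := fun h => (map_ne_zero_iff σ σ.injective).2 h
  have hsum : ∀ l, Irreducible l → σ l = l → formOrd l Φ = 3 * formOrd l P + formOrd l R := by
    intro l hl hσl
    have hp0 := hP.ne_zero
    have hp1 := hσ0 hp0
    have hp2 := hσ0 hp1
    rw [hΦR, formOrd_mul hl _ _ (mul_ne_zero (mul_ne_zero hp0 hp1) hp2) hR0,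
      formOrd_mul hl _ _ (mul_ne_zero hp0 hp1) hp2, formOrd_mul hl _ _ hp0 hp1, hinv _ hσl,
      hinv _ hσl, hinv _ hσl]
    ring
  have hPΦ : P ∣ Φ := by
    rw [hΦR, mul_assoc, mul_assoc]; exact dvd_mul_right _ _
  have hRΦ : R ∣ Φ := by
    rw [hΦR]; exact dvd_mul_left _ _
  have hR1 : formOrd (X 0 + X 1) R = 0 := by
    have := hsum _ (hirr h01) (hσl 0 1)
    rw [h3 h01, hP1] at this
    omega
  have horb : ∀ π : Equiv.Perm (Fin 3), formOrd (X 0 + X 1) (rename π P) ≠ 0 →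
        Associated (rename π P) P ∨ Associated (rename π P) (σ P) ∨
          Associated (rename π P) (σ (σ P)) := by
    intro π hπ
    have hπP : Irreducible (rename π P) :=
      (MulEquiv.irreducible_iff (renameEquiv k π)).2 hP
    have hd : rename π P ∣ P * σ P * σ (σ P) * R := by
      rw [← hΦR, ← hτ π]
      exact map_dvd (rename π) hPΦ
    have hσi : ∀ {b}, Irreducible b → Irreducible (σ b) := fun h => (MulEquiv.irreducible_iff σ).2 h
    rcases hπP.prime.dvd_or_dvd hd with hd | hd
    · rcases hπP.prime.dvd_or_dvd hd with hd | hd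
      · rcases hπP.prime.dvd_or_dvd hd with hd | hd
        · exact .inl ((hπP.dvd_irreducible_iff_associated hP).1 hd)
        · exact .inr (.inl ((hπP.dvd_irreducible_iff_associated (hσi hP)).1 hd))
      · exact .inr (.inr ((hπP.dvd_irreducible_iff_associated (hσi (hσi hP))).1 hd))
    · have := formOrd_le_of_dvd (hirr h01) hd hR0
      omega
  have hren : ∀ (π : Equiv.Perm (Fin 3)) (i j : Fin 3),
      formOrd (X (π i) + X (π j)) (rename π P) = formOrd (X i + X j) P := by
    intro π i j
    have := formOrd_map_ringEquiv (renameEquiv k π).toRingEquiv (leadingForm_renameEquiv π)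
      (X i + X j) P
    simpa using this
  refine ⟨P, hP, hPΦ, hP1, fun i j hij => ?_, ?_, fun hg hgP => ?_, hPσ, hPσσ, hσσσ, horb⟩
  · have := hsum _ (hirr hij) (hσl i j)
    rw [h3 hij] at this
    omega
  · have h4 := hren (Equiv.swap 0 1) 0 2
    rw [Equiv.swap_apply_left, Equiv.swap_apply_of_ne_of_ne (by decide) (by decide)] at h4
    have h5 := hren (Equiv.swap 0 1) 0 1
    rw [Equiv.swap_apply_left, Equiv.swap_apply_right, add_comm] at h5
    rw [← h4]
    rcases horb (Equiv.swap 0 1) (by rw [h5, hP1]; exact one_ne_zero) with h | h | h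
    · exact formOrd_eq_of_associated (hirr h12) h
    · rw [formOrd_eq_of_associated (hirr h12) h, hinv _ (hσl 1 2)]
    · rw [formOrd_eq_of_associated (hirr h12) h, hinv _ (hσl 1 2), hinv _ (hσl 1 2)]
  · have h4 : multiplicity g (delta3 k) = 0 := by
      rw [multiplicity_eq_zero, delta3]
      intro hd
      have hl : ∀ i j : Fin 3, i < j → ¬ g ∣ X i + X j := fun i j hij hd =>
        hgl i j hij ((hg.dvd_irreducible_iff_associated (hirr hij)).1 hd).symm.dvd
      rcases hg.prime.dvd_or_dvd hd with hd | hd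
      · exact (hg.prime.dvd_or_dvd hd).elim (hl 0 1 h01) (hl 0 2 h02)
      · exact hl 1 2 h12 hd
    have h5 := formOrd_eq_of_leadingForm_eq ha hg0 hΦ hg
    rw [h4, multiplicity_self, hsum g hg hσg] at h5
    have h6 : formOrd g P ≠ 0 := multiplicity_ne_zero.2 hgP
    have h7 : formOrd g R = 1 := by omega
    obtain ⟨Q, hQ, hQR, hQσ⟩ := exists_fixed_irreducible_of_eq_one σ hR0 hσR (formOrd_mul hg)
      (hinv g hσg) h7
    exact hno Q hQ (hQR.trans hRΦ) hQσ

end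

theorem MvPolynomial.coeff_sub_leadingForm_eq_zero {ι k : Type*} [CommRing k]
    {P : MvPolynomial ι k} {m : ι →₀ ℕ} (h : (homogenizeHom ι k P).natDegree ≤ m.degree) :
    coeff m (P - leadingForm P) = 0 := by
  classical
  rw [coeff_sub, leadingForm, Polynomial.leadingCoeff, coeff_homogenizeHom,
    coeff_homogeneousComponent]
  split_ifs with h1
  · exact sub_self _
  · have h2 : coeff m (homogeneousComponent m.degree P) = 0 := by
      rw [← coeff_homogenizeHom, Polynomial.coeff_eq_zero_of_natDegree_lt (by omega), coeff_zero]
    rw [coeff_homogeneousComponent, if_pos rfl] at h2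
    rw [h2, sub_zero]

theorem MvPolynomial.eq_of_leadingForm_eq {ι k : Type*} [CommRing k] {P : MvPolynomial ι k}
    {l : MvPolynomial ι k} (hl : l.IsHomogeneous 1) (hl0 : l ≠ 0) (h : leadingForm P = l) :
    P = l + C (coeff 0 P) := by
  have hd : (homogenizeHom ι k P).natDegree = 1 :=
    (leadingForm_isHomogeneous P).inj_right (h ▸ hl) (h ▸ hl0)
  rw [← sub_eq_iff_eq_add']
  classical
  ext m
  rw [← h, coeff_C]
  split_ifs with h0
  · rw [← h0, coeff_sub, h, hl.coeff_eq_zero (by simp), sub_zero]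
  · refine coeff_sub_leadingForm_eq_zero ?_
    rw [hd]
    exact Nat.one_le_iff_ne_zero.2 fun h1 => h0 ((Finsupp.degree_eq_zero_iff m).1 h1).symm

theorem MvPolynomial.eq_of_degree_lt_three_of_symmetric {k : Type*} [CommRing k]
    {R : MvPolynomial (Fin 3) k} (hR : ∀ m : Fin 3 →₀ ℕ, 3 ≤ m.degree → coeff m R = 0)
    (h01 : rename (Equiv.swap 0 1) R = R) (h02 : rename (Equiv.swap 0 2) R = R) :
    R = C (coeff (Finsupp.single 0 2) R) * (X 0 ^ 2 + X 1 ^ 2 + X 2 ^ 2) +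
        C (coeff (Finsupp.single 0 1 + Finsupp.single 1 1) R) *
          (X 0 * X 1 + X 0 * X 2 + X 1 * X 2) +
        C (coeff (Finsupp.single 0 1) R) * (X 0 + X 1 + X 2) + C (coeff 0 R) := by
  have hs : ∀ (π : Equiv.Perm (Fin 3)), rename π R = R → ∀ (a b : Fin 3 →₀ ℕ),
      (∀ i, b (π i) = a i) → coeff a R = coeff b R := by
    intro π hπ a b hab
    conv_rhs => rw [← hπ]
    rw [← coeff_rename_mapDomain π π.injective]
    congr 1
    ext i
    rw [Finsupp.mapDomain_equiv_apply, ← hab, Equiv.apply_symm_apply]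
  let v : ℕ → ℕ → ℕ → (Fin 3 →₀ ℕ) := fun a b c => Finsupp.equivFunOnFinite.symm ![a, b, c]
  have hv : ∀ m, m = v (m 0) (m 1) (m 2) := by
    intro m
    ext i
    fin_cases i <;> rfl
  have hmon : ∀ a b c : ℕ, (X 0 ^ a * X 1 ^ b * X 2 ^ c : MvPolynomial (Fin 3) k) =
      monomial (v a b c) 1 := by
    intro a b c
    rw [monomial_eq, C_1, one_mul, Finsupp.prod_fintype _ _ (by simp), Fin.prod_univ_three]
    rfl
  have e0 : (X 0 : MvPolynomial (Fin 3) k) = monomial (v 1 0 0) 1 := by rw [← hmon]; simp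
  have e1 : (X 1 : MvPolynomial (Fin 3) k) = monomial (v 0 1 0) 1 := by rw [← hmon]; simp
  have e2 : (X 2 : MvPolynomial (Fin 3) k) = monomial (v 0 0 1) 1 := by rw [← hmon]; simp
  have e3 : (X 0 ^ 2 : MvPolynomial (Fin 3) k) = monomial (v 2 0 0) 1 := by rw [← hmon]; simp
  have e4 : (X 1 ^ 2 : MvPolynomial (Fin 3) k) = monomial (v 0 2 0) 1 := by rw [← hmon]; simp
  have e5 : (X 2 ^ 2 : MvPolynomial (Fin 3) k) = monomial (v 0 0 2) 1 := by rw [← hmon]; simp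
  have e6 : (X 0 * X 1 : MvPolynomial (Fin 3) k) = monomial (v 1 1 0) 1 := by rw [← hmon]; simp
  have e7 : (X 0 * X 2 : MvPolynomial (Fin 3) k) = monomial (v 1 0 1) 1 := by rw [← hmon]; simp
  have e8 : (X 1 * X 2 : MvPolynomial (Fin 3) k) = monomial (v 0 1 1) 1 := by rw [← hmon]; simp
  have s2 : (Finsupp.single 0 2 : Fin 3 →₀ ℕ) = v 2 0 0 := by
    ext i; fin_cases i <;> simp [v]
  have s11 : (Finsupp.single 0 1 + Finsupp.single 1 1 : Fin 3 →₀ ℕ) = v 1 1 0 := by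
    ext i; fin_cases i <;> simp [v]
  have s1 : (Finsupp.single 0 1 : Fin 3 →₀ ℕ) = v 1 0 0 := by
    ext i; fin_cases i <;> simp [v]
  have s0 : (0 : Fin 3 →₀ ℕ) = v 0 0 0 := by
    ext i; fin_cases i <;> simp [v]
  have hveq : ∀ a b c a' b' c', v a b c = v a' b' c' ↔ a = a' ∧ b = b' ∧ c = c' := by
    intro a b c a' b' c'
    simp [v]
  have t1 : coeff (v 0 1 0) R = coeff (v 1 0 0) R :=
    hs _ h01 _ _ fun i => by fin_cases i <;> rfl
  have t2 : coeff (v 0 0 1) R = coeff (v 1 0 0) R :=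
    hs _ h02 _ _ fun i => by fin_cases i <;> rfl
  have t3 : coeff (v 0 2 0) R = coeff (v 2 0 0) R :=
    hs _ h01 _ _ fun i => by fin_cases i <;> rfl
  have t4 : coeff (v 0 0 2) R = coeff (v 2 0 0) R :=
    hs _ h02 _ _ fun i => by fin_cases i <;> rfl
  have t5 : coeff (v 0 1 1) R = coeff (v 1 1 0) R :=
    hs _ h02 _ _ fun i => by fin_cases i <;> rfl
  have t6 : coeff (v 1 0 1) R = coeff (v 0 1 1) R :=
    hs _ h01 _ _ fun i => by fin_cases i <;> rfl
  have hC : ∀ c : k, (C c : MvPolynomial (Fin 3) k) = monomial (v 0 0 0) c := by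
    intro c; rw [← s0]; rfl
  rw [s2, s11, s1, s0, e3, e4, e5, e6, e7, e8, e0, e1, e2, hC (coeff (v 0 0 0) R)]
  ext m
  have hm := hR m
  rw [hv m] at hm ⊢
  have hdeg : (v (m 0) (m 1) (m 2)).degree = m 0 + m 1 + m 2 := by
    rw [Finsupp.degree_eq_sum, Fin.sum_univ_three]; rfl
  rw [hdeg] at hm
  generalize m 0 = a at *
  generalize m 1 = b at *
  generalize m 2 = c at *
  simp only [coeff_add, coeff_C_mul, coeff_monomial, hveq]
  by_cases h : 3 ≤ a + b + c
  · rw [hm h]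
    have : ∀ a' b' c', a' + b' + c' ≤ 2 → ¬ (a' = a ∧ b' = b ∧ c' = c) := by omega
    simp [this]
  · have ha : a ≤ 2 := by omega
    have hb : b ≤ 2 := by omega
    have hc : c ≤ 2 := by omega
    interval_cases a <;> interval_cases b <;> interval_cases c <;>
      first | (exfalso; omega) | simp [t1, t2, t3, t4, t5, t6]

section

variable {k : Type} [Field k]

theorem MvPolynomial.eq_of_associated_of_leadingForm_eq {ι : Type*} {P Q : MvPolynomial ι k}
    (hP : P ≠ 0) (h : Associated P Q) (hl : leadingForm P = leadingForm Q) : P = Q := by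
  obtain ⟨u, rfl⟩ := h
  obtain ⟨c, -, hc⟩ := isUnit_iff_eq_C_of_isReduced.1 u.isUnit
  rw [hc] at hl ⊢
  rw [leadingForm_mul, leadingForm_C] at hl
  rw [mul_left_cancel₀ (leadingForm_ne_zero hP) ((mul_one _).trans hl).symm, mul_one]

theorem isUnit_of_dvd_leadingForm {a : k} (ha : a ≠ 0) {g T Ψ : MvPolynomial (Fin 3) k}
    (hg : IsUnit g ∨ Irreducible g) (hT0 : T ≠ 0) (hΨ : Ψ = C a * (delta3 k ^ 3 * g ^ 4))
    (hT : T ∣ Ψ) (hgT : Irreducible g → ¬ g ∣ T)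
    (hl : ∀ i j : Fin 3, i < j → ¬ X i + X j ∣ T) : IsUnit T := by
  by_contra hu
  obtain ⟨q, hq, hqT⟩ := WfDvdMonoid.exists_irreducible_factor hu hT0
  have hlq : ∀ i j : Fin 3, i < j → ¬ q ∣ X i + X j := fun i j hij hd =>
    hl i j hij (((hq.dvd_irreducible_iff_associated
      (irreducible_X_add_X hij.ne)).1 hd).symm.dvd.trans hqT)
  have hd := hqT.trans hT
  rw [hΨ] at hd
  rcases hq.prime.dvd_or_dvd hd with hd | hd
  · exact hq.not_isUnit (isUnit_of_dvd_unit hd ((isUnit_iff_ne_zero.2 ha).map C))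
  rcases hq.prime.dvd_or_dvd hd with hd | hd
  · have hd := hq.prime.dvd_of_dvd_pow hd
    rw [delta3] at hd
    rcases hq.prime.dvd_or_dvd hd with hd | hd
    · exact (hq.prime.dvd_or_dvd hd).elim (hlq 0 1 (by decide)) (hlq 0 2 (by decide))
    · exact hlq 1 2 (by decide) hd
  · have hd := hq.prime.dvd_of_dvd_pow hd
    rcases hg with hg | hg
    · exact hq.not_isUnit (isUnit_of_dvd_unit hd hg)
    · exact hgT hg (((hq.dvd_irreducible_iff_associated hg).1 hd).symm.dvd.trans hqT)

/-- The cubic `(x + y) (y + z) (z + x)` plus a symmetric quadratic polynomial. -/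
noncomputable def symmCubic {k : Type} [CommRing k] (c1 c4 b1 d : k) : MvPolynomial (Fin 3) k :=
  (X 0 + X 1) * (X 1 + X 2) * (X 2 + X 0) +
    (C c1 * (X 0 ^ 2 + X 1 ^ 2 + X 2 ^ 2) +
      C c4 * (X 0 * X 1 + X 0 * X 2 + X 1 * X 2) +
      C b1 * (X 0 + X 1 + X 2) + C d)

theorem delta3_dvd_of_X_add_X_dvd [CharP k 2] {Φ : MvPolynomial (Fin 3) k}
    (hτ : ∀ π : Equiv.Perm (Fin 3), rename π Φ = Φ) {i j : Fin 3} (hij : i ≠ j) (c : k)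
    (h : X i + X j + C c ∣ Φ) :
    (X 0 + X 1 + C c) * (X 0 + X 2 + C c) * (X 1 + X 2 + C c) ∣ Φ := by
  have key : ∀ π : Equiv.Perm (Fin 3), X (π i) + X (π j) + C c ∣ Φ := by
    intro π
    have := map_dvd (rename π) h
    rwa [hτ, map_add, map_add, rename_X, rename_X, rename_C] at this
  have hperm : ∀ i j i' j' : Fin 3, i ≠ j → i' ≠ j' →
      ∃ π : Equiv.Perm (Fin 3), π i = i' ∧ π j = j' := by decide
  have key2 : ∀ i' j' : Fin 3, i' ≠ j' → X i' + X j' + C c ∣ Φ := by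
    intro i' j' hij'
    obtain ⟨π, h1, h2⟩ := hperm i j i' j' hij hij'
    rw [← h1, ← h2]
    exact key π
  exact delta3_mul_dvd c (key2 0 1 (by decide)) (key2 0 2 (by decide)) (key2 1 2 (by decide))

theorem symmCubic_eq_mul [CharP k 2] (c : k) :
    symmCubic c c 0 (c ^ 3) = (X 0 + X 1 + C c) * (X 0 + X 2 + C c) * (X 1 + X 2 + C c) := by
  have two : (2 : MvPolynomial (Fin 3) k) = 0 := CharTwo.two_eq_zero
  rw [symmCubic, C_0, C_pow]
  generalize C c = u
  linear_combination (-u * (X 0 * X 1 + X 0 * X 2 + X 1 * X 2) - u ^ 2 * (X 0 + X 1 + X 2)) * two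

end

section

variable {k : Type} [Field k] [CharP k 2]

theorem exists_symmCubic_dvd_of_no_fixed_irreducible {a : k} (ha : a ≠ 0)
    {g Φ : MvPolynomial (Fin 3) k} (hg0 : g ≠ 0) (hg : IsUnit g ∨ Irreducible g)
    (hgl : ∀ i j : Fin 3, i < j → ¬ X i + X j ∣ g)
    (hΦ : leadingForm Φ = C a * (delta3 k ^ 3 * g ^ 4)) {s : k ≃+* k}
    (hσΦ : mapEquiv (Fin 3) s Φ = Φ) (hσg : mapEquiv (Fin 3) s g = g)
    (hτ : ∀ π : Equiv.Perm (Fin 3), rename π Φ = Φ)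
    (hno : ∀ P, Irreducible P → P ∣ Φ → ¬ Associated (mapEquiv (Fin 3) s P) P) :
    ∃ c1 c4 b1 d : k, (∀ c ∈ [c1, c4, b1, d], s (s (s c)) = c) ∧ symmCubic c1 c4 b1 d ∣ Φ := by
  obtain ⟨P, hP, hPΦ, hP1, hPle, hP23, hgP, hPσ, hPσσ, hσσσ, horb⟩ :=
    exists_orbit_of_no_fixed_irreducible ha hg0 hgl hΦ hσΦ hσg hτ hno
  have hLP0 := leadingForm_ne_zero hP.ne_zero
  have hΦ0 : C a * (delta3 k ^ 3 * g ^ 4) ≠ 0 :=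
    mul_ne_zero ((map_ne_zero_iff _ (C_injective _ _)).2 ha)
      (mul_ne_zero (pow_ne_zero 3 delta3_ne_zero) (pow_ne_zero 4 hg0))
  have hLPΦ : leadingForm P ∣ C a * (delta3 k ^ 3 * g ^ 4) := by
    obtain ⟨R, rfl⟩ := hPΦ
    rw [← hΦ, leadingForm_mul]
    exact dvd_mul_right _ _
  -- a divisor `A` of the leading form of `P` absorbing all the linear factors is associated to it
  have hscale : ∀ A : MvPolynomial (Fin 3) k, A ∣ leadingForm P →
      (∀ i j : Fin 3, i < j → multiplicity (X i + X j) A = formOrd (X i + X j) P) →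
      ∃ Q, Associated Q P ∧ leadingForm Q = A := by
    rintro A ⟨T, hT⟩ hA
    have hT0 : A * T ≠ 0 := hT ▸ hLP0
    have hTu : IsUnit T := by
      refine isUnit_of_dvd_leadingForm ha hg (right_ne_zero_of_mul hT0) rfl
        ((Dvd.intro_left _ hT.symm).trans hLPΦ)
        (fun hgi hgT => hgP hgi (hgT.trans (Dvd.intro_left _ hT.symm))) fun i j hij hd => ?_
      have hl := irreducible_X_add_X (k := k) hij.ne
      have h1 := hA i j hij
      rw [formOrd, hT, multiplicity_mul hl.prime (.of_prime_left hl.prime hT0)] at h1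
      exact multiplicity_ne_zero.2 hd (by omega)
    obtain ⟨b, hb, rfl⟩ := isUnit_iff_eq_C_of_isReduced.1 hTu
    have hb0 := hb.ne_zero
    refine ⟨C b⁻¹ * P, ?_, ?_⟩
    · exact associated_unit_mul_left _ _ ((isUnit_iff_ne_zero.2 (inv_ne_zero hb0)).map C)
    · rw [leadingForm_mul, leadingForm_C, hT, mul_left_comm, ← C_mul, inv_mul_cancel₀ hb0, C_1,
        mul_one]
  have h01 : (0 : Fin 3) < 1 := by decide
  have h02 : (0 : Fin 3) < 2 := by decide
  have h12 : (1 : Fin 3) < 2 := by decide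
  have hsC : ∀ Q : MvPolynomial (Fin 3) k, mapEquiv (Fin 3) s Q = map (s : k →+* k) Q :=
    fun Q => rfl
  have hdvd : X 0 + X 1 ∣ leadingForm P := multiplicity_ne_zero.1 (hP1.trans_ne one_ne_zero)
  have hassoc : ∀ {A B : MvPolynomial (Fin 3) k}, Associated A B →
      Associated (mapEquiv (Fin 3) s A) (mapEquiv (Fin 3) s B) := fun h => h.map _
  rcases Nat.le_one_iff_eq_zero_or_eq_one.1 (hPle 0 2 h02) with h2 | h2
  · obtain ⟨Q, hQP, hQ⟩ := hscale (X 0 + X 1) hdvd (by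
      intro i j hij
      have hz : ∀ {i' j' : Fin 3}, 1 ≠ i' → 1 ≠ j' → (0 = i' ∨ 0 = j') → i' ≠ j' →
          multiplicity (X i' + X j' : MvPolynomial (Fin 3) k) (X 0 + X 1) = 0 :=
        fun h1 h2 h3 h4 => multiplicity_eq_zero.2 (not_dvd_X_add_X h1 h2 h3 h4)
      fin_cases i <;> fin_cases j <;> simp at hij <;>
        simp only [Fin.zero_eta, Fin.mk_one, Fin.reduceFinMk]
      · rw [multiplicity_self, hP1]
      · rw [h2, hz (by decide) (by decide) (by decide) (by decide)]
      · rw [← hP23, h2, add_comm (X 0), multiplicity_eq_zero]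
        exact not_dvd_X_add_X (by decide) (by decide) (by decide) (by decide))
    have hQeq := eq_of_leadingForm_eq ((isHomogeneous_X k 0).add (isHomogeneous_X k 1))
      (irreducible_X_add_X h01.ne).ne_zero hQ
    set c := coeff 0 Q
    have hc : s (s (s c)) = c := by
      have h3 := (hassoc (hassoc (hassoc hQP))).trans (hσσσ.trans hQP.symm)
      rw [hQeq] at h3
      simp only [hsC, map_add, map_X, map_C, RingHom.coe_coe] at h3
      by_contra hne
      refine not_dvd_of_eval ![c, 0, 0] ?_ ?_ h3.symm.dvd
      · simp [CharTwo.add_self_eq_zero]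
      · simpa [CharTwo.add_eq_zero] using Ne.symm hne
    refine ⟨c, c, 0, c ^ 3, ?_, ?_⟩
    · simp [hc]
    · rw [symmCubic_eq_mul]
      refine delta3_dvd_of_X_add_X_dvd hτ (i := 0) (j := 1) (by decide) c ?_
      rw [← hQeq]
      exact hQP.dvd.trans hPΦ
  · obtain ⟨Q, hQP, hQ⟩ := hscale (delta3 k) (delta3_dvd hdvd
      (multiplicity_ne_zero.1 (h2.trans_ne one_ne_zero))
      (multiplicity_ne_zero.1 ((hP23.symm.trans h2).trans_ne one_ne_zero))) (by
      intro i j hij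
      rw [multiplicity_X_add_X_delta3 hij]
      fin_cases i <;> fin_cases j <;> simp at hij <;>
        simp only [Fin.zero_eta, Fin.mk_one, Fin.reduceFinMk]
      · rw [hP1]
      · rw [h2]
      · rw [← hP23, h2])
    have hQ0 : Q ≠ 0 := hQP.ne_zero_iff.2 hP.ne_zero
    have hd : (homogenizeHom (Fin 3) k Q).natDegree = 3 :=
      (leadingForm_isHomogeneous Q).inj_right (hQ ▸ delta3_isHomogeneous)
        (leadingForm_ne_zero hQ0)
    set σ := mapEquiv (Fin 3) s with hσ
    have hlσ : ∀ {R}, leadingForm R = delta3 k → leadingForm (σ R) = delta3 k := by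
      intro R hR
      rw [hσ, leadingForm_mapEquiv, hR, hsC, delta3_map]
    have hlτ : ∀ π : Equiv.Perm (Fin 3), leadingForm (rename π Q) = rename π (delta3 k) := by
      intro π
      rw [leadingForm_rename π.injective, hQ]
    have hσ3 : σ (σ (σ Q)) = Q := by
      symm
      refine eq_of_associated_of_leadingForm_eq hQ0 ?_ (by rw [hQ, hlσ (hlσ (hlσ hQ))])
      exact (hQP.trans hσσσ.symm).trans (hassoc (hassoc (hassoc hQP))).symm
    have hσ1 : σ Q ≠ Q := fun h => hPσ (hQP.symm.trans (h ▸ hassoc hQP))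
    have hswap : ∀ i j : Fin 3, rename (Equiv.swap i j) (delta3 k) = delta3 k →
        rename (Equiv.swap i j) Q = Q := by
      intro i j hij
      have hl := hlτ (Equiv.swap i j)
      rw [hij] at hl
      have hτQ : Associated (rename (Equiv.swap i j) Q) (rename (Equiv.swap i j) P) :=
        hQP.map (rename (Equiv.swap i j))
      have hcomm : ∀ R, rename (Equiv.swap i j) (σ R) = σ (rename (Equiv.swap i j) R) := by
        intro R
        rw [hσ, hsC, hsC, map_rename]
      have hinv : ∀ R : MvPolynomial (Fin 3) k,
          rename (Equiv.swap i j) (rename (Equiv.swap i j) R) = R := by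
        intro R
        rw [rename_rename]
        convert rename_id_apply R
        funext x
        simp
      have hτ0 : rename (Equiv.swap i j) Q ≠ 0 :=
        (map_ne_zero_iff _ (rename_injective _ (Equiv.swap i j).injective)).2 hQ0
      have hne : formOrd (X 0 + X 1) (rename (Equiv.swap i j) P) ≠ 0 := by
        rw [← formOrd_eq_of_associated (irreducible_X_add_X h01.ne) hτQ, formOrd, hl,
          multiplicity_X_add_X_delta3 h01]
        exact one_ne_zero
      rcases horb _ hne with h | h | h
      · exact eq_of_associated_of_leadingForm_eq hτ0 (hτQ.trans (h.trans hQP.symm))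
          (hl.trans hQ.symm)
      · have h1 : rename (Equiv.swap i j) Q = σ Q :=
          eq_of_associated_of_leadingForm_eq hτ0 (hτQ.trans (h.trans (hassoc hQP).symm))
            (hl.trans (hlσ hQ).symm)
        have h2 := hinv Q
        rw [h1, hcomm, h1] at h2
        exact absurd (by rw [h2] at hσ3; exact hσ3) hσ1
      · have h1 : rename (Equiv.swap i j) Q = σ (σ Q) :=
          eq_of_associated_of_leadingForm_eq hτ0 (hτQ.trans (h.trans (hassoc (hassoc hQP)).symm))
            (hl.trans (hlσ (hlσ hQ)).symm)
        have h2 := hinv Q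
        rw [h1, hcomm, hcomm, h1, hσ3] at h2
        exact absurd h2 hσ1
    have hs01 : rename (Equiv.swap 0 1 : Equiv.Perm (Fin 3)) (delta3 k) = delta3 k := by
      simp only [delta3, map_mul, map_add, rename_X, Equiv.swap_apply_left, Equiv.swap_apply_right,
        Equiv.swap_apply_of_ne_of_ne (show (2 : Fin 3) ≠ 0 by decide)
          (show (2 : Fin 3) ≠ 1 by decide)]
      ring
    have hs02 : rename (Equiv.swap 0 2 : Equiv.Perm (Fin 3)) (delta3 k) = delta3 k := by
      simp only [delta3, map_mul, map_add, rename_X, Equiv.swap_apply_left, Equiv.swap_apply_right,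
        Equiv.swap_apply_of_ne_of_ne (show (1 : Fin 3) ≠ 0 by decide)
          (show (1 : Fin 3) ≠ 2 by decide)]
      ring
    have hR := eq_of_degree_lt_three_of_symmetric (R := Q - delta3 k)
      (fun m hm => hQ ▸ coeff_sub_leadingForm_eq_zero (hd.trans_le hm))
      (by rw [map_sub, hs01, hswap 0 1 hs01]) (by rw [map_sub, hs02, hswap 0 2 hs02])
    have hσR : σ (σ (σ (Q - delta3 k))) = Q - delta3 k := by
      have hσδ : σ (delta3 k) = delta3 k := by rw [hσ, hsC, delta3_map]
      rw [map_sub, map_sub, map_sub, hσ3, hσδ, hσδ, hσδ]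
    have hcoef : ∀ m, s (s (s (coeff m (Q - delta3 k)))) = coeff m (Q - delta3 k) := by
      intro m
      conv_rhs => rw [← hσR, hσ, hsC, hsC, hsC, coeff_map, coeff_map, coeff_map]
      rfl
    refine ⟨coeff (.single 0 2) (Q - delta3 k), coeff (.single 0 1 + .single 1 1) (Q - delta3 k),
      coeff (.single 0 1) (Q - delta3 k), coeff 0 (Q - delta3 k), ?_, ?_⟩
    · simp only [List.mem_cons, List.not_mem_nil, or_false]
      rintro c (rfl | rfl | rfl | rfl) <;> exact hcoef _
    · refine Dvd.dvd.trans (dvd_of_eq ?_) (hQP.dvd.trans hPΦ)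
      conv_rhs => rw [← sub_add_cancel Q (delta3 k), hR]
      rw [symmCubic, delta3]
      ring

end

section

variable {k : Type}

theorem exists_perm_apply_eq (π : Equiv.Perm (Fin 3)) :
    (π 0 = 0 ∧ π 1 = 1 ∧ π 2 = 2) ∨ (π 0 = 0 ∧ π 1 = 2 ∧ π 2 = 1) ∨
    (π 0 = 1 ∧ π 1 = 0 ∧ π 2 = 2) ∨ (π 0 = 1 ∧ π 1 = 2 ∧ π 2 = 0) ∨
    (π 0 = 2 ∧ π 1 = 0 ∧ π 2 = 1) ∨ (π 0 = 2 ∧ π 1 = 1 ∧ π 2 = 0) := by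
  revert π
  decide

theorem rename_delta3 [CommRing k] (π : Equiv.Perm (Fin 3)) :
    rename π (delta3 k) = delta3 k := by
  simp only [delta3, map_mul, map_add, rename_X]
  rcases exists_perm_apply_eq π with h | h | h | h | h | h <;> obtain ⟨h0, h1, h2⟩ := h <;>
    rw [h0, h1, h2] <;> ring

theorem rename_phiNum [CommRing k] (π : Equiv.Perm (Fin 3)) (f : Polynomial k) :
    rename π (phiNum f) = phiNum f := by
  simp only [phiNum, map_add, ← Polynomial.aeval_algHom_apply, rename_X]
  have hs : (X (π 0) + X (π 1) + X (π 2) : MvPolynomial (Fin 3) k) = X 0 + X 1 + X 2 := by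
    rcases exists_perm_apply_eq π with h | h | h | h | h | h <;> obtain ⟨h0, h1, h2⟩ := h <;>
      rw [h0, h1, h2] <;> ring
  rw [hs]
  congr 1
  rcases exists_perm_apply_eq π with h | h | h | h | h | h <;> obtain ⟨h0, h1, h2⟩ := h <;>
    rw [h0, h1, h2] <;> ring

theorem map_powerForm [Field k] (s : k →+* k) (e : ℕ) :
    map s (powerForm k e) = powerForm k e := by
  simp [powerForm]

theorem not_X_add_X_dvd_of_delta3_mul_eq [Field k] [CharP k 2] [IsAlgClosed k] {e : ℕ}
    (he : e % 4 = 3) {g : MvPolynomial (Fin 3) k} (hg : delta3 k * g = powerForm k e)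
    {i j : Fin 3} (hij : i ≠ j) : ¬ X i + X j ∣ g := by
  intro hd
  have hl := irreducible_X_add_X (k := k) hij
  rcases isUnit_or_irreducible_of_delta3_mul_eq he hg with h | h
  · exact hl.not_isUnit (isUnit_of_dvd_unit hd h)
  · obtain ⟨u, hu⟩ := (hl.dvd_irreducible_iff_associated h).1 hd
    obtain ⟨c, hc, hcu⟩ := isUnit_iff_eq_C_of_isReduced.1 u.isUnit
    have h4 : (powerForm k e).IsHomogeneous (3 + (1 + 0)) := by
      rw [← hg, ← hu, hcu]
      exact delta3_isHomogeneous.mul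
        (((isHomogeneous_X k i).add (isHomogeneous_X k j)).mul (isHomogeneous_C _ c))
    have := h4.inj_right (powerForm_isHomogeneous e) (powerForm_ne_zero he)
    omega

end

section

theorem MvPolynomial.dvd_of_map_dvd_map {ι M k : Type*} [Field M] [CommRing k] [Nontrivial k]
    (i : M →+* k) {P Q : MvPolynomial ι M} (h : map i P ∣ map i Q) : P ∣ Q := by
  classical
  let := i.toAlgebra
  obtain ⟨r, hr⟩ := (Algebra.linearMap M k).exists_leftInverse_of_injective
    (LinearMap.ker_eq_bot.2 i.injective)
  have hr1 : ∀ x, r (i x) = x := fun x => LinearMap.congr_fun hr x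
  obtain ⟨T, hT⟩ := h
  have hR : ∀ m, coeff m (∑ n ∈ T.support, monomial n (r (coeff n T))) = r (coeff m T) := by
    intro m
    simp only [coeff_sum, coeff_monomial, Finset.sum_ite_eq', mem_support_iff]
    split_ifs with h
    · rfl
    · rw [not_not.1 h, map_zero]
  refine ⟨∑ n ∈ T.support, monomial n (r (coeff n T)), MvPolynomial.ext _ _ fun m => ?_⟩
  rw [← hr1 (coeff m Q), ← coeff_map, hT, coeff_mul, coeff_mul, map_sum]
  refine Finset.sum_congr rfl fun x _ => ?_
  rw [hR, coeff_map, ← smul_eq_mul (coeff x.1 P), ← map_smul, Algebra.smul_def]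
  rfl

theorem exists_ringHom_apply_eq_of_pow_card_eq {k F : Type*} [Field k] [IsAlgClosed k] {p t : ℕ}
    [Fact p.Prime] [CharP k p] (ht : 0 < t) [Field F] [Fintype F]
    (hF : Fintype.card F = p ^ t) (i : F →+* k) {c : k} (hc : c ^ p ^ t = c) : ∃ w, i w = c := by
  classical
  obtain ⟨s, hs, hmem⟩ := IsAlgClosed.exists_finset_card_eq_pow k p t ht
  have himg : Finset.univ.image i = s := by
    refine Finset.eq_of_subset_of_card_le (fun x hx => ?_) ?_
    · obtain ⟨w, -, rfl⟩ := Finset.mem_image.1 hx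
      rw [hmem, ← map_pow, ← hF, FiniteField.pow_card]
    · rw [hs, Finset.card_image_of_injective _ i.injective, Finset.card_univ, hF]
  rw [← hmem, ← himg] at hc
  simpa using hc

theorem MvPolynomial.exists_associated_map_iterateFrobenius_eq {ι k : Type*} [Field k]
    [IsAlgClosed k] {p n : ℕ} [Fact p.Prime] [CharP k p] (hn : 0 < n) {P : MvPolynomial ι k}
    (h : Associated (map (iterateFrobenius k p n) P) P) :
    ∃ Q, Associated Q P ∧ map (iterateFrobenius k p n) Q = Q := by
  have hq : 1 < p ^ n := Nat.one_lt_pow hn.ne' (Fact.out : p.Prime).one_lt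
  obtain ⟨u, hu⟩ := h
  obtain ⟨c, hc, hcu⟩ := isUnit_iff_eq_C_of_isReduced.1 u.isUnit
  obtain ⟨t, ht⟩ := IsAlgClosed.exists_pow_nat_eq c (Nat.sub_pos_of_lt hq)
  have ht0 : t ≠ 0 := by
    rintro rfl
    rw [zero_pow (Nat.sub_pos_of_lt hq).ne'] at ht
    exact hc.ne_zero ht.symm
  refine ⟨C t * P, associated_unit_mul_left _ _ ((isUnit_iff_ne_zero.2 ht0).map C), ?_⟩
  have hpow : t ^ p ^ n = c * t := by
    rw [← ht, ← pow_succ, Nat.sub_add_cancel hq.le]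
  conv_rhs => rw [← hu, hcu]
  rw [map_mul, map_C, iterateFrobenius_def, hpow, C_mul]
  ring

theorem MvPolynomial.map_iterateFrobenius_mul_eq {ι k : Type*} [CommRing k] {p n : ℕ}
    [ExpChar k p] {P : MvPolynomial ι k} (h : map (iterateFrobenius k p n) P = P) (m : ℕ) :
    map (iterateFrobenius k p (n * m)) P = P := by
  induction m with
  | zero => ext; simp [coeff_map]
  | succ m ih =>
    rw [Nat.mul_succ]
    ext x
    have h1 := congr_arg (coeff x) h
    have h2 := congr_arg (coeff x) ih
    rw [coeff_map, iterateFrobenius_def] at h1 h2 ⊢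
    rw [pow_add, pow_mul, h2, h1]

theorem exists_forall_exists_eval_eq_zero {k : Type} [Field k] [IsAlgClosed k] [CharP k 2]
    {n : ℕ} (hn : 0 < n) {P Φ : MvPolynomial (Fin 3) k} (hP : Irreducible P) (hPΦ : P ∣ Φ)
    (hPδ : ¬ P ∣ delta3 k) (h : Associated (map (iterateFrobenius k 2 n) P) P) :
    ∃ N, 0 < N ∧ ∀ m, N ≤ m → ∃ v : Fin 3 → k, (∀ i, v i ^ 2 ^ (n * m) = v i) ∧ eval v Φ = 0 ∧
      eval v (delta3 k) ≠ 0 := by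
  obtain ⟨Q, hQP, hQ⟩ := MvPolynomial.exists_associated_map_iterateFrobenius_eq hn h
  obtain ⟨N, hN⟩ := MvPolynomial.exists_rational_point_of_irreducible (p := 2)
    (hQP.irreducible_iff.2 hP) (fun hd => hPδ (hQP.symm.dvd.trans hd))
  refine ⟨N + 1, N.succ_pos, fun m hm => ?_⟩
  have hnm : m ≤ n * m := Nat.le_mul_of_pos_left m hn
  obtain ⟨v, hv, hv0, hvδ⟩ := hN (n * m) (by omega)
    (by have := Nat.lt_two_pow_self (n := n * m); omega) (map_iterateFrobenius_mul_eq hQ m)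
  obtain ⟨T, rfl⟩ := hQP.dvd.trans hPΦ
  exact ⟨v, hv, by rw [map_mul, hv0, zero_mul], hvδ⟩

theorem eval_phiNum {R : Type} [CommRing R] (w : Fin 3 → R) (f : Polynomial R) :
    eval w (phiNum f) = f.eval (w 0) + f.eval (w 1) + f.eval (w 2) +
      f.eval (w 0 + w 1 + w 2) := by
  simp only [phiNum, map_add, Polynomial.aeval_def, Polynomial.hom_eval₂, eval_X, algebraMap_eq]
  have : (eval w).comp C = RingHom.id R := by
    ext1 x
    simp
  simp [this, Polynomial.eval₂_id]

theorem not_isAPN_of_eval_eq_zero {F : Type} [Field F] [Fintype F] [CharP F 2]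
    {f : Polynomial F} {w : Fin 3 → F} (h0 : eval w (phiNum f) = 0)
    (hδ : eval w (delta3 F) ≠ 0) : ¬ IsAPN fun x => f.eval x := by
  classical
  intro h
  rw [eval_phiNum] at h0
  simp only [delta3, map_mul, map_add, eval_X, mul_ne_zero_iff] at hδ
  obtain ⟨⟨h01, h02⟩, h12⟩ := hδ
  refine absurd (h (w 0 + w 1) (f.eval (w 0) + f.eval (w 1)) h01) (not_le.2 ?_)
  have hsub : (({w 0, w 1, w 2} : Finset F) : Set F) ⊆
      {x | f.eval (x + (w 0 + w 1)) + f.eval x = f.eval (w 0) + f.eval (w 1)} := by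
    simp only [Finset.coe_insert, Finset.coe_singleton, Set.insert_subset_iff,
      Set.singleton_subset_iff, Set.mem_ofPred_eq]
    refine ⟨?_, ?_, ?_⟩
    · rw [← add_assoc, CharTwo.add_self_eq_zero, zero_add, add_comm]
    · rw [add_left_comm, CharTwo.add_self_eq_zero, add_zero]
    · rw [← sub_eq_zero, CharTwo.sub_eq_add, ← h0, add_comm (w 2)]
      ring
  have hcard : ({w 0, w 1, w 2} : Finset F).card = 3 :=
    Finset.card_eq_three.2 ⟨_, _, _, fun h => h01 (CharTwo.add_eq_zero.2 h),
      fun h => h02 (CharTwo.add_eq_zero.2 h), fun h => h12 (CharTwo.add_eq_zero.2 h), rfl⟩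
  have := Set.ncard_le_ncard hsub (Set.toFinite _)
  rw [Set.ncard_coe_finset, hcard] at this
  exact this

end

section

theorem exists_X_add_X_dvd_of_dvd_delta3 {k : Type} [Field k] {P : MvPolynomial (Fin 3) k}
    (hP : Irreducible P) (h : P ∣ delta3 k) : ∃ i j : Fin 3, i ≠ j ∧ X i + X j ∣ P := by
  have key : ∀ i j : Fin 3, i ≠ j → P ∣ X i + X j → X i + X j ∣ P := fun i j hij hd =>
    ((hP.dvd_irreducible_iff_associated (irreducible_X_add_X hij)).1 hd).symm.dvd
  rcases hP.prime.dvd_or_dvd h with h | h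
  · rcases hP.prime.dvd_or_dvd h with h | h
    · exact ⟨0, 1, by decide, key 0 1 (by decide) h⟩
    · exact ⟨0, 2, by decide, key 0 2 (by decide) h⟩
  · exact ⟨1, 2, by decide, key 1 2 (by decide) h⟩

theorem exists_ringHom_comp_eq_algebraMap {L F : Type} [Field L] [Field F] [Finite F]
    (e : L →+* F) : ∃ i : F →+* AlgebraicClosure L, i.comp e = algebraMap L _ := by
  let := e.toAlgebra
  have : Module.Finite L F := Module.Finite.of_finite
  exact ⟨(IsAlgClosed.lift : F →ₐ[L] AlgebraicClosure L), AlgHom.comp_algebraMap _⟩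

end

/-- Let `L = F_q`, `q = 2^n`, and `f ∈ L[x]` of degree `4e` with
`e ≡ 3 (mod 4)`. Suppose no polynomial of the form `(x+y)(y+z)(z+x) + P`, where
`P = c₁(x²+y²+z²) + c₄(xy+xz+yz) + b₁(x+y+z) + d` with `c₁, c₄, b₁, d ∈ F_{q³}`,
divides `φ`. Then there is `N` such that for all `m ≥ N` the function induced by `f`
on `F_{q^m}` is not APN. -/
theorem not_apn_eventually_of_degree_four_e {n : ℕ} (hn : 0 < n) (L : Type)
    [Field L] [Fintype L] (hcard : Fintype.card L = 2 ^ n) (f : Polynomial L)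
    (e : ℕ) (he : e % 4 = 3) (hdeg : f.natDegree = 4 * e)
    (φ : MvPolynomial (Fin 3) L) (hφ : delta3 L * φ = phiNum f)
    (M : Type) [Field M] [Fintype M] (emb : L →+* M)
    (hM : Fintype.card M = Fintype.card L ^ 3)
    (hnodiv : ∀ c1 c4 b1 d : M,
      ¬ ((X 0 + X 1) * (X 1 + X 2) * (X 2 + X 0) +
          (C c1 * (X 0 ^ 2 + X 1 ^ 2 + X 2 ^ 2) +
            C c4 * (X 0 * X 1 + X 0 * X 2 + X 1 * X 2) +
            C b1 * (X 0 + X 1 + X 2) + C d) ∣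
        MvPolynomial.map emb φ)) :
    NotAPNOnAllLargeExtensions f := by
  have hL2 : CharP L 2 := charP_of_card_eq_prime_pow hcard
  let k := AlgebraicClosure L
  have hk2 : CharP k 2 := charP_of_injective_algebraMap (algebraMap L k).injective 2
  let Φ : MvPolynomial (Fin 3) k := map (algebraMap L k) φ
  have hΦ : delta3 k * Φ = phiNum (f.map (algebraMap L k)) := by
    rw [phiNum_map, ← hφ, map_mul, delta3_map]
  have hno : ∀ c1 c4 b1 d : k, c1 ^ 2 ^ (n * 3) = c1 → c4 ^ 2 ^ (n * 3) = c4 →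
      b1 ^ 2 ^ (n * 3) = b1 → d ^ 2 ^ (n * 3) = d → ¬ symmCubic c1 c4 b1 d ∣ Φ := by
    intro c1 c4 b1 d h1 h2 h3 h4 hdvd
    obtain ⟨i, hi⟩ := exists_ringHom_comp_eq_algebraMap emb
    have hcM : Fintype.card M = 2 ^ (n * 3) := by rw [hM, hcard, pow_mul]
    have hlift : ∀ c : k, c ^ 2 ^ (n * 3) = c → ∃ w, i w = c := fun c hc =>
      exists_ringHom_apply_eq_of_pow_card_eq (by omega) hcM i hc
    obtain ⟨c1, rfl⟩ := hlift c1 h1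
    obtain ⟨c4, rfl⟩ := hlift c4 h2
    obtain ⟨b1, rfl⟩ := hlift b1 h3
    obtain ⟨d, rfl⟩ := hlift d h4
    refine hnodiv c1 c4 b1 d (dvd_of_map_dvd_map i ?_)
    rw [map_map, hi]
    simpa [symmCubic] using hdvd
  have hτ : ∀ π : Equiv.Perm (Fin 3), rename π Φ = Φ := by
    intro π
    refine mul_left_cancel₀ (delta3_ne_zero (k := k)) ?_
    rw [hΦ, ← rename_phiNum π, ← hΦ, map_mul, rename_delta3]
  let s : k ≃+* k := iterateFrobeniusEquiv k 2 n
  have hs : ∀ c, s c = c ^ 2 ^ n := fun c => rfl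
  by_cases hfix : ∃ P, Irreducible P ∧ P ∣ Φ ∧ Associated (mapEquiv (Fin 3) s P) P
  · obtain ⟨P, hP, hPΦ, hPs⟩ := hfix
    have hPδ : ¬ P ∣ delta3 k := by
      intro hd
      obtain ⟨i, j, hij, hl⟩ := exists_X_add_X_dvd_of_dvd_delta3 hP hd
      refine hno 0 0 0 (0 ^ 3) ?_ ?_ ?_ ?_ (symmCubic_eq_mul (k := k) 0 ▸
        delta3_dvd_of_X_add_X_dvd hτ hij 0 ?_)
      all_goals try simp
      exact hl.trans hPΦ
    obtain ⟨N, hN0, hN⟩ := exists_forall_exists_eval_eq_zero hn hP hPΦ hPδ hPs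
    refine ⟨N, fun m hm F _ _ e hF => ?_⟩
    obtain ⟨v, hv, hv0, hvδ⟩ := hN m hm
    obtain ⟨i, hi⟩ := exists_ringHom_comp_eq_algebraMap e
    rw [hcard, ← pow_mul] at hF
    have hF2 : CharP F 2 := charP_of_card_eq_prime_pow hF
    choose w hw using fun j => exists_ringHom_apply_eq_of_pow_card_eq
      (Nat.mul_pos hn (hN0.trans_le hm)) hF i (hv j)
    obtain rfl : v = i ∘ w := funext fun j => (hw j).symm
    refine not_isAPN_of_eval_eq_zero (w := w) (i.injective ?_) fun h => hvδ ?_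
    · rw [eval₂_comp, ← eval_map, ← phiNum_map, Polynomial.map_map, hi, ← hΦ, map_mul, hv0,
        mul_zero, map_zero]
    · rw [← delta3_map i, eval_map, ← eval₂_comp, h, map_zero]
  · exfalso
    obtain ⟨g, hg⟩ := delta3_dvd_powerForm (k := k) e
    have hg0 : g ≠ 0 := by
      rintro rfl
      exact powerForm_ne_zero he (by rw [hg, mul_zero])
    have hlead := leadingForm_of_delta3_mul_eq_phiNum he
      ((Polynomial.natDegree_map (algebraMap L k)).trans hdeg) hΦ hg.symm
    have ha : (f.map (algebraMap L k)).leadingCoeff ≠ 0 := by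
      rw [Polynomial.leadingCoeff_ne_zero]
      intro h0
      have := (Polynomial.natDegree_map (algebraMap L k)).trans hdeg
      rw [h0, Polynomial.natDegree_zero] at this
      omega
    obtain ⟨c1, c4, b1, d, hc, hdvd⟩ := exists_symmCubic_dvd_of_no_fixed_irreducible ha hg0
      (isUnit_or_irreducible_of_delta3_mul_eq he hg.symm)
      (fun i j hij => not_X_add_X_dvd_of_delta3_mul_eq he hg.symm hij.ne) hlead (s := s)
      (by
        change map (s : k →+* k) (map _ φ) = map _ φ
        rw [map_map]
        congr 2
        ext x
        change algebraMap L k x ^ 2 ^ n = _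
        rw [← map_pow, ← hcard, FiniteField.pow_card])
      (by
        refine mul_left_cancel₀ (delta3_ne_zero (k := k)) ?_
        change delta3 k * map (s : k →+* k) g = _
        rw [← hg, ← map_powerForm (s : k →+* k) e, hg, map_mul, delta3_map])
      hτ fun P hP hPΦ hPs => hfix ⟨P, hP, hPΦ, hPs⟩
    have hc3 : ∀ c : k, s (s (s c)) = c → c ^ 2 ^ (n * 3) = c := by
      intro c hc
      rw [hs, hs, hs, ← pow_mul, ← pow_mul, ← pow_add, ← pow_add] at hc
      rwa [show n * 3 = n + (n + n) by ring]
    simp only [List.mem_cons, List.not_mem_nil, or_false, forall_eq_or_imp, forall_eq] at hc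
    exact hno c1 c4 b1 d (hc3 _ hc.1) (hc3 _ hc.2.1) (hc3 _ hc.2.2.1) (hc3 _ hc.2.2.2) hdvd
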